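/- arXiv:2506.10471 — 2 statements merged into one kernel-verified Lean document; each statement's English description precedes it below -/
import Mathlib

section
/- Let G be a planar graph of order n. Then s_{K4}(G) − s_o(G) ≤ (1/5)·s_{K4}(G) ≤ n/5. -/
/-- A drawing (embedding) of a simple graph in the plane `ℝ × ℝ` without crossings:
vertices are mapped to distinct points, each edge to an injective arc joining its
endpoints, arcs pass through no other vertex, and two arcs of distinct edges meet
only in common endpoints. -/
structure PlaneEmbedding {V : Type} (G : SimpleGraph V) where
  vtx : V → ℝ × ℝ
  vtx_inj : Function.Injective vtx
  arc : ∀ ⦃u v : V⦄, G.Adj u v → Set (ℝ × ℝ)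
  arc_symm : ∀ ⦃u v : V⦄ (h : G.Adj u v), arc h.symm = arc h
  arc_path : ∀ ⦃u v : V⦄ (h : G.Adj u v),
    ∃ γ : Path (vtx u) (vtx v), Function.Injective ⇑γ ∧ Set.range ⇑γ = arc h
  arc_vtx : ∀ ⦃u v : V⦄ (h : G.Adj u v) (w : V), vtx w ∈ arc h → w = u ∨ w = v
  arc_inter : ∀ ⦃u v a b : V⦄ (h₁ : G.Adj u v) (h₂ : G.Adj a b), s(u, v) ≠ s(a, b) →
    arc h₁ ∩ arc h₂ ⊆ ({vtx u, vtx v} : Set (ℝ × ℝ)) ∩ {vtx a, vtx b}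

namespace PlaneEmbedding

variable {V : Type} {G : SimpleGraph V}

/-- The point set of the sub-drawing determined by the vertices in `S`
(the inherited embedding of the induced subgraph on `S`). -/
def subSupport (E : PlaneEmbedding G) (S : Set V) : Set (ℝ × ℝ) :=
  E.vtx '' S ∪ ⋃ (u : V) (_ : u ∈ S) (v : V) (_ : v ∈ S) (h : G.Adj u v), E.arc h

/-- The induced subgraph on `S`, with the inherited embedding, is an outerplane graph:
every vertex of `S` lies on the boundary of the outer (unbounded) face, i.e. in the
closure of the set of points belonging to unbounded faces of the sub-drawing. -/
def OuterplaneOn (E : PlaneEmbedding G) (S : Set V) : Prop :=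
  ∀ v ∈ S, E.vtx v ∈ closure {p | p ∉ E.subSupport S ∧
    ¬ Bornology.IsBounded (connectedComponentIn (E.subSupport S)ᶜ p)}

/-- The whole drawing is an outerplane graph. -/
def IsOuterplane (E : PlaneEmbedding G) : Prop := E.OuterplaneOn Set.univ

end PlaneEmbedding

/-- A graph is planar if it admits a plane embedding. -/
def IsPlanar {V : Type} (G : SimpleGraph V) : Prop := Nonempty (PlaneEmbedding G)

/-- A graph is outerplanar if it admits a plane embedding with all vertices on the
boundary of the outer face. -/
def IsOuterplanar {V : Type} (G : SimpleGraph V) : Prop :=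
  ∃ E : PlaneEmbedding G, E.IsOuterplane

/-- A plane triangulation is an edge-maximal (finite) planar graph. -/
def IsPlaneTriangulation {V : Type} (G : SimpleGraph V) : Prop :=
  IsPlanar G ∧ ∀ u v : V, u ≠ v → ¬ G.Adj u v →
    ¬ IsPlanar (G ⊔ SimpleGraph.fromEdgeSet {s(u, v)})

/-- `G` has a `K_m`-minor: there are `m` pairwise disjoint nonempty connected branch
sets with an edge between any two of them. -/
def HasCliqueMinor {V : Type} (G : SimpleGraph V) (m : ℕ) : Prop :=
  ∃ B : Fin m → Set V,
    (∀ i, (B i).Nonempty) ∧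
    (∀ i, (G.induce (B i)).Connected) ∧
    (∀ i j, i ≠ j → Disjoint (B i) (B j)) ∧
    (∀ i j, i ≠ j → ∃ u ∈ B i, ∃ v ∈ B j, G.Adj u v)

/-- `G` is `K₄`-minor free. -/
def K4MinorFree {V : Type} (G : SimpleGraph V) : Prop := ¬ HasCliqueMinor G 4

/-- `s_{o'}(G)` for a fixed plane embedding of `G`: the maximum order of an induced
subgraph whose inherited embedding is an outerplane graph. -/
noncomputable def sO' {V : Type} [Fintype V] {G : SimpleGraph V}
    (E : PlaneEmbedding G) : ℕ :=
  sSup {n | ∃ S : Finset V, E.OuterplaneOn ↑S ∧ S.card = n}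

/-- `s_o(G)`: the maximum order of an induced outerplanar subgraph of `G`. -/
noncomputable def sO {V : Type} [Fintype V] (G : SimpleGraph V) : ℕ :=
  sSup {n | ∃ S : Finset V, IsOuterplanar (G.induce (↑S : Set V)) ∧ S.card = n}

/-- `s_{K₄}(G)`: the maximum order of an induced `K₄`-minor-free subgraph of `G`. -/
noncomputable def sK4 {V : Type} [Fintype V] (G : SimpleGraph V) : ℕ :=
  sSup {n | ∃ S : Finset V, K4MinorFree (G.induce (↑S : Set V)) ∧ S.card = n}

/-- `tw(G) ≤ k`: `G` admits a tree decomposition of width at most `k`. -/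
def TreewidthLE {V : Type} (G : SimpleGraph V) (k : ℕ) : Prop :=
  ∃ (ι : Type) (T : SimpleGraph ι) (bag : ι → Set V),
    T.IsTree ∧
    (∀ v : V, ∃ i, v ∈ bag i) ∧
    (∀ u v : V, G.Adj u v → ∃ i, u ∈ bag i ∧ v ∈ bag i) ∧
    (∀ v : V, (T.induce {i | v ∈ bag i}).Connected) ∧
    (∀ i, (bag i).ncard ≤ k + 1)

/-- `G` is a `k`-tree: its vertices admit a construction order in which the first
`k+1` vertices form a complete graph and every later vertex is joined to exactly
`k` earlier, pairwise adjacent, vertices. -/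
def IsKTree (k : ℕ) {V : Type} (G : SimpleGraph V) : Prop :=
  ∃ (n : ℕ) (e : Fin n ≃ V), k + 1 ≤ n ∧
    (∀ i j : Fin n, (i : ℕ) < k + 1 → (j : ℕ) < k + 1 → i ≠ j → G.Adj (e i) (e j)) ∧
    (∀ j : Fin n, k + 1 ≤ (j : ℕ) →
      {i : Fin n | i < j ∧ G.Adj (e i) (e j)}.ncard = k ∧
      (∀ i i' : Fin n, i < j → i' < j → G.Adj (e i) (e j) → G.Adj (e i') (e j) →
        i ≠ i' → G.Adj (e i) (e i')))

/-- `S` is a dominating set of `G`. -/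
def IsDomSet {V : Type} (G : SimpleGraph V) (S : Set V) : Prop :=
  ∀ v : V, v ∈ S ∨ ∃ u ∈ S, G.Adj u v

/-- `S` is a connected dominating set of `G`. -/
def IsConnDomSet {V : Type} (G : SimpleGraph V) (S : Set V) : Prop :=
  IsDomSet G S ∧ (G.induce S).Connected

/-- The domination number `γ(G)`. -/
noncomputable def domNum {V : Type} [Fintype V] (G : SimpleGraph V) : ℕ :=
  sInf {n | ∃ S : Finset V, IsDomSet G ↑S ∧ S.card = n}

/-- The connected domination number `γ_c(G)`. -/
noncomputable def connDomNum {V : Type} [Fintype V] (G : SimpleGraph V) : ℕ :=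
  sInf {n | ∃ S : Finset V, IsConnDomSet G ↑S ∧ S.card = n}

/-- A graph is Eulerian if every vertex has even degree. -/
def IsEulerian {V : Type} (G : SimpleGraph V) : Prop :=
  ∀ v : V, Even (G.neighborSet v).ncard

/-- `G` contains a subgraph isomorphic to `H`. -/
def ContainsCopy {W V : Type} (H : SimpleGraph W) (G : SimpleGraph V) : Prop :=
  ∃ f : H →g G, Function.Injective ⇑f

/-- The complete tripartite graph `K_{1,1,3}`. -/
def K113 : SimpleGraph (Fin 5) :=
  SimpleGraph.fromEdgeSet {s(0, 1), s(0, 2), s(0, 3), s(0, 4), s(1, 2), s(1, 3), s(1, 4)}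

/-- `G` is a maximal outerplanar graph. -/
def IsMaximalOuterplanar {V : Type} (G : SimpleGraph V) : Prop :=
  IsOuterplanar G ∧ ∀ u v : V, u ≠ v → ¬ G.Adj u v →
    ¬ IsOuterplanar (G ⊔ SimpleGraph.fromEdgeSet {s(u, v)})

/-- The chord of the parabola `y = x ^ 2` over `[s, t]`, written as a graph over its abscissa. -/
theorem mem_segment_parabola {s t : ℝ} (p : ℝ × ℝ)
    (hp : p ∈ segment ℝ ((s, s ^ 2) : ℝ × ℝ) (t, t ^ 2)) :
    p.2 - p.1 ^ 2 = (p.1 - s) * (t - p.1) ∧ 0 ≤ (p.1 - s) * (t - p.1) := by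
  obtain ⟨a, b, ha, hb, hab, rfl⟩ := hp
  obtain rfl : a = 1 - b := by linarith
  have h : ((1 - b) * s + b * t - s) * (t - ((1 - b) * s + b * t)) =
      (1 - b) * b * (t - s) ^ 2 := by ring
  refine ⟨?_, ?_⟩
  · simp only [Prod.smul_mk, Prod.mk_add_mk, smul_eq_mul]
    ring
  · simp only [Prod.smul_mk, Prod.mk_add_mk, smul_eq_mul]
    rw [h]
    positivity

/-- Two non-crossing chords of the parabola can only meet in a common endpoint. -/
theorem eq_endpoint_of_mem_chords {s t a b x y : ℝ} (hst : s < t) (hab : a < b)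
    (hne : ¬ (s = a ∧ t = b))
    (h₁ : ¬ (s < a ∧ a < t ∧ t < b)) (h₂ : ¬ (a < s ∧ s < b ∧ b < t))
    (hx₁ : y - x ^ 2 = (x - s) * (t - x)) (hn₁ : 0 ≤ (x - s) * (t - x))
    (hx₂ : y - x ^ 2 = (x - a) * (b - x)) (hn₂ : 0 ≤ (x - a) * (b - x)) :
    (x = s ∨ x = t) ∧ (x = a ∨ x = b) := by
  have hs : s ≤ x := by by_contra! h; nlinarith
  have ht : x ≤ t := by by_contra! h; nlinarith
  have ha : a ≤ x := by by_contra! h; nlinarith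
  have hb : x ≤ b := by by_contra! h; nlinarith
  have heq : (x - s) * (t - x) = (x - a) * (b - x) := hx₁.symm.trans hx₂
  suffices h : (x - s) * (t - x) = 0 by
    refine ⟨?_, ?_⟩
    · rcases mul_eq_zero.1 h with h | h
      · left; linarith
      · right; linarith
    · rcases mul_eq_zero.1 (heq ▸ h) with h | h
      · left; linarith
      · right; linarith
  by_contra hpos
  have hpos' : 0 < (x - s) * (t - x) := lt_of_le_of_ne hn₁ (Ne.symm hpos)
  have hs' : s < x := lt_of_le_of_ne hs (by rintro rfl; simp at hpos)
  have ht' : x < t := lt_of_le_of_ne ht (by rintro rfl; simp at hpos)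
  have ha' : a < x := lt_of_le_of_ne ha (by rintro rfl; simp [heq] at hpos)
  have hb' : x < b := lt_of_le_of_ne hb (by rintro rfl; simp [heq] at hpos)
  rcases lt_trichotomy s a with h | rfl | h
  · have : b ≤ t := by by_contra! h'; exact h₁ ⟨h, by linarith, h'⟩
    nlinarith
  · have : t - x = b - x := mul_left_cancel₀ (sub_pos.2 hs').ne' heq
    exact hne ⟨rfl, by linarith⟩
  · have : t ≤ b := by by_contra! h'; exact h₂ ⟨h, by linarith, h'⟩
    nlinarith

/-- A graph whose vertices can be placed on a line so that no two edges interleave is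
outerplanar: draw the vertices on a parabola and the edges as chords. -/
theorem isOuterplanar_of_noncrossing {V : Type} (G : SimpleGraph V) (f : V → ℝ)
    (hf : Function.Injective f)
    (hG : ∀ a b c d, f a < f b → f b < f c → f c < f d → G.Adj a c → ¬ G.Adj b d) :
    IsOuterplanar G := by
  have key : ∀ ⦃u v a b : V⦄, G.Adj u v → G.Adj a b → s(u, v) ≠ s(a, b) → f u < f v →
      f a < f b → ∀ x y, y - x ^ 2 = (x - f u) * (f v - x) → 0 ≤ (x - f u) * (f v - x) →
      y - x ^ 2 = (x - f a) * (f b - x) → 0 ≤ (x - f a) * (f b - x) →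
      (x = f u ∨ x = f v) ∧ (x = f a ∨ x = f b) := by
    intro u v a b huv hab hne h₁ h₂ x y
    refine eq_endpoint_of_mem_chords h₁ h₂ ?_ ?_ ?_
    · rintro ⟨h, h'⟩
      exact hne (by rw [hf h, hf h'])
    · rintro ⟨h, h', h''⟩
      exact hG _ _ _ _ h h' h'' huv hab
    · rintro ⟨h, h', h''⟩
      exact hG _ _ _ _ h h' h'' hab huv
  have key' : ∀ ⦃u v a b : V⦄, G.Adj u v → G.Adj a b → s(u, v) ≠ s(a, b) →
      ∀ x y, y - x ^ 2 = (x - f u) * (f v - x) → 0 ≤ (x - f u) * (f v - x) →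
      y - x ^ 2 = (x - f a) * (f b - x) → 0 ≤ (x - f a) * (f b - x) →
      (x = f u ∨ x = f v) ∧ (x = f a ∨ x = f b) := by
    intro u v a b huv hab hne x y k₁ k₂ k₃ k₄
    have hswap : ∀ s t : ℝ, (x - s) * (t - x) = (x - t) * (s - x) := fun s t => by ring
    rcases lt_or_gt_of_ne (hf.ne huv.ne) with h₁ | h₁ <;>
      rcases lt_or_gt_of_ne (hf.ne hab.ne) with h₂ | h₂
    · exact key huv hab hne h₁ h₂ x y k₁ k₂ k₃ k₄
    · rw [hswap] at k₃ k₄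
      rw [Sym2.eq_swap (a := a)] at hne
      exact (key huv hab.symm hne h₁ h₂ x y k₁ k₂ k₃ k₄).imp id Or.symm
    · rw [hswap] at k₁ k₂
      rw [Sym2.eq_swap (a := u)] at hne
      exact (key huv.symm hab hne h₁ h₂ x y k₁ k₂ k₃ k₄).imp Or.symm id
    · rw [hswap] at k₁ k₂ k₃ k₄
      rw [Sym2.eq_swap (a := u), Sym2.eq_swap (a := a)] at hne
      exact (key huv.symm hab.symm hne h₁ h₂ x y k₁ k₂ k₃ k₄).imp Or.symm Or.symm
  let E : PlaneEmbedding G :=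
    { vtx := fun v => (f v, f v ^ 2)
      vtx_inj := fun u v h => hf (congrArg Prod.fst h)
      arc := fun u v _ => segment ℝ (f u, f u ^ 2) (f v, f v ^ 2)
      arc_symm := fun u v _ => segment_symm ℝ _ _
      arc_path := by
        intro u v h
        exact ⟨Path.segment _ _,
          Path.segment_injective_of_ne fun h' => hf.ne h.ne (congrArg Prod.fst h'),
          Path.range_segment _ _⟩
      arc_vtx := by
        intro u v h w hw
        have := mem_segment_parabola _ hw
        simp only [sub_self] at this
        rcases mul_eq_zero.1 this.1.symm with h | h
        · exact Or.inl (hf (by linarith))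
        · exact Or.inr (hf (by linarith))
      arc_inter := by
        rintro u v a b h₁ h₂ hne ⟨x, y⟩ ⟨hp₁, hp₂⟩
        have m₁ := mem_segment_parabola _ hp₁
        have m₂ := mem_segment_parabola _ hp₂
        simp only at m₁ m₂
        obtain ⟨k₁, k₂⟩ := key' h₁ h₂ hne x y m₁.1 m₁.2 m₂.1 m₂.2
        refine ⟨?_, ?_⟩
        · rcases k₁ with rfl | rfl
          · exact Or.inl (by ext <;> simp; linarith)
          · exact Or.inr (by ext <;> simp; linarith)
        · rcases k₂ with rfl | rfl
          · exact Or.inl (by ext <;> simp; linarith)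
          · exact Or.inr (by ext <;> simp; linarith) }
  have hsupp : ∀ p ∈ E.subSupport Set.univ, p.1 ^ 2 ≤ p.2 := by
    rintro p (⟨v, -, rfl⟩ | hp)
    · exact le_rfl
    · simp only [Set.mem_iUnion] at hp
      obtain ⟨u, -, v, -, h, hp⟩ := hp
      have := mem_segment_parabola _ hp
      linarith
  refine ⟨E, fun v _ => ?_⟩
  let ray : Set (ℝ × ℝ) := {f v} ×ˢ Set.Iio (f v ^ 2)
  have hray : ray ⊆ (E.subSupport Set.univ)ᶜ := by
    rintro ⟨x, y⟩ ⟨hx, hy⟩ hp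
    have := hsupp _ hp
    simp only [Set.mem_singleton_iff, Set.mem_Iio] at hx hy
    subst hx
    simp only at this
    linarith
  have hconn : IsPreconnected ray := isPreconnected_singleton.prod isPreconnected_Iio
  have hunb : ¬ Bornology.IsBounded ray := by
    intro hb
    have := hb.image_snd
    simp only [ray] at this
    rw [Set.snd_image_prod (Set.singleton_nonempty _)] at this
    exact not_bddBelow_Iio _ this.bddBelow
  refine closure_mono (s := ray) ?_ ?_
  · intro p hp
    exact ⟨hray hp, fun hb => hunb (hb.subset (hconn.subset_connectedComponentIn hp hray))⟩
  · rw [closure_prod_eq, closure_singleton, closure_Iio]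
    exact ⟨rfl, Set.mem_Iic.2 le_rfl⟩

/-- No two edges of `G` interleave along the list `l`. As a property of `l` it is invariant
under rotation, so `l` may be thought of as a circular order. -/
def Noncrossing {V : Type} (G : SimpleGraph V) (l : List V) : Prop :=
  ∀ a b c d, [a, b, c, d].Sublist l → G.Adj a c → ¬ G.Adj b d

/-- The vertices of `Y` can be arranged on a circle without crossing edges. -/
def CircleDrawable {V : Type} (G : SimpleGraph V) (Y : Finset V) : Prop :=
  ∃ l : List V, l.Nodup ∧ (∀ w, w ∈ l ↔ w ∈ Y) ∧ Noncrossing G l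

theorem sublist_of_idxOf_lt {V : Type} [DecidableEq V] {l : List V} :
    ∀ {t : List V}, (∀ a ∈ t, a ∈ l) → t.Pairwise (fun a b => l.idxOf a < l.idxOf b) →
      t.Sublist l := by
  induction l with
  | nil =>
    intro t ht _
    rw [List.eq_nil_iff_forall_not_mem.2 fun a ha => List.not_mem_nil (ht a ha)]
  | cons x l ih =>
    intro t ht hp
    have tail : ∀ t : List V, (∀ a ∈ t, a ∈ x :: l) → x ∉ t →
        t.Pairwise (fun a b => (x :: l).idxOf a < (x :: l).idxOf b) → t.Sublist l := by
      intro t ht hx hp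
      have hne : ∀ a ∈ t, x ≠ a := fun a ha h => hx (h ▸ ha)
      refine ih (fun a ha => ?_) (hp.imp_of_mem fun {a b} ha hb hab => ?_)
      · exact (List.mem_cons.1 (ht a ha)).resolve_left (hne a ha).symm
      · rw [List.idxOf_cons_ne _ (hne a ha), List.idxOf_cons_ne _ (hne b hb)] at hab
        omega
    cases t with
    | nil => exact List.nil_sublist _
    | cons y t =>
      have hxt : x ∉ t := fun h => by
        have := (List.pairwise_cons.1 hp).1 x h
        simp at this
      by_cases hxy : y = x
      · subst hxy
        exact (tail t (fun a ha => ht a (List.mem_cons_of_mem _ ha)) hxt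
          (List.pairwise_cons.1 hp).2).cons_cons _
      · refine (tail (y :: t) ht ?_ hp).cons _
        simp [hxt, Ne.symm hxy]

theorem CircleDrawable.isOuterplanar {V : Type} {G : SimpleGraph V} {Y : Finset V}
    (h : CircleDrawable G Y) : IsOuterplanar (G.induce (↑Y : Set V)) := by
  classical
  obtain ⟨l, -, hl, hnc⟩ := h
  have hmem : ∀ w : (↑Y : Set V), (w : V) ∈ l := fun w => (hl w).2 w.2
  refine isOuterplanar_of_noncrossing _ (fun w => (l.idxOf (w : V) : ℝ)) ?_ ?_
  · intro a b hab
    exact Subtype.ext ((List.idxOf_inj (hmem a)).1 (Nat.cast_injective hab))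
  · intro a b c d hab hbc hcd hac hbd
    simp only [Nat.cast_lt] at hab hbc hcd
    refine hnc a b c d (sublist_of_idxOf_lt ?_ ?_) hac hbd
    · simp [hmem]
    · simp only [List.pairwise_cons, List.mem_cons, List.not_mem_nil, forall_eq_or_imp,
        List.Pairwise.nil, or_false, forall_eq, IsEmpty.forall_iff, implies_true, and_true]
      omega

namespace Noncrossing

variable {V : Type} {G : SimpleGraph V}

theorem of_length_lt {l : List V} (h : l.length < 4) : Noncrossing G l :=
  fun _ _ _ _ hs => absurd hs.length_le (by simpa using h)

/-- A four-term sublist of a concatenation is cut at one of five places. -/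
theorem sublist_append_cases {a b c d : V} {l₁ l₂ : List V}
    (h : [a, b, c, d].Sublist (l₁ ++ l₂)) :
    [a, b, c, d].Sublist l₂ ∨ ([a].Sublist l₁ ∧ [b, c, d].Sublist l₂) ∨
    ([a, b].Sublist l₁ ∧ [c, d].Sublist l₂) ∨ ([a, b, c].Sublist l₁ ∧ [d].Sublist l₂) ∨
    [a, b, c, d].Sublist l₁ := by
  obtain ⟨s, t, hst, hs, ht⟩ := List.sublist_append_iff.1 h
  match s, hst with
  | [], hst => simp at hst; subst hst; exact Or.inl ht
  | [_], hst => simp at hst; obtain ⟨rfl, rfl⟩ := hst; exact Or.inr (Or.inl ⟨hs, ht⟩)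
  | [_, _], hst =>
    simp at hst; obtain ⟨rfl, rfl, rfl⟩ := hst; exact Or.inr (Or.inr (Or.inl ⟨hs, ht⟩))
  | [_, _, _], hst =>
    simp at hst; obtain ⟨rfl, rfl, rfl, rfl⟩ := hst
    exact Or.inr (Or.inr (Or.inr (Or.inl ⟨hs, ht⟩)))
  | [_, _, _, _], hst =>
    simp at hst; obtain ⟨rfl, rfl, rfl, rfl, rfl⟩ := hst
    exact Or.inr (Or.inr (Or.inr (Or.inr hs)))
  | _ :: _ :: _ :: _ :: _ :: _, hst => simp at hst

theorem rotate {l₁ l₂ : List V} (h : Noncrossing G (l₁ ++ l₂)) : Noncrossing G (l₂ ++ l₁) := by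
  intro a b c d hs hac hbd
  rcases sublist_append_cases hs with h' | ⟨h', h''⟩ | ⟨h', h''⟩ | ⟨h', h''⟩ | h'
  · exact h _ _ _ _ (h'.trans (List.sublist_append_left _ _)) hac hbd
  · exact h b c d a (h''.append h') hbd hac.symm
  · exact h c d a b (h''.append h') hac.symm hbd.symm
  · exact h d a b c (h''.append h') hbd.symm hac
  · exact h _ _ _ _ (h'.trans (List.sublist_append_right _ _)) hac hbd

theorem reverse {l : List V} (h : Noncrossing G l) : Noncrossing G l.reverse := by
  intro a b c d hs hac hbd
  have hs' := List.reverse_sublist.2 hs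
  rw [List.reverse_reverse] at hs'
  exact h d c b a hs' hbd.symm hac.symm

theorem append {l₁ l₂ : List V} (h₁ : Noncrossing G l₁) (h₂ : Noncrossing G l₂)
    (h : ∀ a ∈ l₁, ∀ b ∈ l₂, ¬ G.Adj a b) : Noncrossing G (l₁ ++ l₂) := by
  intro a b c d hs hac hbd
  rcases sublist_append_cases hs with h' | ⟨h', h''⟩ | ⟨h', h''⟩ | ⟨h', h''⟩ | h'
  · exact h₂ _ _ _ _ h' hac hbd
  · exact h a (h'.subset (by simp)) c (h''.subset (by simp)) hac
  · exact h a (h'.subset (by simp)) c (h''.subset (by simp)) hac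
  · exact h b (h'.subset (by simp)) d (h''.subset (by simp)) hbd
  · exact h₁ _ _ _ _ h' hac hbd

theorem tail_subset {x y : V} {t l : List V} (h : (x :: t).Sublist (y :: l)) : t ⊆ l :=
  h.tail.subset

/-- Gluing along a common vertex. -/
theorem glue_vertex {l₁ l₂ : List V} {x : V} (h₁ : Noncrossing G (l₁ ++ [x]))
    (h₂ : Noncrossing G (x :: l₂)) (h : ∀ a ∈ l₁, ∀ b ∈ l₂, ¬ G.Adj a b) :
    Noncrossing G (l₁ ++ x :: l₂) := by
  intro a b c d hs hac hbd
  rcases sublist_append_cases hs with h' | ⟨h', h''⟩ | ⟨h', h''⟩ | ⟨h', h''⟩ | h'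
  · exact h₂ _ _ _ _ h' hac hbd
  · exact h a (h'.subset (by simp)) c (tail_subset h'' (by simp)) hac
  · exact h b (h'.subset (by simp)) d (tail_subset h'' (by simp)) hbd
  · rcases List.mem_cons.1 (h''.subset (List.mem_singleton_self d)) with rfl | hd
    · exact h₁ a b c d (h'.append (List.Sublist.refl [d])) hac hbd
    · exact h b (h'.subset (by simp)) d hd hbd
  · exact h₁ _ _ _ _ (h'.trans (List.sublist_append_left _ _)) hac hbd

/-- Gluing two arcs along the chord between their common endpoints. -/
theorem glue_chord {m₁ m₂ : List V} {u x : V} (h₁ : Noncrossing G (u :: m₁ ++ [x]))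
    (h₂ : Noncrossing G (x :: m₂ ++ [u])) (h : ∀ a ∈ m₁, ∀ b ∈ m₂, ¬ G.Adj a b) :
    Noncrossing G (u :: m₁ ++ x :: m₂) := by
  intro a b c d hs hac hbd
  rcases sublist_append_cases hs with h' | ⟨h', h''⟩ | ⟨h', h''⟩ | ⟨h', h''⟩ | h'
  · exact h₂ _ _ _ _ (h'.trans (List.sublist_append_left _ _)) hac hbd
  · have hc := tail_subset h'' (List.mem_cons_self (a := c))
    rcases List.mem_cons.1 (h'.subset (List.mem_singleton_self a)) with rfl | ha
    · exact h₂ b c d a (h''.append (List.Sublist.refl [a])) hbd hac.symm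
    · exact h a ha c hc hac
  · exact h b (tail_subset h' (by simp)) d (tail_subset h'' (by simp)) hbd
  · rcases List.mem_cons.1 (h''.subset (List.mem_singleton_self d)) with rfl | hd
    · exact h₁ a b c d (h'.append (List.Sublist.refl [d])) hac hbd
    · exact h b (tail_subset h' (by simp)) d hd hbd
  · exact h₁ _ _ _ _ (h'.trans (List.sublist_append_left _ _)) hac hbd

/-- Concatenating two arcs below the chord between the outer endpoints. -/
theorem glue_series {l₁ l₂ : List V} {u x v : V} (h₁ : Noncrossing G (u :: l₁ ++ [x]))
    (h₂ : Noncrossing G (x :: l₂ ++ [v])) (h : ∀ a ∈ l₁, ∀ b ∈ l₂, ¬ G.Adj a b)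
    (hv : ∀ a ∈ l₁, ¬ G.Adj a v) (hu : ∀ b ∈ l₂, ¬ G.Adj u b) :
    Noncrossing G (u :: (l₁ ++ x :: l₂) ++ [v]) := by
  have h₃ : Noncrossing G (x :: (l₂ ++ [v]) ++ [u]) := by
    have : Noncrossing G (x :: l₂ ++ v :: [u]) :=
      glue_chord h₂ (of_length_lt (by simp)) (by simpa [G.adj_comm] using hu)
    simpa using this
  have := glue_chord h₁ h₃ (by simpa [or_imp, forall_and] using ⟨h, hv⟩)
  simpa using this

end Noncrossing

/-- No edge of `G` joins `S` to `T`. -/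
def NoEdges {V : Type} (G : SimpleGraph V) (S T : Finset V) : Prop :=
  ∀ a ∈ S, ∀ b ∈ T, ¬ G.Adj a b

/-- The vertices of `Y` can be arranged without crossing edges on an arc from `u` to `v`. -/
def ArcDrawable {V : Type} (G : SimpleGraph V) (u v : V) (Y : Finset V) : Prop :=
  ∃ l : List V, l.Nodup ∧ (∀ w, w ∈ l ↔ w ∈ Y) ∧ Noncrossing G (u :: l ++ [v])

section Drawable

variable {V : Type} {G : SimpleGraph V} {S T Y Y' : Finset V} {u v x : V}

theorem NoEdges.mono {S' T' : Finset V} (h : NoEdges G S T) (hS : S' ⊆ S) (hT : T' ⊆ T) :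
    NoEdges G S' T' :=
  fun a ha b hb => h a (hS ha) b (hT hb)

theorem NoEdges.symm (h : NoEdges G S T) : NoEdges G T S :=
  fun a ha b hb hab => h b hb a ha hab.symm

theorem circleDrawable_singleton (x : V) : CircleDrawable G {x} :=
  ⟨[x], by simp, by simp, .of_length_lt (by simp)⟩

theorem ArcDrawable.empty : ArcDrawable G u v ∅ :=
  ⟨[], by simp, by simp, .of_length_lt (by simp)⟩

theorem ArcDrawable.symm (h : ArcDrawable G u v Y) : ArcDrawable G v u Y := by
  obtain ⟨l, hl, hmem, hnc⟩ := h
  exact ⟨l.reverse, List.nodup_reverse.2 hl, by simpa using hmem, by simpa using hnc.reverse⟩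

variable [DecidableEq V]

theorem CircleDrawable.exists_rooted (h : CircleDrawable G (insert x S)) (hx : x ∉ S) :
    ∃ l : List V, l.Nodup ∧ (∀ w, w ∈ l ↔ w ∈ S) ∧ Noncrossing G (x :: l) := by
  obtain ⟨l, hl, hmem, hnc⟩ := h
  obtain ⟨s, t, rfl⟩ := List.append_of_mem ((hmem x).2 (Finset.mem_insert_self _ _))
  refine ⟨t ++ s, ?_, fun w => ?_, by simpa using hnc.rotate⟩
  · have := (List.perm_append_comm (l₁ := s) (l₂ := x :: t)).nodup_iff.1 hl
    exact (List.nodup_cons.1 this).2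
  · have h₁ := hmem w
    have h₂ : x ∉ t ++ s := by
      have := (List.perm_append_comm (l₁ := s) (l₂ := x :: t)).nodup_iff.1 hl
      exact (List.nodup_cons.1 this).1
    simp only [List.mem_append, List.mem_cons, Finset.mem_insert] at h₁ h₂ ⊢
    grind

theorem CircleDrawable.union (hS : CircleDrawable G S) (hT : CircleDrawable G T)
    (hd : Disjoint S T) (h : NoEdges G S T) : CircleDrawable G (S ∪ T) := by
  obtain ⟨l, hl, hmem, hnc⟩ := hS
  obtain ⟨l', hl', hmem', hnc'⟩ := hT
  refine ⟨l ++ l', ?_, by simp [hmem, hmem'], hnc.append hnc' ?_⟩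
  · refine hl.append hl' fun a ha hb => ?_
    exact Finset.disjoint_left.1 hd ((hmem a).1 ha) ((hmem' a).1 hb)
  · exact fun a ha b hb => h a ((hmem a).1 ha) b ((hmem' b).1 hb)

theorem CircleDrawable.glue (hS : CircleDrawable G (insert x S))
    (hT : CircleDrawable G (insert x T)) (hxS : x ∉ S) (hxT : x ∉ T) (hd : Disjoint S T)
    (h : NoEdges G S T) : CircleDrawable G (insert x (S ∪ T)) := by
  obtain ⟨l, hl, hmem, hnc⟩ := hS.exists_rooted hxS
  obtain ⟨l', hl', hmem', hnc'⟩ := hT.exists_rooted hxT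
  refine ⟨l ++ x :: l', ?_, ?_, ?_⟩
  · refine hl.append (List.nodup_cons.2 ⟨by simpa [hmem'] using hxT, hl'⟩) fun a ha hb => ?_
    rcases List.mem_cons.1 hb with rfl | hb
    · exact hxS ((hmem a).1 ha)
    · exact Finset.disjoint_left.1 hd ((hmem a).1 ha) ((hmem' a).1 hb)
  · intro w
    simp only [List.mem_append, List.mem_cons, Finset.mem_insert, Finset.mem_union, hmem, hmem']
    tauto
  · exact Noncrossing.glue_vertex (Noncrossing.rotate (l₁ := [x]) hnc) hnc'
      fun a ha b hb => h a ((hmem a).1 ha) b ((hmem' b).1 hb)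

theorem ArcDrawable.circleDrawable (h : ArcDrawable G u v Y) (huv : u ≠ v) (hu : u ∉ Y)
    (hv : v ∉ Y) : CircleDrawable G (insert u (insert v Y)) := by
  obtain ⟨l, hl, hmem, hnc⟩ := h
  refine ⟨_, ?_, fun w => ?_, hnc⟩
  · rw [← hmem] at hu hv
    grind
  · simp only [List.mem_append, List.mem_cons, Finset.mem_insert, hmem]
    grind

theorem ArcDrawable.attach (h : ArcDrawable G u v Y) (hS : CircleDrawable G (insert u S))
    (hu : u ∉ S) (hd : Disjoint S Y) (hSY : NoEdges G S Y) (hSv : NoEdges G S {v}) :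
    ArcDrawable G u v (S ∪ Y) := by
  obtain ⟨l, hl, hmem, hnc⟩ := h
  obtain ⟨s, hs, hmem', hnc'⟩ := hS.exists_rooted hu
  refine ⟨s ++ l, ?_, by simp [hmem, hmem'], ?_⟩
  · refine hs.append hl fun a ha hb => ?_
    exact Finset.disjoint_left.1 hd ((hmem' a).1 ha) ((hmem a).1 hb)
  · have h₁ : Noncrossing G ((l ++ [v]) ++ [u]) := Noncrossing.rotate (l₁ := [u]) hnc
    have := (h₁.glue_vertex hnc' fun a ha b hb hab => ?_).rotate
    · simpa using this
    · rcases List.mem_append.1 ha with ha | ha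
      · exact hSY b ((hmem' b).1 hb) a ((hmem a).1 ha) hab.symm
      · exact hSv b ((hmem' b).1 hb) a (by simpa using ha) hab.symm

theorem ArcDrawable.parallel (h : ArcDrawable G u v Y) (h' : ArcDrawable G u v Y')
    (huv : u ≠ v) (hu : u ∉ Y ∪ Y') (hv : v ∉ Y ∪ Y') (hd : Disjoint Y Y')
    (hYY' : NoEdges G Y Y') :
    CircleDrawable G (insert u (insert v (Y ∪ Y'))) := by
  obtain ⟨l, hl, hmem, hnc⟩ := h
  obtain ⟨l', hl', hmem', hnc'⟩ := h'.symm
  refine ⟨_, ?_, fun w => ?_, hnc.glue_chord hnc' fun a ha b hb =>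
    hYY' a ((hmem a).1 ha) b ((hmem' b).1 hb)⟩
  · rw [Finset.mem_union, ← hmem, ← hmem'] at hu hv
    have : ∀ a ∈ l, a ∉ l' := fun a ha hb =>
      Finset.disjoint_left.1 hd ((hmem a).1 ha) ((hmem' a).1 hb)
    simp only [List.cons_append, List.nodup_cons, List.nodup_append, List.mem_append,
      List.mem_cons]
    grind
  · simp only [List.mem_append, List.mem_cons, Finset.mem_insert, Finset.mem_union, hmem, hmem']
    tauto

theorem ArcDrawable.series (h : ArcDrawable G u x Y) (h' : ArcDrawable G x v Y')
    (hx : x ∉ Y ∪ Y') (hd : Disjoint Y Y')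
    (hYY' : NoEdges G Y Y') (hv : NoEdges G Y {v}) (hu : NoEdges G Y' {u}) :
    ArcDrawable G u v (insert x (Y ∪ Y')) := by
  obtain ⟨l, hl, hmem, hnc⟩ := h
  obtain ⟨l', hl', hmem', hnc'⟩ := h'
  refine ⟨l ++ x :: l', ?_, fun w => ?_, hnc.glue_series hnc'
    (fun a ha b hb => hYY' a ((hmem a).1 ha) b ((hmem' b).1 hb))
    (fun a ha => hv a ((hmem a).1 ha) v (by simp))
    (fun b hb hub => hu b ((hmem' b).1 hb) u (by simp) hub.symm)⟩
  · rw [Finset.mem_union, ← hmem, ← hmem'] at hx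
    have : ∀ a ∈ l, a ∉ l' := fun a ha hb =>
      Finset.disjoint_left.1 hd ((hmem a).1 ha) ((hmem' a).1 hb)
    simp only [List.nodup_cons, List.nodup_append, List.mem_cons]
    grind
  · simp only [List.mem_append, List.mem_cons, Finset.mem_insert, Finset.mem_union, hmem, hmem']
    tauto

end Drawable

/-- What becomes of the two roots of a piece, and how the retained part is attached to them:
both roots are kept and no retained component is attached to both (`split`), both are kept and
the retained part fills one arc between them (`arc`), both are kept (`both`), only the left or
only the right root is kept, or neither is. -/
inductive RootState
  | split | arc | both | left | right | neither
  deriving DecidableEq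

instance : Fintype RootState :=
  ⟨{.split, .arc, .both, .left, .right, .neither}, fun s => by cases s <;> simp⟩

/-- The set `Y` of retained vertices can be drawn with the roots `u`, `v` in state `s`. -/
def Realizes {V : Type} [DecidableEq V] (G : SimpleGraph V) (u v : V) :
    RootState → Finset V → Prop
  | .split, Y => ∃ S T, Disjoint S T ∧ S ∪ T = Y ∧ NoEdges G S T ∧ NoEdges G S {v} ∧
      NoEdges G T {u} ∧ CircleDrawable G (insert u S) ∧ CircleDrawable G (insert v T)
  | .arc, Y => ArcDrawable G u v Y
  | .both, Y => CircleDrawable G (insert u (insert v Y))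
  | .left, Y => CircleDrawable G (insert u Y)
  | .right, Y => CircleDrawable G (insert v Y)
  | .neither, Y => CircleDrawable G Y

section Realizes

variable {V : Type} [DecidableEq V] {G : SimpleGraph V} {Y Y' : Finset V} {u v x : V}

theorem Realizes.split_parallel_arc (h : Realizes G u v .split Y) (h' : Realizes G u v .arc Y')
    (hu : u ∉ Y) (hv : v ∉ Y) (hd : Disjoint Y Y') (hYY' : NoEdges G Y Y') :
    Realizes G u v .arc (Y ∪ Y') := by
  obtain ⟨S, T, hST, rfl, hn, hSv, hTu, hS, hT⟩ := h
  rw [Finset.disjoint_union_left] at hd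
  rw [Finset.mem_union, not_or] at hu hv
  have h₁ := ArcDrawable.attach h' hS hu.1 hd.1
    (hYY'.mono Finset.subset_union_left subset_rfl) hSv
  have h₂ := h₁.symm.attach hT hv.2 (Finset.disjoint_union_right.2 ⟨hST.symm, hd.2⟩) ?_ hTu
  · have := h₂.symm
    rwa [← Finset.union_assoc, Finset.union_comm T S] at this
  · intro a ha b hb
    rcases Finset.mem_union.1 hb with hb | hb
    · exact hn.symm a ha b hb
    · exact hYY' a (Finset.mem_union_right _ ha) b hb

theorem Realizes.split_parallel_both (h : Realizes G u v .split Y)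
    (h' : Realizes G u v .both Y') (huv : u ≠ v) (hu : u ∉ Y ∪ Y') (hv : v ∉ Y ∪ Y')
    (hd : Disjoint Y Y') (hYY' : NoEdges G Y Y') : Realizes G u v .both (Y ∪ Y') := by
  obtain ⟨S, T, hST, rfl, hn, hSv, hTu, hS, hT⟩ := h
  have hu' : u ∉ S ∧ u ∉ T ∧ u ∉ Y' := by grind
  have hv' : v ∉ S ∧ v ∉ T ∧ v ∉ Y' := by grind
  rw [Finset.disjoint_union_left] at hd
  have h₁ : CircleDrawable G (insert u (S ∪ insert v Y')) := by
    refine hS.glue h' hu'.1 (by grind) ?_ ?_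
    · exact Finset.disjoint_insert_right.2 ⟨hv'.1, hd.1⟩
    · intro a ha b hb
      rcases Finset.mem_insert.1 hb with rfl | hb
      · exact hSv a ha _ (by simp)
      · exact hYY' a (Finset.mem_union_left _ ha) b hb
  have h₂ : CircleDrawable G (insert v (T ∪ insert u (S ∪ Y'))) := by
    refine hT.glue ?_ hv'.2.1 (by grind) ?_ ?_
    · convert h₁ using 1
      ext w
      simp only [Finset.mem_insert, Finset.mem_union]
      tauto
    · rw [Finset.disjoint_insert_right, Finset.disjoint_union_right]
      exact ⟨hu'.2.1, hST.symm, hd.2⟩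
    · intro a ha b hb
      rcases Finset.mem_insert.1 hb with rfl | hb
      · exact hTu a ha _ (by simp)
      · rcases Finset.mem_union.1 hb with hb | hb
        · exact hn.symm a ha b hb
        · exact hYY' a (Finset.mem_union_right _ ha) b hb
  show CircleDrawable G _
  convert h₂ using 1
  ext w
  simp only [Finset.mem_insert, Finset.mem_union]
  tauto

theorem Realizes.split_parallel_split (h : Realizes G u v .split Y)
    (h' : Realizes G u v .split Y') (hu : u ∉ Y ∪ Y') (hv : v ∉ Y ∪ Y')
    (hd : Disjoint Y Y') (hYY' : NoEdges G Y Y') : Realizes G u v .split (Y ∪ Y') := by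
  obtain ⟨S, T, hST, rfl, hn, hSv, hTu, hS, hT⟩ := h
  obtain ⟨S', T', hST', rfl, hn', hSv', hTu', hS', hT'⟩ := h'
  refine ⟨S ∪ S', T ∪ T', ?_, ?_, ?_, ?_, ?_, ?_, ?_⟩
  · simp only [Finset.disjoint_union_left, Finset.disjoint_union_right] at hd ⊢
    exact ⟨⟨hST, hd.1.2.symm⟩, hd.2.1, hST'⟩
  · ext w
    simp only [Finset.mem_union]
    tauto
  · unfold NoEdges at *
    grind [SimpleGraph.adj_comm]
  · unfold NoEdges at *
    grind
  · unfold NoEdges at *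
    grind
  · simp only [Finset.disjoint_union_left, Finset.disjoint_union_right] at hd
    exact hS.glue hS' (by grind) (by grind) hd.1.1
      (hYY'.mono Finset.subset_union_left Finset.subset_union_left)
  · simp only [Finset.disjoint_union_left, Finset.disjoint_union_right] at hd
    exact hT.glue hT' (by grind) (by grind) hd.2.2
      (hYY'.mono Finset.subset_union_right Finset.subset_union_right)

theorem Realizes.arc_of_split (h : Realizes G u v .split Y) (hu : u ∉ Y) (hv : v ∉ Y) :
    Realizes G u v .arc Y := by
  simpa using h.split_parallel_arc ArcDrawable.empty hu hv (by simp)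
    (fun _ _ _ hb => absurd hb (by simp))

end Realizes

/-- `Piece G u v M`: the vertices of `M` hang off the pair of roots `u`, `v` as in a
series-parallel decomposition. -/
inductive Piece {V : Type} [DecidableEq V] (G : SimpleGraph V) : V → V → Finset V → Prop
  | empty {u v : V} (huv : u ≠ v) : Piece G u v ∅
  | parallel {u v : V} {M N : Finset V} (hM : Piece G u v M) (hN : Piece G u v N)
      (hd : Disjoint M N) (hMN : NoEdges G M N) : Piece G u v (M ∪ N)
  | series {u x v : V} {M N : Finset V} (hM : Piece G u x M) (hN : Piece G x v N)
      (huv : u ≠ v) (hu : u ∉ N) (hv : v ∉ M) (hd : Disjoint M N) (hMN : NoEdges G M N)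
      (hMv : NoEdges G M {v}) (hNu : NoEdges G N {u}) : Piece G u v (insert x (M ∪ N))

theorem Piece.roots {V : Type} [DecidableEq V] {G : SimpleGraph V} {u v : V} {M : Finset V}
    (h : Piece G u v M) : u ≠ v ∧ u ∉ M ∧ v ∉ M := by
  induction h with
  | empty huv => simpa using huv
  | parallel _ _ _ _ ihM ihN => grind
  | series _ _ huv hu hv _ _ _ _ ihM ihN => grind

/-- In state `s`, all but one fifth of `M`, up to the defect `k / 5`, can be retained. -/
def Attains {V : Type} [DecidableEq V] (G : SimpleGraph V) (u v : V) (M : Finset V)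
    (s : RootState) (k : WithTop ℤ) : Prop :=
  ∀ z : ℤ, k = z → ∃ Y ⊆ M, Realizes G u v s Y ∧ 4 * (M.card : ℤ) ≤ 5 * Y.card + z

section Attains

variable {V : Type} [DecidableEq V] {G : SimpleGraph V} {M N : Finset V} {u v x : V}
  {s s₁ s₂ : RootState} {k k₁ k₂ : WithTop ℤ}

theorem Attains.mono (h : Attains G u v M s k₁) (hk : k₁ ≤ k₂) : Attains G u v M s k₂ := by
  rintro z rfl
  obtain ⟨y, rfl⟩ := WithTop.ne_top_iff_exists.1 (ne_top_of_le_ne_top (WithTop.coe_ne_top) hk)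
  obtain ⟨Y, hY, hr, hc⟩ := h y rfl
  exact ⟨Y, hY, hr, hc.trans (by have := WithTop.coe_le_coe.1 hk; omega)⟩

theorem Attains.min (h₁ : Attains G u v M s k₁) (h₂ : Attains G u v M s k₂) :
    Attains G u v M s (min k₁ k₂) := by
  rcases min_choice k₁ k₂ with h | h <;> rw [h] <;> assumption

theorem Attains.imp (h : Attains G u v M s₁ k)
    (himp : ∀ Y ⊆ M, Realizes G u v s₁ Y → Realizes G u v s Y) : Attains G u v M s k := by
  intro z hz
  obtain ⟨Y, hY, hr, hc⟩ := h z hz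
  exact ⟨Y, hY, himp Y hY hr, hc⟩

/-- Combining retained sets of two pieces `M`, `N` of a piece consisting of `M`, `N` and
further vertices `D`, of which those in `K` are retained. -/
theorem Attains.combine {D K : Finset V} {u₁ v₁ u₂ v₂ : V} {d : ℤ}
    (h₁ : Attains G u₁ v₁ M s₁ k₁) (h₂ : Attains G u₂ v₂ N s₂ k₂)
    (hd : Disjoint M N) (hDM : Disjoint D (M ∪ N)) (hK : K ⊆ D)
    (hKd : 4 * (D.card : ℤ) ≤ 5 * K.card + d)
    (himp : ∀ Y ⊆ M, ∀ Y' ⊆ N, Realizes G u₁ v₁ s₁ Y → Realizes G u₂ v₂ s₂ Y' →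
      Realizes G u v s (K ∪ (Y ∪ Y'))) :
    Attains G u v (D ∪ (M ∪ N)) s (k₁ + k₂ + d) := by
  intro z hz
  have hk₁ : k₁ ≠ ⊤ := by rintro rfl; simp at hz
  have hk₂ : k₂ ≠ ⊤ := by rintro rfl; simp at hz
  obtain ⟨z₁, rfl⟩ := WithTop.ne_top_iff_exists.1 hk₁
  obtain ⟨z₂, rfl⟩ := WithTop.ne_top_iff_exists.1 hk₂
  obtain ⟨Y, hY, hr, hc⟩ := h₁ z₁ rfl
  obtain ⟨Y', hY', hr', hc'⟩ := h₂ z₂ rfl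
  have hz' : z₁ + z₂ + d = z := by exact_mod_cast hz
  refine ⟨K ∪ (Y ∪ Y'), ?_, himp Y hY Y' hY' hr hr', ?_⟩
  · exact Finset.union_subset_union hK (Finset.union_subset_union hY hY')
  · rw [Finset.card_union_of_disjoint hDM, Finset.card_union_of_disjoint hd,
      Finset.card_union_of_disjoint
        (Finset.disjoint_of_subset_left hK
          (Finset.disjoint_of_subset_right (Finset.union_subset_union hY hY') hDM)),
      Finset.card_union_of_disjoint
        (Finset.disjoint_of_subset_left hY (Finset.disjoint_of_subset_right hY' hd))]
    push_cast
    linarith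

theorem Attains.parallel (h₁ : Attains G u v M s₁ k₁) (h₂ : Attains G u v N s₂ k₂)
    (hd : Disjoint M N)
    (himp : ∀ Y ⊆ M, ∀ Y' ⊆ N, Realizes G u v s₁ Y → Realizes G u v s₂ Y' →
      Realizes G u v s (Y ∪ Y')) :
    Attains G u v (M ∪ N) s (k₁ + k₂) := by
  simpa using Attains.combine (D := ∅) (K := ∅) (d := 0) h₁ h₂ hd (by simp) (by simp) (by simp)
    (by simpa using himp)

theorem Attains.series_keep (h₁ : Attains G u x M s₁ k₁) (h₂ : Attains G x v N s₂ k₂)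
    (hd : Disjoint M N) (hx : x ∉ M ∪ N)
    (himp : ∀ Y ⊆ M, ∀ Y' ⊆ N, Realizes G u x s₁ Y → Realizes G x v s₂ Y' →
      Realizes G u v s (insert x (Y ∪ Y'))) :
    Attains G u v (insert x (M ∪ N)) s (k₁ + k₂ + (-1 : ℤ)) := by
  simpa using Attains.combine (D := {x}) (K := {x}) (d := -1) h₁ h₂ hd
    (Finset.disjoint_singleton_left.2 hx) subset_rfl (by simp) (by simpa using himp)

theorem Attains.series_delete (h₁ : Attains G u x M s₁ k₁) (h₂ : Attains G x v N s₂ k₂)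
    (hd : Disjoint M N) (hx : x ∉ M ∪ N)
    (himp : ∀ Y ⊆ M, ∀ Y' ⊆ N, Realizes G u x s₁ Y → Realizes G x v s₂ Y' →
      Realizes G u v s (Y ∪ Y')) :
    Attains G u v (insert x (M ∪ N)) s (k₁ + k₂ + (4 : ℤ)) := by
  simpa using Attains.combine (D := {x}) (K := ∅) (d := 4) h₁ h₂ hd
    (Finset.disjoint_singleton_left.2 hx) (by simp) (by simp) (by simpa using himp)

end Attains

/-- Upper bounds for the defects in all six states. -/
abbrev Profile : Type := RootState → WithTop ℤ

/-- The profile of a parallel composition. -/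
def Profile.parallel (p q : Profile) : Profile
  | .split => p .split + q .split
  | .arc => min (p .split + q .arc) (p .arc + q .split)
  | .both => min (p .arc + q .arc) (min (p .split + q .both) (p .both + q .split))
  | .left => p .left + q .left
  | .right => p .right + q .right
  | .neither => p .neither + q .neither

/-- The profile of a series composition. -/
def Profile.series (p q : Profile) : Profile
  | .split => p .left + q .right + (4 : ℤ)
  | .arc => min (p .arc + q .arc + (-1 : ℤ)) (p .left + q .right + (4 : ℤ))
  | .both => min (p .arc + q .arc + (-1 : ℤ)) (p .left + q .right + (4 : ℤ))
  | .left => min (p .both + q .left + (-1 : ℤ)) (p .left + q .neither + (4 : ℤ))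
  | .right => min (p .right + q .both + (-1 : ℤ)) (p .neither + q .right + (4 : ℤ))
  | .neither => min (p .right + q .left + (-1 : ℤ)) (p .neither + q .neither + (4 : ℤ))

/-- The profile with the given defects in the states `split`, `arc`, `both`, `left`, `right`,
`neither`. -/
def Profile.of (a b c d e f : WithTop ℤ) : Profile
  | .split => a
  | .arc => b
  | .both => c
  | .left => d
  | .right => e
  | .neither => f

/-- A set of profiles that is closed, up to domination, under both compositions. -/
def profileTable : List Profile :=
  [.of 0 0 0 0 0 0,
   .of 1 1 1 1 (-4) (-4),
   .of 1 1 1 (-4) 1 (-4),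
   .of 4 (-1) (-1) (-1) (-1) (-1),
   .of 5 0 0 0 (-5) (-5),
   .of 5 0 0 (-5) 0 (-5),
   .of ⊤ 3 (-2) (-2) (-2) (-2),
   .of ⊤ ⊤ 2 (-3) (-3) (-3),
   .of ⊤ ⊤ ⊤ (-4) (-4) (-4),
   .of ⊤ ⊤ ⊤ ⊤ (-6) (-6),
   .of ⊤ ⊤ ⊤ (-6) ⊤ (-6),
   .of ⊤ ⊤ ⊤ ⊤ ⊤ (-10)]

theorem profileTable_parallel :
    ∀ p ∈ profileTable, ∀ q ∈ profileTable, ∃ r ∈ profileTable, ∀ s, p.parallel q s ≤ r s := by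
  decide +kernel

theorem profileTable_series :
    ∀ p ∈ profileTable, ∀ q ∈ profileTable, ∃ r ∈ profileTable, ∀ s, p.series q s ≤ r s := by
  decide +kernel

theorem profileTable_defect : ∀ p ∈ profileTable,
    p .both ≤ 2 ∨ p .left ≤ -3 ∨ p .right ≤ -3 ∨ p .neither ≤ -8 := by
  decide +kernel

/-- The defects of the piece `M` in all states are bounded by `p`. -/
def HasProfile {V : Type} [DecidableEq V] (G : SimpleGraph V) (u v : V) (M : Finset V)
    (p : Profile) : Prop :=
  ∀ s, Attains G u v M s (p s)

section HasProfile

variable {V : Type} [DecidableEq V] {G : SimpleGraph V} {M N : Finset V} {u v x : V}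
  {p q : Profile}

theorem Realizes.symm_union {s : RootState} {Y Y' : Finset V}
    (h : Realizes G u v s (Y ∪ Y')) : Realizes G u v s (Y' ∪ Y) := by
  rwa [Finset.union_comm]

theorem HasProfile.parallel (hp : HasProfile G u v M p) (hq : HasProfile G u v N q)
    (huv : u ≠ v) (hu : u ∉ M ∪ N) (hv : v ∉ M ∪ N) (hd : Disjoint M N)
    (hMN : NoEdges G M N) : HasProfile G u v (M ∪ N) (p.parallel q) := by
  have hdY : ∀ Y ⊆ M, ∀ Y' ⊆ N, Disjoint Y Y' := fun Y hY Y' hY' =>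
    Finset.disjoint_of_subset_left hY (Finset.disjoint_of_subset_right hY' hd)
  have hnY : ∀ Y ⊆ M, ∀ Y' ⊆ N, NoEdges G Y Y' := fun Y hY Y' hY' => hMN.mono hY hY'
  have hmem : ∀ w, w ∉ M ∪ N → ∀ Y ⊆ M, ∀ Y' ⊆ N, w ∉ Y ∪ Y' := fun w hw Y hY Y' hY' h =>
    hw (Finset.union_subset_union hY hY' h)
  have hM : ∀ w, w ∉ M ∪ N → ∀ Y ⊆ M, w ∉ Y := fun w hw Y hY h =>
    hw (Finset.mem_union_left _ (hY h))
  have hN : ∀ w, w ∉ M ∪ N → ∀ Y' ⊆ N, w ∉ Y' := fun w hw Y hY h =>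
    hw (Finset.mem_union_right _ (hY h))
  intro s
  cases s with
  | split =>
    exact (hp .split).parallel (hq .split) hd fun Y hY Y' hY' h h' =>
      h.split_parallel_split h' (hmem u hu Y hY Y' hY') (hmem v hv Y hY Y' hY')
        (hdY Y hY Y' hY') (hnY Y hY Y' hY')
  | arc =>
    refine ((hp .split).parallel (hq .arc) hd fun Y hY Y' hY' h h' => ?_).min
      ((hp .arc).parallel (hq .split) hd fun Y hY Y' hY' h h' => ?_)
    · exact h.split_parallel_arc h' (hM u hu Y hY) (hM v hv Y hY) (hdY Y hY Y' hY')
        (hnY Y hY Y' hY')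
    · exact (h'.split_parallel_arc h (hN u hu Y' hY') (hN v hv Y' hY') (hdY Y hY Y' hY').symm
        (hnY Y hY Y' hY').symm).symm_union
  | both =>
    refine ((hp .arc).parallel (hq .arc) hd fun Y hY Y' hY' h h' => ?_).min
      (((hp .split).parallel (hq .both) hd fun Y hY Y' hY' h h' => ?_).min
      ((hp .both).parallel (hq .split) hd fun Y hY Y' hY' h h' => ?_))
    · exact ArcDrawable.parallel h h' huv (hmem u hu Y hY Y' hY') (hmem v hv Y hY Y' hY')
        (hdY Y hY Y' hY') (hnY Y hY Y' hY')
    · exact h.split_parallel_both h' huv (hmem u hu Y hY Y' hY') (hmem v hv Y hY Y' hY')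
        (hdY Y hY Y' hY') (hnY Y hY Y' hY')
    · refine (h'.split_parallel_both h huv ?_ ?_ (hdY Y hY Y' hY').symm
        (hnY Y hY Y' hY').symm).symm_union
      · rw [Finset.union_comm]
        exact hmem u hu Y hY Y' hY'
      · rw [Finset.union_comm]
        exact hmem v hv Y hY Y' hY'
  | left =>
    exact (hp .left).parallel (hq .left) hd fun Y hY Y' hY' h h' =>
      CircleDrawable.glue h h' (hM u hu Y hY) (hN u hu Y' hY') (hdY Y hY Y' hY')
        (hnY Y hY Y' hY')
  | right =>
    exact (hp .right).parallel (hq .right) hd fun Y hY Y' hY' h h' =>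
      CircleDrawable.glue h h' (hM v hv Y hY) (hN v hv Y' hY') (hdY Y hY Y' hY')
        (hnY Y hY Y' hY')
  | neither =>
    exact (hp .neither).parallel (hq .neither) hd fun Y hY Y' hY' h h' =>
      CircleDrawable.union h h' (hdY Y hY Y' hY') (hnY Y hY Y' hY')

theorem NoEdges.insert_right {S T : Finset V} (h : NoEdges G S T) (hv : NoEdges G S {v}) :
    NoEdges G S (insert v T) := by
  intro a ha b hb
  rcases Finset.mem_insert.1 hb with rfl | hb
  · exact hv a ha _ (by simp)
  · exact h a ha b hb

theorem HasProfile.series (hp : HasProfile G u x M p) (hq : HasProfile G x v N q)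
    (huv : u ≠ v) (hux : u ≠ x) (hxv : x ≠ v) (hu : u ∉ M ∪ N) (hv : v ∉ M ∪ N)
    (hx : x ∉ M ∪ N) (hd : Disjoint M N) (hMN : NoEdges G M N) (hMv : NoEdges G M {v})
    (hNu : NoEdges G N {u}) : HasProfile G u v (insert x (M ∪ N)) (p.series q) := by
  have hdY : ∀ Y ⊆ M, ∀ Y' ⊆ N, Disjoint Y Y' := fun Y hY Y' hY' =>
    Finset.disjoint_of_subset_left hY (Finset.disjoint_of_subset_right hY' hd)
  have hnY : ∀ Y ⊆ M, ∀ Y' ⊆ N, NoEdges G Y Y' := fun Y hY Y' hY' => hMN.mono hY hY'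
  have hMv' : ∀ Y ⊆ M, NoEdges G Y {v} := fun Y hY => hMv.mono hY subset_rfl
  have hNu' : ∀ Y' ⊆ N, NoEdges G Y' {u} := fun Y hY => hNu.mono hY subset_rfl
  have hM : ∀ w, w ∉ M ∪ N → ∀ Y ⊆ M, w ∉ Y := fun w hw Y hY h =>
    hw (Finset.mem_union_left _ (hY h))
  have hN : ∀ w, w ∉ M ∪ N → ∀ Y' ⊆ N, w ∉ Y' := fun w hw Y hY h =>
    hw (Finset.mem_union_right _ (hY h))
  have hsplit : Attains G u v (insert x (M ∪ N)) .split (p .left + q .right + (4 : ℤ)) :=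
    (hp .left).series_delete (hq .right) hd hx fun Y hY Y' hY' h h' =>
      ⟨Y, Y', hdY Y hY Y' hY', rfl, hnY Y hY Y' hY', hMv' Y hY, hNu' Y' hY', h, h'⟩
  have hu' : ∀ Y ⊆ insert x (M ∪ N), u ∉ Y := fun Y hY h => by
    rcases Finset.mem_insert.1 (hY h) with h | h
    exacts [hux h, hu h]
  have hv' : ∀ Y ⊆ insert x (M ∪ N), v ∉ Y := fun Y hY h => by
    rcases Finset.mem_insert.1 (hY h) with h | h
    exacts [hxv h.symm, hv h]
  have harc : Attains G u v (insert x (M ∪ N)) .arc (p.series q .arc) := by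
    refine ((hp .arc).series_keep (hq .arc) hd hx fun Y hY Y' hY' h h' => ?_).min
      (hsplit.imp fun Y hY h => h.arc_of_split (hu' Y hY) (hv' Y hY))
    exact ArcDrawable.series h h' (fun hxY => hx (Finset.union_subset_union hY hY' hxY))
      (hdY Y hY Y' hY') (hnY Y hY Y' hY') (hMv' Y hY) (hNu' Y' hY')
  intro s
  cases s with
  | split => exact hsplit
  | arc => exact harc
  | both =>
    exact harc.imp fun Y hY h => ArcDrawable.circleDrawable h huv (hu' Y hY) (hv' Y hY)
  | left =>
    refine ((hp .both).series_keep (hq .left) hd hx fun Y hY Y' hY' h h' => ?_).min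
      ((hp .left).series_delete (hq .neither) hd hx fun Y hY Y' hY' h h' => ?_)
    · have h₁ : CircleDrawable G (insert x (insert u Y)) := by
        rw [Finset.insert_comm]
        exact h
      have h₂ := h₁.glue h' (by simpa [hux.symm] using hM x hx Y hY) (hN x hx Y' hY')
        (Finset.disjoint_insert_left.2 ⟨hN u hu Y' hY', hdY Y hY Y' hY'⟩)
        (NoEdges.insert_right (hnY Y hY Y' hY').symm (hNu' Y' hY')).symm
      rw [Finset.insert_union, Finset.insert_comm] at h₂
      exact h₂
    · have h₂ := CircleDrawable.union h h'
        (Finset.disjoint_insert_left.2 ⟨hN u hu Y' hY', hdY Y hY Y' hY'⟩)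
        (NoEdges.insert_right (hnY Y hY Y' hY').symm (hNu' Y' hY')).symm
      rw [Finset.insert_union] at h₂
      exact h₂
  | right =>
    refine ((hp .right).series_keep (hq .both) hd hx fun Y hY Y' hY' h h' => ?_).min
      ((hp .neither).series_delete (hq .right) hd hx fun Y hY Y' hY' h h' => ?_)
    · have h₂ := CircleDrawable.glue h h' (hM x hx Y hY)
        (by simpa [hxv] using hN x hx Y' hY')
        (Finset.disjoint_insert_right.2 ⟨hM v hv Y hY, hdY Y hY Y' hY'⟩)
        (NoEdges.insert_right (hnY Y hY Y' hY') (hMv' Y hY))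
      rw [Finset.union_insert, Finset.insert_comm] at h₂
      exact h₂
    · have h₂ := CircleDrawable.union h h'
        (Finset.disjoint_insert_right.2 ⟨hM v hv Y hY, hdY Y hY Y' hY'⟩)
        (NoEdges.insert_right (hnY Y hY Y' hY') (hMv' Y hY))
      rw [Finset.union_insert] at h₂
      exact h₂
  | neither =>
    refine ((hp .right).series_keep (hq .left) hd hx fun Y hY Y' hY' h h' => ?_).min
      ((hp .neither).series_delete (hq .neither) hd hx fun Y hY Y' hY' h h' => ?_)
    · exact CircleDrawable.glue h h' (hM x hx Y hY) (hN x hx Y' hY') (hdY Y hY Y' hY')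
        (hnY Y hY Y' hY')
    · exact CircleDrawable.union h h' (hdY Y hY Y' hY') (hnY Y hY Y' hY')

theorem Piece.exists_profile (h : Piece G u v M) : ∃ p ∈ profileTable, HasProfile G u v M p := by
  induction h with
  | @empty u v huv =>
    have h0 : ∀ w, CircleDrawable G (insert w ∅) := fun w => circleDrawable_singleton w
    refine ⟨.of 0 0 0 0 0 0, List.mem_cons_self, fun s z hz => ⟨∅, subset_rfl, ?_, ?_⟩⟩
    · cases s with
      | split =>
        refine ⟨∅, ∅, by simp, by simp, ?_, ?_, ?_, h0 u, h0 v⟩ <;>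
          exact fun a ha => absurd ha (by simp)
      | arc => exact ArcDrawable.empty
      | both => exact ArcDrawable.empty.circleDrawable huv (by simp) (by simp)
      | left => exact h0 u
      | right => exact h0 v
      | neither => exact ⟨[], by simp, by simp, .of_length_lt (by simp)⟩
    · have : (0 : WithTop ℤ) = z := by cases s <;> exact hz
      have : (0 : ℤ) = z := by exact_mod_cast this
      simp [← this]
  | @parallel u v M N hM hN hd hMN ihM ihN =>
    obtain ⟨p, hp, hpM⟩ := ihM
    obtain ⟨q, hq, hqN⟩ := ihN
    obtain ⟨r, hr, hle⟩ := profileTable_parallel p hp q hq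
    have h := (Piece.parallel hM hN hd hMN).roots
    exact ⟨r, hr, fun s => (hpM.parallel hqN h.1 h.2.1 h.2.2 hd hMN s).mono (hle s)⟩
  | @series u x v M N hM hN huv hu hv hd hMN hMv hNu ihM ihN =>
    obtain ⟨p, hp, hpM⟩ := ihM
    obtain ⟨q, hq, hqN⟩ := ihN
    obtain ⟨r, hr, hle⟩ := profileTable_series p hp q hq
    obtain ⟨hux, huM, hxM⟩ := hM.roots
    obtain ⟨hxv, hxN, hvN⟩ := hN.roots
    exact ⟨r, hr, fun s => (hpM.series hqN huv hux hxv (by simp [huM, hu]) (by simp [hv, hvN])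
      (by simp [hxM, hxN]) hd hMN hMv hNu s).mono (hle s)⟩

/-- A piece together with its roots loses at most one fifth of its vertices. -/
theorem Piece.exists_circleDrawable (h : Piece G u v M) :
    ∃ Y ⊆ insert u (insert v M), CircleDrawable G Y ∧
      4 * (insert u (insert v M)).card ≤ 5 * Y.card := by
  obtain ⟨huv, hu, hv⟩ := h.roots
  obtain ⟨p, hp, hpM⟩ := h.exists_profile
  have hcard : (insert u (insert v M)).card = M.card + 2 := by
    rw [Finset.card_insert_of_notMem (by simp [huv, hu]), Finset.card_insert_of_notMem hv]
  rw [hcard]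
  rcases profileTable_defect p hp with hd | hd | hd | hd
  · obtain ⟨Y, hY, hr, hc⟩ := (hpM .both).mono hd 2 rfl
    refine ⟨_, Finset.insert_subset_insert _ (Finset.insert_subset_insert _ hY), hr, ?_⟩
    rw [Finset.card_insert_of_notMem (by simpa [huv] using fun h => hu (hY h)),
      Finset.card_insert_of_notMem fun h => hv (hY h)]
    omega
  · obtain ⟨Y, hY, hr, hc⟩ := (hpM .left).mono hd (-3) rfl
    refine ⟨_, Finset.insert_subset_insert _ (hY.trans (Finset.subset_insert _ _)), hr, ?_⟩
    rw [Finset.card_insert_of_notMem fun h => hu (hY h)]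
    omega
  · obtain ⟨Y, hY, hr, hc⟩ := (hpM .right).mono hd (-3) rfl
    refine ⟨_, (Finset.insert_subset_insert _ hY).trans (Finset.subset_insert _ _), hr, ?_⟩
    rw [Finset.card_insert_of_notMem fun h => hv (hY h)]
    omega
  · obtain ⟨Y, hY, hr, hc⟩ := (hpM .neither).mono hd (-8) rfl
    refine ⟨Y, hY.trans ((Finset.subset_insert _ _).trans (Finset.subset_insert _ _)), hr, ?_⟩
    omega

end HasProfile

/-- A nonempty vertex set that no bipartition separates in `G`. -/
def CutConnected {V : Type} (G : SimpleGraph V) (s : Set V) : Prop :=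
  s.Nonempty ∧ ∀ T ⊆ s, T.Nonempty → (s \ T).Nonempty → ∃ a ∈ T, ∃ b ∈ s \ T, G.Adj a b

namespace CutConnected

variable {V : Type} {G H : SimpleGraph V} {s t : Set V}

theorem mono (h : CutConnected G s) (hGH : G ≤ H) : CutConnected H s := by
  refine ⟨h.1, fun T hT h₁ h₂ => ?_⟩
  obtain ⟨a, ha, b, hb, hab⟩ := h.2 T hT h₁ h₂
  exact ⟨a, ha, b, hb, hGH hab⟩

theorem singleton (x : V) : CutConnected G {x} := by
  refine ⟨Set.singleton_nonempty x, fun T hT h₁ h₂ => ?_⟩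
  obtain ⟨y, hy⟩ := h₁
  obtain ⟨z, hz, hz'⟩ := h₂
  exact absurd hy (by rwa [hT hy, ← Set.mem_singleton_iff.1 hz])

/-- It suffices to look at bipartitions with a given vertex on the first side. -/
theorem of_mem {x : V} (hx : x ∈ s)
    (h : ∀ T ⊆ s, x ∈ T → (s \ T).Nonempty → ∃ a ∈ T, ∃ b ∈ s \ T, G.Adj a b) :
    CutConnected G s := by
  refine ⟨⟨x, hx⟩, fun T hT h₁ h₂ => ?_⟩
  by_cases hxT : x ∈ T
  · exact h T hT hxT h₂
  · obtain ⟨a, ha, b, hb, hab⟩ := h (s \ T) Set.sdiff_subset ⟨hx, hxT⟩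
      (by rwa [Set.sdiff_sdiff_cancel_left hT])
    rw [Set.sdiff_sdiff_cancel_left hT] at hb
    exact ⟨b, hb, a, ha, hab.symm⟩

theorem exists_adj_of_subset (hs : CutConnected G s) (hst : s ⊆ t) {T : Set V} {x y : V}
    (hx : x ∈ s) (hxT : x ∈ T) (hy : y ∈ s) (hyT : y ∉ T) :
    ∃ a ∈ T, ∃ b ∈ t \ T, G.Adj a b := by
  obtain ⟨a, ha, b, hb, hab⟩ := hs.2 (s ∩ T) Set.inter_subset_left ⟨x, hx, hxT⟩
    ⟨y, hy, fun h => hyT h.2⟩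
  exact ⟨a, ha.2, b, ⟨hst hb.1, fun h => hb.2 ⟨hb.1, h⟩⟩, hab⟩

theorem union (hs : CutConnected G s) (ht : CutConnected G t) {x : V} (hxs : x ∈ s)
    (hxt : x ∈ t) : CutConnected G (s ∪ t) := by
  refine of_mem (Or.inl hxs) fun T hT hxT hne => ?_
  obtain ⟨y, hy | hy, hyT⟩ := hne
  · exact hs.exists_adj_of_subset Set.subset_union_left hxs hxT hy hyT
  · exact ht.exists_adj_of_subset Set.subset_union_right hxt hxT hy hyT

theorem pair {x y : V} (hxy : G.Adj x y) : CutConnected G {x, y} := by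
  refine of_mem (Or.inl rfl) fun T hT hxT hne => ?_
  obtain ⟨z, hz, hzT⟩ := hne
  rcases hz with rfl | rfl
  · exact absurd hxT hzT
  · exact ⟨x, hxT, z, ⟨Or.inr rfl, hzT⟩, hxy⟩

theorem union_of_adj (hs : CutConnected G s) (ht : CutConnected G t) {x y : V} (hxs : x ∈ s)
    (hyt : y ∈ t) (hxy : G.Adj x y) : CutConnected G (s ∪ t) := by
  have h := (hs.union (pair hxy) hxs (Or.inl rfl)).union ht (Or.inr (Or.inr rfl)) hyt
  convert h using 1
  ext z
  simp only [Set.mem_union, Set.mem_insert_iff, Set.mem_singleton_iff]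
  constructor
  · tauto
  · rintro ((h | rfl | rfl) | h) <;> tauto

theorem connected_induce (h : CutConnected G s) : (G.induce s).Connected := by
  obtain ⟨x, hx⟩ := h.1
  rw [SimpleGraph.connected_iff_exists_forall_reachable]
  refine ⟨⟨x, hx⟩, fun y => ?_⟩
  by_contra hy
  obtain ⟨a, ⟨ha, har⟩, b, ⟨hb, hbr⟩, hab⟩ := h.2
    {z | ∃ hz : z ∈ s, (G.induce s).Reachable ⟨x, hx⟩ ⟨z, hz⟩} (fun z hz => hz.1)
    ⟨x, hx, SimpleGraph.Reachable.refl _⟩ ⟨y, y.2, fun h => hy h.2⟩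
  have hab' : (G.induce s).Adj ⟨a, ha⟩ ⟨b, hb⟩ := hab
  exact hbr ⟨hb, har.trans hab'.reachable⟩

theorem exists_cut (hs : s.Nonempty) (h : ¬ CutConnected G s) :
    ∃ T ⊆ s, T.Nonempty ∧ (s \ T).Nonempty ∧ ∀ a ∈ T, ∀ b ∈ s \ T, ¬ G.Adj a b := by
  by_contra hcon
  refine h ⟨hs, fun T hT h₁ h₂ => ?_⟩
  by_contra hcon'
  push Not at hcon'
  exact hcon ⟨T, hT, h₁, h₂, hcon'⟩

end CutConnected

/-- The case of two paths of Menger's theorem: either two disjoint connected sets inside `M`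
join `A` to `B`, or a single vertex separates `A` from `B` in `M`. -/
theorem two_disjoint_connections_or_separator {V : Type} [Finite V] (G : SimpleGraph V) :
    ∀ M A B : Set V, M.Nonempty → A ⊆ M → B ⊆ M →
    (∃ M₁ M₂ : Set V, M₁ ⊆ M ∧ M₂ ⊆ M ∧ Disjoint M₁ M₂ ∧ CutConnected G M₁ ∧
      CutConnected G M₂ ∧ (M₁ ∩ A).Nonempty ∧ (M₁ ∩ B).Nonempty ∧ (M₂ ∩ A).Nonempty ∧
      (M₂ ∩ B).Nonempty) ∨
    ∃ x ∈ M, ∃ P Q : Set V, P ∪ Q = M \ {x} ∧ Disjoint P Q ∧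
      (∀ a ∈ P, ∀ b ∈ Q, ¬ G.Adj a b) ∧ A ⊆ insert x P ∧ B ⊆ insert x Q := by
  induction G using WellFoundedLT.induction with
  | ind G ih =>
  intro M A B hM hA hB
  by_cases hedge : ∃ p ∈ M, ∃ q ∈ M, G.Adj p q
  swap
  · push Not at hedge
    by_cases hAB : (A ∩ B).Nontrivial
    · obtain ⟨x, hx, y, hy, hxy⟩ := hAB
      left
      exact ⟨{x}, {y}, by simpa using hA hx.1, by simpa using hA hy.1, by simpa using hxy,
        .singleton x, .singleton y, by simpa using hx.1, by simpa using hx.2,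
        by simpa using hy.1, by simpa using hy.2⟩
    · right
      obtain ⟨x, hxM, hx⟩ : ∃ x ∈ M, ∀ y ∈ A ∩ B, y = x := by
        rcases (A ∩ B).eq_empty_or_nonempty with h | ⟨x, hx⟩
        · obtain ⟨x, hx⟩ := hM
          exact ⟨x, hx, by simp [h]⟩
        · exact ⟨x, hA hx.1, fun y hy => Set.not_nontrivial_iff.1 hAB hy hx⟩
      refine ⟨x, hxM, A \ {x}, (M \ A) \ {x}, ?_, ?_, ?_, ?_, ?_⟩
      · ext y
        have := @hA y
        simp only [Set.mem_union, Set.mem_sdiff, Set.mem_singleton_iff]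
        tauto
      · rw [Set.disjoint_left]
        rintro y ⟨hy, -⟩ ⟨⟨-, hy'⟩, -⟩
        exact hy' hy
      · exact fun a ha b hb => hedge a (hA ha.1) b hb.1.1
      · intro y hy
        by_cases h : y = x
        · exact Or.inl h
        · exact Or.inr ⟨hy, h⟩
      · intro y hy
        by_cases h : y = x
        · exact Or.inl h
        · exact Or.inr ⟨⟨hB hy, fun hy' => h (hx y ⟨hy', hy⟩)⟩, h⟩
  obtain ⟨p₀, hp₀, q₀, hq₀, hpq₀⟩ := hedge
  set H := G.deleteEdges {s(p₀, q₀)} with hH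
  have hHG : H ≤ G := G.deleteEdges_le _
  have hlt : H < G := lt_of_le_of_ne hHG fun h => by
    have : H.Adj p₀ q₀ := h ▸ hpq₀
    simp [hH] at this
  have hadj : ∀ a b, G.Adj a b → H.Adj a b ∨ s(a, b) = s(p₀, q₀) := fun a b hab => by
    by_cases h : s(a, b) = s(p₀, q₀)
    · exact Or.inr h
    · left
      rw [hH, SimpleGraph.deleteEdges_adj]
      exact ⟨hab, h⟩
  rcases ih H hlt M A B hM hA hB with ⟨M₁, M₂, h₁, h₂, h₃, h₄, h₅, h₆⟩ |
    ⟨x, hx, P, Q, hPQ, hdPQ, hnPQ, hAP, hBQ⟩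
  · exact Or.inl ⟨M₁, M₂, h₁, h₂, h₃, h₄.mono hHG, h₅.mono hHG, h₆⟩
  by_cases hsep : ∀ a ∈ P, ∀ b ∈ Q, ¬ G.Adj a b
  · exact Or.inr ⟨x, hx, P, Q, hPQ, hdPQ, hsep, hAP, hBQ⟩
  push Not at hsep
  obtain ⟨p, hp, q, hq, hpq⟩ := hsep
  have hpq' : s(p, q) = s(p₀, q₀) := (hadj p q hpq).resolve_left (hnPQ p hp q hq)
  rw [← hpq'] at hadj
  have hPM : ∀ y ∈ P, y ∈ M ∧ y ≠ x ∧ y ∉ Q := fun y hy =>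
    have h : y ∈ M \ {x} := hPQ ▸ Or.inl hy
    ⟨h.1, h.2, Set.disjoint_left.1 hdPQ hy⟩
  have hQM : ∀ y ∈ Q, y ∈ M ∧ y ≠ x ∧ y ∉ P := fun y hy =>
    have h : y ∈ M \ {x} := hPQ ▸ Or.inr hy
    ⟨h.1, h.2, Set.disjoint_right.1 hdPQ hy⟩
  have hcover : ∀ y ∈ M, y ≠ x → y ∈ P ∨ y ∈ Q := fun y hy hyx =>
    (hPQ ▸ (⟨hy, hyx⟩ : y ∈ M \ {x}) : y ∈ P ∪ Q)
  have hedges : ∀ a b, G.Adj a b → H.Adj a b ∨ (a = p ∧ b = q) ∨ (a = q ∧ b = p) :=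
    fun a b hab => by simpa using hadj a b hab
  rcases ih H hlt (insert x P) A {x, p} ⟨x, Or.inl rfl⟩ hAP
      (by rintro y (rfl | rfl); exacts [Or.inl rfl, Or.inr hp]) with
    ⟨M₁, M₂, hM₁, hM₂, hMd, hMc₁, hMc₂, hMA₁, hMB₁, hMA₂, hMB₂⟩ |
    ⟨y, hy, P', Q', hPQ', hdPQ', hnPQ', hAP', hBQ'⟩
  swap
  · right
    have hP' : ∀ z ∈ P', z ∈ insert x P ∧ z ≠ y ∧ z ∉ Q' := fun z hz =>
      have h : z ∈ insert x P \ {y} := hPQ' ▸ Or.inl hz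
      ⟨h.1, h.2, Set.disjoint_left.1 hdPQ' hz⟩
    have hQ' : ∀ z ∈ Q', z ∈ insert x P ∧ z ≠ y := fun z hz =>
      have h : z ∈ insert x P \ {y} := hPQ' ▸ Or.inr hz
      ⟨h.1, h.2⟩
    have hxy : x ∈ insert y Q' := hBQ' (Or.inl rfl)
    have hpy : p ∈ insert y Q' := hBQ' (Or.inr rfl)
    have hcover' : ∀ z ∈ insert x P, z ≠ y → z ∈ P' ∨ z ∈ Q' := fun z hz hzy =>
      (hPQ' ▸ (⟨hz, hzy⟩ : z ∈ insert x P \ {y}) : z ∈ P' ∪ Q')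
    have hyQ : y ∉ Q := by
      rcases hy with rfl | hy
      · exact fun h => (hQM _ h).2.1 rfl
      · exact (hPM y hy).2.2
    refine ⟨y, ?_, P', Q' ∪ Q, ?_, ?_, ?_, hAP', ?_⟩
    · rcases hy with rfl | hy
      exacts [hx, (hPM y hy).1]
    · ext z
      simp only [Set.mem_union, Set.mem_sdiff, Set.mem_singleton_iff]
      grind
    · rw [Set.disjoint_left]
      grind
    · intro a ha b hb hab
      have := hedges a b hab
      grind
    · intro z hz
      have := hBQ hz
      grind
  rcases ih H hlt (insert x Q) {x, q} B ⟨x, Or.inl rfl⟩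
      (by rintro y (rfl | rfl); exacts [Or.inl rfl, Or.inr hq]) hBQ with
    ⟨N₁, N₂, hN₁, hN₂, hNd, hNc₁, hNc₂, hNA₁, hNB₁, hNA₂, hNB₂⟩ |
    ⟨y, hy, P', Q', hPQ', hdPQ', hnPQ', hAP', hBQ'⟩
  swap
  · right
    have hP' : ∀ z ∈ P', z ∈ insert x Q ∧ z ≠ y ∧ z ∉ Q' := fun z hz =>
      have h : z ∈ insert x Q \ {y} := hPQ' ▸ Or.inl hz
      ⟨h.1, h.2, Set.disjoint_left.1 hdPQ' hz⟩
    have hQ' : ∀ z ∈ Q', z ∈ insert x Q ∧ z ≠ y := fun z hz =>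
      have h : z ∈ insert x Q \ {y} := hPQ' ▸ Or.inr hz
      ⟨h.1, h.2⟩
    have hxy : x ∈ insert y P' := hAP' (Or.inl rfl)
    have hqy : q ∈ insert y P' := hAP' (Or.inr rfl)
    have hcover' : ∀ z ∈ insert x Q, z ≠ y → z ∈ P' ∨ z ∈ Q' := fun z hz hzy =>
      (hPQ' ▸ (⟨hz, hzy⟩ : z ∈ insert x Q \ {y}) : z ∈ P' ∪ Q')
    have hyP : y ∉ P := by
      rcases hy with rfl | hy
      · exact fun h => (hPM _ h).2.1 rfl
      · exact (hQM y hy).2.2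
    refine ⟨y, ?_, P ∪ P', Q', ?_, ?_, ?_, ?_, hBQ'⟩
    · rcases hy with rfl | hy
      exacts [hx, (hQM y hy).1]
    · ext z
      simp only [Set.mem_union, Set.mem_sdiff, Set.mem_singleton_iff]
      grind
    · rw [Set.disjoint_left]
      grind
    · intro a ha b hb hab
      have := hedges a b hab
      grind
    · intro z hz
      have := hAP hz
      grind
  left
  have hpx : p ≠ x := (hPM p hp).2.1
  have hqx : q ≠ x := (hQM q hq).2.1
  obtain ⟨M₁, M₂, hM₁, hM₂, hMd, hMc₁, hMc₂, hMA₁, hMA₂, hxM, hpM⟩ :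
      ∃ M₁ M₂ : Set V, M₁ ⊆ insert x P ∧ M₂ ⊆ insert x P ∧ Disjoint M₁ M₂ ∧
        CutConnected H M₁ ∧ CutConnected H M₂ ∧ (M₁ ∩ A).Nonempty ∧ (M₂ ∩ A).Nonempty ∧
        x ∈ M₁ ∧ p ∈ M₂ := by
    obtain ⟨z, hz, hz'⟩ := hMB₁
    obtain ⟨w, hw, hw'⟩ := hMB₂
    have hzw : z ≠ w := fun h => Set.disjoint_left.1 hMd hz (h ▸ hw)
    rcases hz' with rfl | rfl <;> rcases hw' with rfl | rfl
    · exact absurd rfl hzw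
    · exact ⟨M₁, M₂, hM₁, hM₂, hMd, hMc₁, hMc₂, hMA₁, hMA₂, hz, hw⟩
    · exact ⟨M₂, M₁, hM₂, hM₁, hMd.symm, hMc₂, hMc₁, hMA₂, hMA₁, hw, hz⟩
    · exact absurd rfl hzw
  obtain ⟨N₁, N₂, hN₁, hN₂, hNd, hNc₁, hNc₂, hNB₁, hNB₂, hxN, hqN⟩ :
      ∃ N₁ N₂ : Set V, N₁ ⊆ insert x Q ∧ N₂ ⊆ insert x Q ∧ Disjoint N₁ N₂ ∧
        CutConnected H N₁ ∧ CutConnected H N₂ ∧ (N₁ ∩ B).Nonempty ∧ (N₂ ∩ B).Nonempty ∧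
        x ∈ N₁ ∧ q ∈ N₂ := by
    obtain ⟨z, hz, hz'⟩ := hNA₁
    obtain ⟨w, hw, hw'⟩ := hNA₂
    have hzw : z ≠ w := fun h => Set.disjoint_left.1 hNd hz (h ▸ hw)
    rcases hz' with rfl | rfl <;> rcases hw' with rfl | rfl
    · exact absurd rfl hzw
    · exact ⟨N₁, N₂, hN₁, hN₂, hNd, hNc₁, hNc₂, hNB₁, hNB₂, hz, hw⟩
    · exact ⟨N₂, N₁, hN₂, hN₁, hNd.symm, hNc₂, hNc₁, hNB₂, hNB₁, hw, hz⟩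
    · exact absurd rfl hzw
  have hsub : ∀ y, y ∈ insert x P ∨ y ∈ insert x Q → y ∈ M := by grind
  refine ⟨M₁ ∪ N₁, M₂ ∪ N₂, fun y hy => hsub y (hy.imp (@hM₁ y) (@hN₁ y)),
    fun y hy => hsub y (hy.imp (@hM₂ y) (@hN₂ y)), ?_,
    (hMc₁.mono hHG).union (hNc₁.mono hHG) hxM hxN,
    (hMc₂.mono hHG).union_of_adj (hNc₂.mono hHG) hpM hqN hpq,
    hMA₁.mono (Set.inter_subset_inter_left _ Set.subset_union_left),
    hNB₁.mono (Set.inter_subset_inter_left _ Set.subset_union_right),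
    hMA₂.mono (Set.inter_subset_inter_left _ Set.subset_union_left),
    hNB₂.mono (Set.inter_subset_inter_left _ Set.subset_union_right)⟩
  rw [Set.disjoint_left] at hMd hNd ⊢
  have hxM₂ := hMd hxM
  have hxN₂ := hNd hxN
  rintro y (hy | hy) (hy' | hy')
  · exact hMd hy hy'
  · have := hM₁ hy
    have := hN₂ hy'
    grind
  · have := hN₁ hy
    have := hM₂ hy'
    grind
  · exact hNd hy hy'

/-- Four disjoint connected, pairwise adjacent branch sets of `G` inside `W`. -/
def HasK4Model {V : Type} (G : SimpleGraph V) (W : Set V) : Prop :=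
  ∃ B : Fin 4 → Set V, (∀ i, B i ⊆ W) ∧ (∀ i, CutConnected G (B i)) ∧
    (∀ i j, i < j → Disjoint (B i) (B j)) ∧
    ∀ i j, i < j → ∃ a ∈ B i, ∃ b ∈ B j, G.Adj a b

/-- A `K₄`-model survives when a vertex `x` is expanded into a connected set `insert x D`. -/
theorem HasK4Model.expand {V : Type} {G H : SimpleGraph V} {W W' D : Set V} {x : V}
    (h : HasK4Model H W) (hW : W ⊆ W') (hD : D ⊆ W') (hdisj : Disjoint D W)
    (hconn : CutConnected G (insert x D))
    (hadj : ∀ a ∈ W, ∀ b ∈ W, H.Adj a b →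
      G.Adj a b ∨ (a = x ∧ ∃ d ∈ D, G.Adj d b) ∨ (b = x ∧ ∃ d ∈ D, G.Adj a d)) :
    HasK4Model G W' := by
  obtain ⟨B, hBW, hBc, hBd, hBa⟩ := h
  refine ⟨fun i => B i ∪ {z | x ∈ B i ∧ z ∈ D}, fun i => ?_, fun i => ?_, fun i j hij => ?_,
    fun i j hij => ?_⟩
  · exact Set.union_subset ((hBW i).trans hW) fun z hz => hD hz.2
  · have key : ∀ a ∈ B i, ∀ b ∈ B i, H.Adj a b →
        G.Adj a b ∨ (a = x ∧ ∃ d ∈ D, G.Adj d b) ∨ (b = x ∧ ∃ d ∈ D, G.Adj a d) :=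
      fun a ha b hb => hadj a (hBW i ha) b (hBW i hb)
    by_cases hx : x ∈ B i
    · refine CutConnected.of_mem (x := x) (Or.inl hx) fun T hT hxT hne => ?_
      by_cases hDT : D ⊆ T
      · obtain ⟨y, hy | hy, hyT⟩ := hne
        · obtain ⟨a, ha, b, hb, hab⟩ := (hBc i).2 (B i ∩ T) Set.inter_subset_left ⟨x, hx, hxT⟩
            ⟨y, hy, fun h => hyT h.2⟩
          have hbT : b ∉ T := fun h => hb.2 ⟨hb.1, h⟩
          rcases key a ha.1 b hb.1 hab with h | ⟨-, d, hd, h⟩ | ⟨rfl, -⟩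
          · exact ⟨a, ha.2, b, ⟨Or.inl hb.1, hbT⟩, h⟩
          · exact ⟨d, hDT hd, b, ⟨Or.inl hb.1, hbT⟩, h⟩
          · exact absurd hxT hbT
        · exact absurd (hDT hy.2) hyT
      · obtain ⟨y, hy, hyT⟩ := Set.not_subset.1 hDT
        refine hconn.exists_adj_of_subset ?_ (Or.inl rfl) hxT (Or.inr hy) hyT
        rintro z (rfl | hz)
        exacts [Or.inl hx, Or.inr ⟨hx, hz⟩]
    · have hempty : {z | x ∈ B i ∧ z ∈ D} = ∅ := by simp [hx]
      simp only [hempty, Set.union_empty]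
      refine ⟨(hBc i).1, fun T hT h₁ h₂ => ?_⟩
      obtain ⟨a, ha, b, hb, hab⟩ := (hBc i).2 T hT h₁ h₂
      rcases key a (hT ha) b hb.1 hab with h | ⟨rfl, -⟩ | ⟨rfl, -⟩
      exacts [⟨a, ha, b, hb, h⟩, absurd (hT ha) hx, absurd hb.1 hx]
  · rw [Set.disjoint_left] at hdisj ⊢
    have h₁ := Set.disjoint_left.1 (hBd i j hij)
    rintro z (hz | ⟨hz, hzD⟩) (hz' | ⟨hz', hzD'⟩)
    · exact h₁ hz hz'
    · exact hdisj hzD' (hBW i hz)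
    · exact hdisj hzD (hBW j hz')
    · exact h₁ hz hz'
  · obtain ⟨a, ha, b, hb, hab⟩ := hBa i j hij
    rcases hadj a (hBW i ha) b (hBW j hb) hab with h | ⟨rfl, d, hd, h⟩ | ⟨rfl, d, hd, h⟩
    · exact ⟨a, Or.inl ha, b, Or.inl hb, h⟩
    · exact ⟨d, Or.inr ⟨ha, hd⟩, b, Or.inl hb, h⟩
    · exact ⟨a, Or.inl ha, d, Or.inr ⟨hb, hd⟩, h⟩

/-- A vertex set `M` with roots `u` and `v` all of whose parts are attached to the rest, and
that has no `K₄`-minor when the roots are joined. -/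
structure Rooted {V : Type} (G : SimpleGraph V) (u v : V) (M : Set V) : Prop where
  ne : u ≠ v
  left_notMem : u ∉ M
  right_notMem : v ∉ M
  attached : ∀ T ⊆ M, T.Nonempty → ∃ t ∈ T, ∃ w, w ∉ T ∧ (w ∈ M ∨ w = u ∨ w = v) ∧ G.Adj t w
  noK4 : ¬ HasK4Model (G ⊔ SimpleGraph.edge u v) (insert u (insert v M))

namespace Rooted

variable {V : Type} {G : SimpleGraph V} {u v x : V} {M P Q : Set V}

theorem symm (h : Rooted G u v M) : Rooted G v u M where
  ne := h.ne.symm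
  left_notMem := h.right_notMem
  right_notMem := h.left_notMem
  attached T hT hne := by
    obtain ⟨t, ht, w, hw, hw', htw⟩ := h.attached T hT hne
    exact ⟨t, ht, w, hw, by tauto, htw⟩
  noK4 := by
    rw [SimpleGraph.edge_comm, Set.insert_comm]
    exact h.noK4

/-- A part of `M` without edges to the rest of `M` is again rooted. -/
theorem of_isolated (h : Rooted G u v M) (hP : P ⊆ M)
    (hno : ∀ a ∈ P, ∀ b ∈ M \ P, ¬ G.Adj a b) : Rooted G u v P where
  ne := h.ne
  left_notMem hu := h.left_notMem (hP hu)
  right_notMem hv := h.right_notMem (hP hv)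
  attached T hT hne := by
    obtain ⟨t, ht, w, hw, hw', htw⟩ := h.attached T (hT.trans hP) hne
    refine ⟨t, ht, w, hw, ?_, htw⟩
    by_contra hcon
    exact hno t (hT ht) w ⟨by tauto, by tauto⟩ htw
  noK4 hK := h.noK4 <| by
    refine hK.expand (D := ∅) (x := u) (by gcongr) (Set.empty_subset _) (Set.empty_disjoint _)
      ?_ fun a _ b _ hab => Or.inl hab
    rw [insert_empty_eq]
    exact .singleton u

theorem not_disjoint_connections [Finite V] (h : Rooted G u v M) (hM : CutConnected G M)
    {M₁ M₂ : Set V} (h₁ : M₁ ⊆ M) (h₂ : M₂ ⊆ M) (hd : Disjoint M₁ M₂) (hc₁ : CutConnected G M₁)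
    (hc₂ : CutConnected G M₂) (hu₁ : ∃ a ∈ M₁, G.Adj u a) (hv₁ : ∃ a ∈ M₁, G.Adj v a)
    (hu₂ : ∃ a ∈ M₂, G.Adj u a) (hv₂ : ∃ a ∈ M₂, G.Adj v a) : False := by
  obtain ⟨N, hN₁, hN⟩ := Finite.exists_le_maximal
    (p := fun N : Set V => N ⊆ M ∧ Disjoint N M₂ ∧ CutConnected G N) ⟨h₁, hd, hc₁⟩
  obtain ⟨hNM, hNd, hNc⟩ := hN.prop
  have hNM₂ : ∃ a ∈ N, ∃ b ∈ M₂, G.Adj a b := by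
    obtain ⟨y, hy⟩ := hc₂.1
    obtain ⟨a, ha, b, hb, hab⟩ := hM.2 N hNM hNc.1 ⟨y, h₂ hy, Set.disjoint_right.1 hNd hy⟩
    by_cases hb₂ : b ∈ M₂
    · exact ⟨a, ha, b, hb₂, hab⟩
    · refine absurd (hN.le_of_ge ⟨?_, ?_, hNc.union_of_adj (.singleton b) ha rfl hab⟩
        Set.subset_union_left (Or.inr rfl)) hb.2
      · exact Set.union_subset hNM (Set.singleton_subset_iff.2 hb.1)
      · exact Set.disjoint_union_left.2 ⟨hNd, Set.disjoint_singleton_left.2 hb₂⟩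
  have hle : G ≤ G ⊔ SimpleGraph.edge u v := le_sup_left
  obtain ⟨a₁, ha₁, hua₁⟩ := hu₁
  obtain ⟨b₁, hb₁, hvb₁⟩ := hv₁
  obtain ⟨a₂, ha₂, hua₂⟩ := hu₂
  obtain ⟨b₂, hb₂, hvb₂⟩ := hv₂
  obtain ⟨c, hc, d, hcd, hadj⟩ := hNM₂
  have huv : (G ⊔ SimpleGraph.edge u v).Adj u v := by
    simp [SimpleGraph.edge_adj, h.ne]
  have huM := h.left_notMem
  have hvM := h.right_notMem
  refine h.noK4 ⟨![{u}, {v}, N, M₂], ?_, ?_, ?_, ?_⟩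
  · intro i
    fin_cases i
    · exact Set.singleton_subset_iff.2 (Or.inl rfl)
    · exact Set.singleton_subset_iff.2 (Or.inr (Or.inl rfl))
    · exact fun z hz => Or.inr (Or.inr (hNM hz))
    · exact fun z hz => Or.inr (Or.inr (h₂ hz))
  · intro i
    fin_cases i
    exacts [.singleton u, .singleton v, hNc.mono hle, hc₂.mono hle]
  · intro i j hij
    fin_cases i <;> fin_cases j <;> first | exact absurd hij (by decide) | skip
    · exact Set.disjoint_singleton.2 h.ne
    · exact Set.disjoint_singleton_left.2 fun hu => huM (hNM hu)
    · exact Set.disjoint_singleton_left.2 fun hu => huM (h₂ hu)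
    · exact Set.disjoint_singleton_left.2 fun hv => hvM (hNM hv)
    · exact Set.disjoint_singleton_left.2 fun hv => hvM (h₂ hv)
    · exact hNd
  · intro i j hij
    fin_cases i <;> fin_cases j <;> first | exact absurd hij (by decide) | skip
    · exact ⟨u, rfl, v, rfl, huv⟩
    · exact ⟨u, rfl, a₁, hN₁ ha₁, hle hua₁⟩
    · exact ⟨u, rfl, a₂, ha₂, hle hua₂⟩
    · exact ⟨v, rfl, b₁, hN₁ hb₁, hle hvb₁⟩
    · exact ⟨v, rfl, b₂, hb₂, hle hvb₂⟩
    · exact ⟨c, hc, d, hcd, hle hadj⟩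

/-- One side of a cut vertex `x` is rooted at `u` and `x`. -/
theorem of_separator (h : Rooted G u v M) (hM : CutConnected G M) (hx : x ∈ M)
    (hPQ : P ∪ Q = M \ {x}) (hd : Disjoint P Q) (hno : ∀ a ∈ P, ∀ b ∈ Q, ¬ G.Adj a b)
    (hvP : ∀ a ∈ P, ¬ G.Adj v a) (hconn : (∃ b ∈ M, G.Adj v b) ∨ G.Adj u x) :
    Rooted G u x P := by
  have hmem : ∀ z, z ∈ M ↔ z ∈ P ∨ z ∈ Q ∨ z = x := fun z => by
    have := Set.ext_iff.1 hPQ z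
    simp only [Set.mem_union, Set.mem_sdiff, Set.mem_singleton_iff] at this
    by_cases hzx : z = x
    · simp [hzx, hx]
    · tauto
  have hxPQ : x ∉ P ∪ Q := by simp [hPQ]
  have huM := h.left_notMem
  have hvM := h.right_notMem
  rw [Set.disjoint_left] at hd
  refine ⟨fun hux => huM (hux ▸ hx), fun hu => huM ((hmem u).2 (Or.inl hu)),
    fun hxP => hxPQ (Or.inl hxP), fun T hT hne => ?_, fun hK => ?_⟩
  · obtain ⟨a, ha, b, hb, hab⟩ := hM.2 T (fun z hz => (hmem z).2 (Or.inl (hT hz))) hne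
      ⟨x, hx, fun hxT => hxPQ (Or.inl (hT hxT))⟩
    refine ⟨a, ha, b, hb.2, ?_, hab⟩
    have := hno a (hT ha) b
    have := (hmem b).1 hb.1
    tauto
  · by_cases hux : G.Adj u x
    · refine h.noK4 (hK.expand (D := ∅) (x := u) ?_ (Set.empty_subset _) (Set.empty_disjoint _)
        (by rw [insert_empty_eq]; exact .singleton u) fun a _ b _ hab => Or.inl ?_)
      · grind
      · rcases hab with hab | hab
        · exact Or.inl hab
        · rw [SimpleGraph.edge_adj] at hab
          rcases hab.1 with ⟨rfl, rfl⟩ | ⟨rfl, rfl⟩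
          exacts [Or.inl hux, Or.inl hux.symm]
    · obtain ⟨b, hbM, hvb⟩ := hconn.resolve_right hux
      refine h.noK4 (hK.expand (D := insert v Q) (x := x) ?_ ?_ ?_ ?_ ?_)
      · grind
      · grind
      · rw [Set.disjoint_left]
        have := h.ne
        grind
      · refine (CutConnected.of_mem (x := x) (Or.inl rfl) fun T hT hxT hne => ?_).mono le_sup_left
        obtain ⟨y, hy, hyT⟩ := hne
        by_cases hS : ∃ z ∈ Q, z ∉ T
        · obtain ⟨z, hzQ, hzT⟩ := hS
          obtain ⟨c, hc, d, hd, hcd⟩ := hM.2 (Q \ T)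
            (fun z hz => (hmem z).2 (Or.inr (Or.inl hz.1))) ⟨z, hzQ, hzT⟩
            ⟨x, hx, fun hxT' => hxT'.2 hxT⟩
          have hdP : d ∉ P := fun hdP => hno d hdP c hc.1 hcd.symm
          have hdT : d ∈ T := by
            rcases (hmem d).1 hd.1 with hd' | hd' | rfl
            · exact absurd hd' hdP
            · exact not_not.1 fun hdT => hd.2 ⟨hd', hdT⟩
            · exact hxT
          exact ⟨d, hdT, c, ⟨Or.inr (Or.inr hc.1), hc.2⟩, hcd.symm⟩
        · push Not at hS
          have hyv : y = v := by grind
          have hbT : b ∈ T := by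
            have := hvP b
            grind
          exact ⟨b, hbT, y, ⟨hy, hyT⟩, hyv ▸ hvb.symm⟩
      · intro a ha b hb hab
        rcases hab with hab | hab
        · exact Or.inl (Or.inl hab)
        · have huv : (G ⊔ SimpleGraph.edge u v).Adj u v := by
            simp [SimpleGraph.edge_adj, h.ne]
          rw [SimpleGraph.edge_adj] at hab
          rcases hab.1 with ⟨rfl, rfl⟩ | ⟨rfl, rfl⟩
          · exact Or.inr (Or.inr ⟨rfl, v, Or.inl rfl, huv⟩)
          · exact Or.inr (Or.inl ⟨rfl, v, Or.inl rfl, huv.symm⟩)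

/-- A connected rooted set splits at a cut vertex. -/
theorem exists_separator [Finite V] (h : Rooted G u v M) (hM : CutConnected G M) :
    ∃ x ∈ M, ∃ P Q : Set V, P ∪ Q = M \ {x} ∧ Disjoint P Q ∧
      (∀ a ∈ P, ∀ b ∈ Q, ¬ G.Adj a b) ∧ (∀ a ∈ P, ¬ G.Adj v a) ∧ (∀ b ∈ Q, ¬ G.Adj u b) ∧
      ((∃ b ∈ M, G.Adj v b) ∨ G.Adj u x) ∧ ((∃ a ∈ M, G.Adj u a) ∨ G.Adj v x) := by
  by_cases hA : ∃ a ∈ M, G.Adj u a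
  swap
  · obtain ⟨t, ht, w, hw, hw', htw⟩ := h.attached M subset_rfl hM.1
    push Not at hA
    rcases hw' with hw' | rfl | rfl
    · exact absurd hw' hw
    · exact absurd htw.symm (hA t ht)
    · exact ⟨t, ht, ∅, M \ {t}, by simp, by simp, by simp, by simp, fun b hb => hA b hb.1,
        Or.inl ⟨t, ht, htw.symm⟩, Or.inr htw.symm⟩
  by_cases hB : ∃ b ∈ M, G.Adj v b
  swap
  · obtain ⟨x, hx, hux⟩ := hA
    push Not at hB
    exact ⟨x, hx, M \ {x}, ∅, by simp, by simp, by simp, fun a ha => hB a ha.1, by simp,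
      Or.inr hux, Or.inl ⟨x, hx, hux⟩⟩
  rcases two_disjoint_connections_or_separator G M {a ∈ M | G.Adj u a} {b ∈ M | G.Adj v b} hM.1
      (Set.sep_subset _ _) (Set.sep_subset _ _) with
    ⟨M₁, M₂, h₁, h₂, hd, hc₁, hc₂, ⟨a₁, ha₁, ha₁'⟩, ⟨b₁, hb₁, hb₁'⟩, ⟨a₂, ha₂, ha₂'⟩,
      ⟨b₂, hb₂, hb₂'⟩⟩ | ⟨x, hx, P, Q, hPQ, hd, hno, hAP, hBQ⟩
  · exact (h.not_disjoint_connections hM h₁ h₂ hd hc₁ hc₂ ⟨a₁, ha₁, ha₁'.2⟩ ⟨b₁, hb₁, hb₁'.2⟩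
      ⟨a₂, ha₂, ha₂'.2⟩ ⟨b₂, hb₂, hb₂'.2⟩).elim
  · have hP : ∀ a ∈ P, a ∈ M ∧ a ≠ x := fun a ha => (hPQ ▸ Or.inl ha : a ∈ M \ {x})
    have hQ : ∀ b ∈ Q, b ∈ M ∧ b ≠ x := fun b hb => (hPQ ▸ Or.inr hb : b ∈ M \ {x})
    rw [Set.disjoint_left] at hd
    refine ⟨x, hx, P, Q, hPQ, Set.disjoint_left.2 hd, hno, fun a ha hva => ?_, fun b hb hub => ?_,
      Or.inl hB, Or.inl hA⟩
    · rcases hBQ ⟨(hP a ha).1, hva⟩ with h' | h'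
      exacts [(hP a ha).2 h', hd ha h']
    · rcases hAP ⟨(hQ b hb).1, hub⟩ with h' | h'
      exacts [(hQ b hb).2 h', hd h' hb]

/-- Rooted sets admit a series-parallel decomposition. -/
theorem piece [Finite V] [DecidableEq V] {M : Finset V} (h : Rooted G u v M) :
    Piece G u v M := by
  induction M using Finset.strongInduction generalizing u v with
  | H M ih =>
  rcases M.eq_empty_or_nonempty with rfl | hne
  · exact .empty h.ne
  by_cases hM : CutConnected G (M : Set V)
  · obtain ⟨x, hx, P, Q, hPQ, hd, hno, hvP, huQ, hl, hr⟩ := h.exists_separator hM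
    have hRP := h.of_separator hM hx hPQ hd hno hvP hl
    have hRQ := (h.symm.of_separator hM hx (by rwa [Set.union_comm]) hd.symm
      (fun a ha b hb hab => hno b hb a ha hab.symm) huQ hr).symm
    lift P to Finset V using P.toFinite
    lift Q to Finset V using Q.toFinite
    have hPQ' : P ∪ Q = M.erase x := by
      rw [← Finset.coe_inj]
      simpa using hPQ
    have hlt : M.erase x ⊂ M := Finset.erase_ssubset hx
    have hPM : P ⊂ M := (hPQ' ▸ Finset.subset_union_left : P ⊆ M.erase x).trans_ssubset hlt
    have hQM : Q ⊂ M := (hPQ' ▸ Finset.subset_union_right : Q ⊆ M.erase x).trans_ssubset hlt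
    rw [← Finset.insert_erase hx, ← hPQ']
    refine .series (ih P hPM hRP) (ih Q hQM hRQ) h.ne (fun hu => h.left_notMem (hQM.1 hu))
      (fun hv => h.right_notMem (hPM.1 hv)) (Finset.disjoint_coe.1 hd) hno ?_ ?_
    · intro a ha b hb hab
      exact hvP a ha (Finset.mem_singleton.1 hb ▸ hab.symm)
    · intro a ha b hb hab
      exact huQ a ha (Finset.mem_singleton.1 hb ▸ hab.symm)
  · obtain ⟨T, hT, hTne, hTc, hno⟩ := CutConnected.exists_cut hne hM
    lift T to Finset V using T.toFinite
    have hTM : T ⊆ M := hT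
    have hT₁ := h.of_isolated hT hno
    have hT₂ : Rooted G u v ↑(M \ T) := by
      refine h.of_isolated (by simp) fun a ha b hb hab => ?_
      simp only [Finset.coe_sdiff, Set.sdiff_sdiff_cancel_left hT] at ha hb
      exact hno b hb a ha hab.symm
    rw [← Finset.union_sdiff_of_subset hTM]
    refine .parallel (ih T ?_ hT₁) (ih (M \ T) ?_ hT₂) Finset.disjoint_sdiff ?_
    · refine hTM.ssubset_of_ne ?_
      rintro rfl
      simp at hTc
    · exact Finset.sdiff_ssubset hTM hTne
    · intro a ha b hb
      exact hno a ha b (by simpa using hb)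

end Rooted

theorem HasK4Model.mono {V : Type} {G : SimpleGraph V} {W W' : Set V} (h : HasK4Model G W)
    (hW : W ⊆ W') : HasK4Model G W' := by
  obtain ⟨B, hB, h⟩ := h
  exact ⟨B, fun i => (hB i).trans hW, h⟩

/-- A set without a `K₄`-model contains a circle drawable set with four fifths of its vertices. -/
theorem exists_circleDrawable_of_not_hasK4Model {V : Type} [Finite V] [DecidableEq V]
    {G : SimpleGraph V} (W : Finset V) (hW : ¬ HasK4Model G (W : Set V)) :
    ∃ Y ⊆ W, CircleDrawable G Y ∧ 4 * W.card ≤ 5 * Y.card := by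
  induction W using Finset.strongInduction with
  | H W ih =>
  rcases W.eq_empty_or_nonempty with rfl | hne
  · exact ⟨∅, subset_rfl, ⟨[], by simp, by simp, .of_length_lt (by simp)⟩, by simp⟩
  by_cases hc : CutConnected G (W : Set V)
  · obtain ⟨u, hu⟩ := hne
    by_cases hu' : W = {u}
    · subst hu'
      exact ⟨{u}, subset_rfl, circleDrawable_singleton u, by simp⟩
    obtain ⟨w, hw, hwu⟩ : ∃ w ∈ W, w ≠ u := by
      by_contra hcon
      push Not at hcon
      exact hu' (Finset.eq_singleton_iff_unique_mem.2 ⟨hu, hcon⟩)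
    obtain ⟨a, ha, v, hv, huv⟩ := hc.2 {u} (by simpa using hu) (Set.singleton_nonempty u)
      ⟨w, hw, hwu⟩
    obtain rfl : a = u := ha
    have hWM : insert a (insert v (W \ {a, v})) = W := by
      ext z
      have : v ∈ W := hv.1
      simp only [Finset.mem_insert, Finset.mem_sdiff, Finset.mem_singleton]
      grind
    have hR : Rooted G a v ↑(W \ {a, v}) := by
      refine ⟨huv.ne, by simp, by simp, fun T hT hTne => ?_, ?_⟩
      · have haT : a ∉ T := fun h => by simpa using hT h
        obtain ⟨t, ht, b, hb, htb⟩ := hc.2 T (hT.trans (by simp)) hTne ⟨a, hu, haT⟩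
        refine ⟨t, ht, b, hb.2, ?_, htb⟩
        have := hb.1
        simp only [Finset.coe_sdiff, Set.mem_sdiff, Finset.coe_insert, Finset.coe_singleton]
        grind
      · have hG : G ⊔ SimpleGraph.edge a v = G := sup_eq_left.2 <|
          (SimpleGraph.edge_le_iff G).2 (Or.inr huv)
        rw [hG, ← Finset.coe_insert, ← Finset.coe_insert, hWM]
        exact hW
    have := hR.piece.exists_circleDrawable
    rwa [hWM] at this
  · obtain ⟨T, hT, hTne, hTc, hno⟩ := CutConnected.exists_cut hne hc
    lift T to Finset V using T.toFinite
    have hTW : T ⊆ W := hT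
    obtain ⟨Y, hY, hYc, hYn⟩ := ih T
      (hTW.ssubset_of_ne (by rintro rfl; simp at hTc)) fun h => hW (h.mono hT)
    obtain ⟨Z, hZ, hZc, hZn⟩ := ih (W \ T) (Finset.sdiff_ssubset hTW hTne)
      fun h => hW (h.mono (by simp))
    have hd : Disjoint Y Z := Finset.disjoint_sdiff.mono hY hZ
    refine ⟨Y ∪ Z, Finset.union_subset (hY.trans hTW) (hZ.trans Finset.sdiff_subset),
      hYc.union hZc hd fun a ha b hb => hno a (hY ha) b (by simpa using hZ hb), ?_⟩
    have := Finset.card_sdiff_add_card_eq_card hTW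
    rw [Finset.card_union_of_disjoint hd]
    omega

theorem K4MinorFree.not_hasK4Model {V : Type} {G : SimpleGraph V} {W : Set V}
    (h : K4MinorFree (G.induce W)) : ¬ HasK4Model G W := by
  rintro ⟨B, hBW, hBc, hBd, hBa⟩
  refine h ⟨fun i => Subtype.val ⁻¹' B i, fun i => ?_, fun i => ?_, fun i j hij => ?_,
    fun i j hij => ?_⟩
  · obtain ⟨x, hx⟩ := (hBc i).1
    exact ⟨⟨x, hBW i hx⟩, hx⟩
  · refine CutConnected.connected_induce ⟨?_, fun T hT h₁ h₂ => ?_⟩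
    · obtain ⟨x, hx⟩ := (hBc i).1
      exact ⟨⟨x, hBW i hx⟩, hx⟩
    · obtain ⟨y, hy, hyT⟩ := h₂
      obtain ⟨_, ⟨a, ha, rfl⟩, b, ⟨hb, hbT⟩, hab⟩ := (hBc i).2 (Subtype.val '' T)
        (Set.image_subset_iff.2 hT) (h₁.image _) ⟨y, hy, by simpa using hyT⟩
      exact ⟨a, ha, ⟨b, hBW i hb⟩, ⟨hb, fun h' => hbT ⟨_, h', rfl⟩⟩, hab⟩
  · rcases lt_or_gt_of_ne hij with hij | hij
    exacts [(hBd i j hij).preimage _, ((hBd j i hij).preimage _).symm]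
  · rcases lt_or_gt_of_ne hij with hij | hij
    · obtain ⟨a, ha, b, hb, hab⟩ := hBa i j hij
      exact ⟨⟨a, hBW i ha⟩, ha, ⟨b, hBW j hb⟩, hb, hab⟩
    · obtain ⟨a, ha, b, hb, hab⟩ := hBa j i hij
      exact ⟨⟨b, hBW i hb⟩, hb, ⟨a, hBW j ha⟩, ha, hab.symm⟩

theorem bddAbove_card_of_finset {V : Type} [Fintype V] (p : Finset V → Prop) :
    BddAbove {n | ∃ S : Finset V, p S ∧ S.card = n} := by
  refine ⟨Fintype.card V, ?_⟩
  rintro _ ⟨S, -, rfl⟩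
  exact S.card_le_univ

theorem exists_k4MinorFree_card_eq_sK4 {V : Type} [Fintype V] (G : SimpleGraph V) :
    ∃ S : Finset V, K4MinorFree (G.induce (↑S : Set V)) ∧ S.card = sK4 G := by
  have hne : {n | ∃ S : Finset V, K4MinorFree (G.induce (↑S : Set V)) ∧ S.card = n}.Nonempty := by
    refine ⟨0, ∅, ?_, rfl⟩
    rintro ⟨B, hB, -⟩
    obtain ⟨⟨x, hx⟩, -⟩ := hB 0
    simp at hx
  exact Nat.sSup_mem hne (bddAbove_card_of_finset _)

/-- For a planar graph `G` of order `n`: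
`s_{K₄}(G) − s_o(G) ≤ (1/5)·s_{K₄}(G) ≤ n/5`. -/
theorem stmt8 (V : Type) [Fintype V] (G : SimpleGraph V) (hG : IsPlanar G) :
    (sK4 G : ℚ) - (sO G : ℚ) ≤ (sK4 G : ℚ) / 5 ∧
    (sK4 G : ℚ) / 5 ≤ (Fintype.card V : ℚ) / 5 := by
  classical
  obtain ⟨S, hS, hcard⟩ := exists_k4MinorFree_card_eq_sK4 G
  obtain ⟨Y, -, hY, hle⟩ := exists_circleDrawable_of_not_hasK4Model S hS.not_hasK4Model
  have hYO : Y.card ≤ sO G := le_csSup (bddAbove_card_of_finset _) ⟨Y, hY.isOuterplanar, rfl⟩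
  have hn : sK4 G ≤ Fintype.card V := hcard ▸ S.card_le_univ
  have h45 : (4 * sK4 G : ℚ) ≤ 5 * sO G := by
    exact_mod_cast (by omega : 4 * sK4 G ≤ 5 * sO G)
  have hn' : (sK4 G : ℚ) ≤ Fintype.card V := by exact_mod_cast hn
  constructor <;> linarith
end

section
/- Let G be a planar graph. Then (4/5)·s_{K4}(G) ≤ s_o(G). -/
namespace SimpleGraph

variable {V : Type} {G G' : SimpleGraph V}

/-- `B` is nonempty and connected in `G`, phrased through adjacency-closed subsets. -/
def ConnectedOn (G : SimpleGraph V) (B : Set V) : Prop :=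
  B.Nonempty ∧ ∀ T ⊆ B, T.Nonempty → (∀ u ∈ T, ∀ v ∈ B, G.Adj u v → v ∈ T) → T = B

/-- No `K₄`-minor of `G` has all its branch sets inside `S`. -/
def K4MinorFreeOn (G : SimpleGraph V) (S : Set V) : Prop :=
  ¬ ∃ B : Fin 4 → Set V, (∀ i, B i ⊆ S) ∧ (∀ i, G.ConnectedOn (B i)) ∧
    (∀ i j, i ≠ j → Disjoint (B i) (B j)) ∧
    (∀ i j, i ≠ j → ∃ u ∈ B i, ∃ v ∈ B j, G.Adj u v)

theorem ConnectedOn.singleton (v : V) : G.ConnectedOn {v} := by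
  refine ⟨Set.singleton_nonempty v, fun T hT hne _ => ?_⟩
  exact hne.subset_singleton_iff.1 hT

theorem ConnectedOn.insert {B : Set V} (h : G.ConnectedOn B) {u v : V} (hu : u ∈ B)
    (huv : G.Adj u v) : G.ConnectedOn (insert v B) := by
  refine ⟨Set.insert_nonempty v B, fun T hT hne hcl => ?_⟩
  have huT : u ∈ T := by
    obtain ⟨t, ht⟩ := hne
    rcases hT ht with rfl | htB
    · exact hcl t ht u (Or.inr hu) huv.symm
    · have := h.2 (T ∩ B) Set.inter_subset_right ⟨t, ht, htB⟩
        (fun a ha b hb hab => ⟨hcl a ha.1 b (Or.inr hb) hab, hb⟩)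
      exact (this.ge hu).1
  have hBT : B ⊆ T := by
    have := h.2 (T ∩ B) Set.inter_subset_right ⟨u, huT, hu⟩
      (fun a ha b hb hab => ⟨hcl a ha.1 b (Or.inr hb) hab, hb⟩)
    intro b hb
    exact (this.ge hb).1
  exact hT.antisymm (Set.insert_subset (hcl u huT v (Or.inl rfl) huv) hBT)

theorem ConnectedOn.connected_induce {B : Set V} (h : G.ConnectedOn B) :
    (G.induce B).Connected := by
  obtain ⟨⟨a, ha⟩, hB⟩ := h
  rw [connected_iff_exists_forall_reachable]
  refine ⟨⟨a, ha⟩, ?_⟩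
  have := hB {v | ∃ hv : v ∈ B, (G.induce B).Reachable ⟨a, ha⟩ ⟨v, hv⟩}
    (fun v hv => hv.1) ⟨a, ha, Reachable.rfl⟩ (by
      rintro u ⟨hu, hr⟩ v hv huv
      refine ⟨hv, hr.trans (Adj.reachable ?_)⟩
      simpa using huv)
  rintro ⟨w, hw⟩
  rw [← this] at hw
  exact hw.2

theorem ConnectedOn.induce {B S : Set V} (h : G.ConnectedOn B) (hS : B ⊆ S) :
    (G.induce S).ConnectedOn {w | (w : V) ∈ B} := by
  obtain ⟨⟨a, ha⟩, hB⟩ := h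
  refine ⟨⟨⟨a, hS ha⟩, ha⟩, fun T hT hne hcl => hT.antisymm fun w hw => ?_⟩
  have := hB (Subtype.val '' T) (by rintro _ ⟨t, ht, rfl⟩; exact hT ht) (hne.image _) (by
    rintro _ ⟨t, ht, rfl⟩ v hv htv
    exact ⟨⟨v, hS hv⟩, hcl t ht ⟨v, hS hv⟩ hv htv, rfl⟩)
  have hw' : (w : V) ∈ Subtype.val '' T := by rw [this]; exact hw
  obtain ⟨t, ht, htw⟩ := hw'
  exact Subtype.ext htw ▸ ht

theorem K4MinorFreeOn.of_induce {S : Set V} (h : K4MinorFree (G.induce S)) :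
    G.K4MinorFreeOn S := by
  rintro ⟨B, hBS, hconn, hdisj, hadj⟩
  refine h ⟨fun i => {w | (w : V) ∈ B i}, fun i => ((hconn i).induce (hBS i)).1,
    fun i => ((hconn i).induce (hBS i)).connected_induce, fun i j hij => ?_, fun i j hij => ?_⟩
  · exact (hdisj i j hij).preimage Subtype.val
  · obtain ⟨u, hu, v, hv, huv⟩ := hadj i j hij
    exact ⟨⟨u, hBS i hu⟩, hu, ⟨v, hBS j hv⟩, hv, huv⟩

theorem K4MinorFreeOn.mono {S T : Set V} (h : G.K4MinorFreeOn S) (hT : T ⊆ S) :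
    G.K4MinorFreeOn T := by
  rintro ⟨B, hB, hrest⟩
  exact h ⟨B, fun i => (hB i).trans hT, hrest⟩

/-- A triangle together with a connected set meeting the neighbourhood of each of its corners
is a `K₄`-minor. -/
theorem K4MinorFreeOn.not_triangle_connectedOn {S : Set V} (h : G.K4MinorFreeOn S) {p q r : V}
    {A : Set V} (hp : p ∈ S) (hq : q ∈ S) (hr : r ∈ S) (hA : A ⊆ S) (hconn : G.ConnectedOn A)
    (hpA : p ∉ A) (hqA : q ∉ A) (hrA : r ∉ A) (hpq : G.Adj p q) (hpr : G.Adj p r)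
    (hqr : G.Adj q r) (hpa : ∃ a ∈ A, G.Adj p a) (hqa : ∃ a ∈ A, G.Adj q a)
    (hra : ∃ a ∈ A, G.Adj r a) : False := by
  obtain ⟨a, ha, hpa⟩ := hpa
  obtain ⟨b, hb, hqb⟩ := hqa
  obtain ⟨c, hc, hrc⟩ := hra
  have key : ∀ i j : Fin 4, i < j → Disjoint ((![{p}, {q}, {r}, A] : Fin 4 → Set V) i)
        ((![{p}, {q}, {r}, A] : Fin 4 → Set V) j) ∧
      ∃ u ∈ (![{p}, {q}, {r}, A] : Fin 4 → Set V) i,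
        ∃ v ∈ (![{p}, {q}, {r}, A] : Fin 4 → Set V) j, G.Adj u v := by
    intro i j hij
    fin_cases i <;> fin_cases j <;> simp at hij ⊢
    · exact ⟨hpq.ne, hpq⟩
    · exact ⟨hpr.ne, hpr⟩
    · exact ⟨hpA, a, ha, hpa⟩
    · exact ⟨hqr.ne, hqr⟩
    · exact ⟨hqA, b, hb, hqb⟩
    · exact ⟨hrA, c, hc, hrc⟩
  refine h ⟨![{p}, {q}, {r}, A], fun i => ?_, fun i => ?_, fun i j hij => ?_, fun i j hij => ?_⟩
  · fin_cases i <;> simp [hp, hq, hr, hA]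
  · fin_cases i
    exacts [.singleton p, .singleton q, .singleton r, hconn]
  · rcases lt_or_gt_of_ne hij with h' | h'
    exacts [(key i j h').1, (key j i h').1.symm]
  · rcases lt_or_gt_of_ne hij with h' | h'
    · exact (key i j h').2
    · obtain ⟨u, hu, v, hv, huv⟩ := (key j i h').2
      exact ⟨v, hv, u, hu, huv.symm⟩

theorem K4MinorFreeOn.not_clique {S : Set V} (h : G.K4MinorFreeOn S) {p q r s : V}
    (hp : p ∈ S) (hq : q ∈ S) (hr : r ∈ S) (hs : s ∈ S) (hpq : G.Adj p q) (hpr : G.Adj p r)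
    (hps : G.Adj p s) (hqr : G.Adj q r) (hqs : G.Adj q s) (hrs : G.Adj r s) : False :=
  h.not_triangle_connectedOn (A := {s}) hp hq hr (by simpa using hs) (.singleton s)
    hps.ne hqs.ne hrs.ne hpq hpr hqr ⟨s, rfl, hps⟩ ⟨s, rfl, hqs⟩ ⟨s, rfl, hrs⟩

/-- The graph obtained by making every neighbour of `u` a neighbour of `a`; away from `u` it is
the contraction of the edge `au` onto `a`. -/
def contractOnto (G : SimpleGraph V) (a u : V) : SimpleGraph V where
  Adj x y := x ≠ y ∧ (G.Adj x y ∨ (x = a ∧ G.Adj u y) ∨ (y = a ∧ G.Adj u x))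
  symm := ⟨fun x y h => ⟨h.1.symm, by
    rcases h.2 with h | h | h
    exacts [Or.inl h.symm, Or.inr (Or.inr h), Or.inr (Or.inl h)]⟩⟩
  loopless := ⟨fun x h => h.1 rfl⟩

theorem le_contractOnto (a u : V) : G ≤ G.contractOnto a u :=
  fun _ _ h => ⟨h.ne, Or.inl h⟩

theorem K4MinorFreeOn.contractOnto {S : Set V} (h : G.K4MinorFreeOn S) {a u : V}
    (hu : u ∈ S) (hau : G.Adj a u) :
    (G.contractOnto a u).K4MinorFreeOn (S \ {u}) := by
  classical
  rintro ⟨B, hBS, hconn, hdisj, hadj⟩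
  have huB : ∀ i, u ∉ B i := fun i hi => (hBS i hi).2 rfl
  have hex : ∀ i, ∃ C : Set V, B i ⊆ C ∧ C ⊆ insert u (B i) ∧ (u ∈ C ↔ a ∈ B i) := by
    intro i
    by_cases ha : a ∈ B i
    · exact ⟨insert u (B i), Set.subset_insert _ _, subset_rfl, by simp [ha]⟩
    · exact ⟨B i, subset_rfl, Set.subset_insert _ _, by simp [ha, huB i]⟩
  choose C hBC hCB hCu using hex
  refine h ⟨C, fun i x hx => ?_, fun i => ⟨(hconn i).1.mono (hBC i), fun T hT hne hcl => ?_⟩,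
    fun i j hij => ?_, fun i j hij => ?_⟩
  · rcases hCB i hx with rfl | hx
    exacts [hu, (hBS i hx).1]
  · have huT : u ∈ T → a ∈ T := fun hut =>
      hcl u hut a (hBC i ((hCu i).1 (hT hut))) hau.symm
    have haT : a ∈ T → u ∈ T := fun hat => by
      refine hcl a hat u ((hCu i).2 ?_) hau
      rcases hCB i (hT hat) with h' | h'
      exacts [absurd h' hau.ne, h']
    have hTB : ∀ t ∈ T, t ≠ u → t ∈ B i := fun t ht htu => (hCB i (hT ht)).resolve_left htu
    have key := (hconn i).2 (T \ {u}) (fun t ht => hTB t ht.1 ht.2) (by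
      obtain ⟨t, ht⟩ := hne
      by_cases htu : t = u
      · exact ⟨a, huT (htu ▸ ht), hau.ne⟩
      · exact ⟨t, ht, htu⟩) (by
      rintro p ⟨hp, hpu⟩ q hq hpq
      have hqu : q ≠ u := fun h' => huB i (h' ▸ hq)
      refine ⟨?_, hqu⟩
      rcases hpq.2 with h' | ⟨rfl, h'⟩ | ⟨rfl, h'⟩
      · exact hcl p hp q (hBC i hq) h'
      · exact hcl u (haT hp) q (hBC i hq) h'
      · exact huT (hcl p hp u ((hCu i).2 hq) h'.symm))
    refine hT.antisymm fun x hx => ?_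
    rcases hCB i hx with rfl | hx'
    · have : a ∈ T \ {x} := by rw [key]; exact (hCu i).1 hx
      exact haT this.1
    · rw [← key] at hx'
      exact hx'.1
  · rw [Set.disjoint_left]
    intro x hxi hxj
    have hd := Set.disjoint_left.1 (hdisj i j hij)
    by_cases hxu : x = u
    · subst hxu
      exact hd ((hCu i).1 hxi) ((hCu j).1 hxj)
    · exact hd ((hCB i hxi).resolve_left hxu) ((hCB j hxj).resolve_left hxu)
  · obtain ⟨p, hp, q, hq, hpq⟩ := hadj i j hij
    rcases hpq.2 with h' | ⟨rfl, h'⟩ | ⟨rfl, h'⟩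
    · exact ⟨p, hBC i hp, q, hBC j hq, h'⟩
    · exact ⟨u, (hCu i).2 hp, q, hBC j hq, h'⟩
    · exact ⟨p, hBC i hp, u, (hCu j).2 hq, h'.symm⟩

/-- The vertex `v` has at most two neighbours inside `S`. -/
def DegreeLETwoOn (G : SimpleGraph V) (S : Finset V) (v : V) : Prop :=
  ∃ p q, ∀ w ∈ S, G.Adj v w → w = p ∨ w = q

theorem exists_adj_of_not_degreeLETwoOn {S : Finset V} {v : V} (h : ¬ G.DegreeLETwoOn S v)
    (p q : V) : ∃ w ∈ S, G.Adj v w ∧ w ≠ p ∧ w ≠ q := by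
  by_contra! hcon
  exact h ⟨p, q, fun w hw hvw => by
    by_contra! hne
    exact hne.2 (hcon w hw hvw hne.1)⟩

theorem three_le_card_of_not_degreeLETwoOn {S : Finset V} {v : V} (h : ¬ G.DegreeLETwoOn S v) :
    3 ≤ S.card := by
  obtain ⟨p, hp, -⟩ := exists_adj_of_not_degreeLETwoOn h v v
  obtain ⟨q, hq, -, hqp, -⟩ := exists_adj_of_not_degreeLETwoOn h p p
  obtain ⟨r, hr, -, hrp, hrq⟩ := exists_adj_of_not_degreeLETwoOn h p q
  exact (Finset.two_lt_card.2 ⟨p, hp, q, hq, r, hr, hqp.symm, hrp.symm, hrq.symm⟩)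

/-- Among the connected sets which contain `a` and lie in `U`, there is one that is closed under
adjacency in `U`. -/
theorem exists_connectedOn_closed [DecidableEq V] (G : SimpleGraph V) {U : Finset V} {a : V}
    (ha : a ∈ U) :
    ∃ A ⊆ U, a ∈ A ∧ G.ConnectedOn (A : Set V) ∧ ∀ x ∈ A, ∀ y ∈ U, G.Adj x y → y ∈ A := by
  classical
  obtain ⟨A, hA, hmax⟩ := Finset.exists_max_image
    (U.powerset.filter fun A : Finset V => a ∈ A ∧ G.ConnectedOn (A : Set V)) Finset.card
    ⟨{a}, by simpa [ha] using ConnectedOn.singleton a⟩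
  simp only [Finset.mem_filter, Finset.mem_powerset] at hA hmax
  refine ⟨A, hA.1, hA.2.1, hA.2.2, fun x hx y hy hxy => ?_⟩
  by_contra hyA
  have := hmax (insert y A) ⟨Finset.insert_subset hy hA.1, Finset.mem_insert_of_mem hA.2.1, by
    rw [Finset.coe_insert]
    exact hA.2.2.insert hx hxy⟩
  rw [Finset.card_insert_of_notMem hyA] at this
  omega

/-- The inductive hypothesis of `K4MinorFreeOn.exists_degreeLETwoOn`. -/
def SmallerHaveDegreeLETwo (S : Finset V) : Prop :=
  ∀ (H : SimpleGraph V) (T : Finset V), T.card < S.card → H.K4MinorFreeOn (T : Set V) →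
    ∀ a ∈ T, ∀ c ∈ T, H.Adj a c → 3 ≤ T.card → ∃ v ∈ T, v ≠ a ∧ v ≠ c ∧ H.DegreeLETwoOn T v

/-- A minimal counterexample has no proper subset, spanning an edge at `x`, all of whose vertices
other than `x` have high degree and all their neighbours inside it. -/
theorem SmallerHaveDegreeLETwo.false_of_closed {S : Finset V} (hIH : SmallerHaveDegreeLETwo S)
    (hK : G.K4MinorFreeOn (S : Set V)) {T : Finset V} (hTS : T ⊆ S) (hne : ∃ s ∈ S, s ∉ T)
    {x z : V} (hx : x ∈ T) (hz : z ∈ T) (hxz : G.Adj x z)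
    (hcl : ∀ v ∈ T, v ≠ x → ∀ w ∈ S, G.Adj v w → w ∈ T)
    (hdeg : ∀ v ∈ T, v ≠ x → ¬ G.DegreeLETwoOn S v) : False := by
  have hdegT : ∀ v ∈ T, v ≠ x → ¬ G.DegreeLETwoOn T v := by
    rintro v hv hvx ⟨p, q, hpq⟩
    exact hdeg v hv hvx ⟨p, q, fun w hw hvw => hpq w (hcl v hv hvx w hw hvw) hvw⟩
  obtain ⟨s, hs, hsT⟩ := hne
  obtain ⟨v, hv, hvx, -, hv2⟩ := hIH G T
    (Finset.card_lt_card ⟨hTS, fun h => hsT (h hs)⟩) (hK.mono (by exact_mod_cast hTS))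
    x hx z hz hxz (three_le_card_of_not_degreeLETwoOn (hdegT z hz hxz.ne'))
  exact hdegT v hv hvx hv2

section MinimalCounterexample

variable [DecidableEq V] {S : Finset V} {a c : V}

/-- If contracting the edge `au` creates a vertex of degree at most two, that vertex is a common
neighbour of `a` and `u` of degree three. -/
theorem exists_common_neighbor_of_contractOnto {u v : V} (hu : u ∈ S) (ha : a ∈ S)
    (hau : G.Adj a u) (hvu : v ≠ u) (hva : v ≠ a) (hdeg : ¬ G.DegreeLETwoOn S v)
    (hsmall : (G.contractOnto a u).DegreeLETwoOn (S.erase u) v) :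
    G.Adj v a ∧ G.Adj v u ∧ ∃ x, ∀ w ∈ S, G.Adj v w → w = a ∨ w = u ∨ w = x := by
  obtain ⟨p, q, hpq⟩ := hsmall
  have hN : ∀ w ∈ S, w ≠ u → G.Adj v w → w = p ∨ w = q := fun w hw hwu hvw =>
    hpq w (Finset.mem_erase.2 ⟨hwu, hw⟩) (le_contractOnto a u hvw)
  have hvu' : G.Adj v u := by
    by_contra hcon
    exact hdeg ⟨p, q, fun w hw hvw => hN w hw (by rintro rfl; exact hcon hvw) hvw⟩
  have hapq : a = p ∨ a = q := hpq a (Finset.mem_erase.2 ⟨hau.ne, ha⟩)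
    ⟨hva, Or.inr (Or.inr ⟨rfl, hvu'.symm⟩)⟩
  have hva' : G.Adj v a := by
    by_contra hcon
    rcases hapq with rfl | rfl
    · refine hdeg ⟨u, q, fun w hw hvw => ?_⟩
      by_cases hwu : w = u
      · exact Or.inl hwu
      · rcases hN w hw hwu hvw with rfl | h
        exacts [absurd hvw hcon, Or.inr h]
    · refine hdeg ⟨u, p, fun w hw hvw => ?_⟩
      by_cases hwu : w = u
      · exact Or.inl hwu
      · rcases hN w hw hwu hvw with h | rfl
        exacts [Or.inr h, absurd hvw hcon]
  refine ⟨hva', hvu', ?_⟩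
  rcases hapq with rfl | rfl
  · exact ⟨q, fun w hw hvw => by have := hN w hw; tauto⟩
  · exact ⟨p, fun w hw hvw => by have := hN w hw; tauto⟩

/-- If `v`, `w` are adjacent vertices of degree three with common neighbour `a` and different
third neighbours `y`, `x`, contracting `vw` creates no vertex of degree at most two. -/
theorem not_degreeLETwoOn_contractOnto {v w x y s : V} (hv : v ∈ S) (hw : w ∈ S)
    (hvw : G.Adj v w) (ha : a ∈ S) (hx : x ∈ S) (hy : y ∈ S) (hva : G.Adj v a)
    (hwa : G.Adj w a) (hwx : G.Adj w x) (hvy : G.Adj v y) (hxa : x ≠ a) (hya : y ≠ a)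
    (hxv : x ≠ v) (hyw : y ≠ w) (hxy : x ≠ y)
    (hNw : ∀ t ∈ S, G.Adj w t → t = a ∨ t = v ∨ t = x)
    (hNv : ∀ t ∈ S, G.Adj v t → t = a ∨ t = w ∨ t = y)
    (hs : s ∈ S) (hsv : s ≠ v) (hsa : s ≠ a) (hdeg : ¬ G.DegreeLETwoOn S s) :
    ¬ (G.contractOnto w v).DegreeLETwoOn (S.erase v) s := by
  intro hsmall
  by_cases hsw : s = w
  · subst hsw
    obtain ⟨p, q, hpq⟩ := hsmall
    have h₁ := hpq a (Finset.mem_erase.2 ⟨hva.ne', ha⟩) (le_contractOnto s v hwa)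
    have h₂ := hpq x (Finset.mem_erase.2 ⟨hxv, hx⟩) (le_contractOnto s v hwx)
    have h₃ := hpq y (Finset.mem_erase.2 ⟨hvy.ne', hy⟩) ⟨hyw.symm, Or.inr (Or.inl ⟨rfl, hvy⟩)⟩
    grind
  · obtain ⟨h₁, h₂, -⟩ := exists_common_neighbor_of_contractOnto hv hw hvw.symm hsv hsw
      hdeg hsmall
    have := hNw s hs h₁.symm
    have := hNv s hs h₂.symm
    grind

theorem SmallerHaveDegreeLETwo.exists_common_neighbor (hIH : SmallerHaveDegreeLETwo S)
    (hK : G.K4MinorFreeOn (S : Set V)) (ha : a ∈ S) (hc : c ∈ S) (hac : G.Adj a c)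
    (hcard : 4 ≤ S.card) (hdeg : ∀ v ∈ S, v ≠ a → v ≠ c → ¬ G.DegreeLETwoOn S v)
    {u : V} (hu : u ∈ S) (huc : u ≠ c) (hau : G.Adj a u) :
    ∃ w ∈ S, w ≠ c ∧ G.Adj w a ∧ G.Adj w u ∧ ∃ x, ∀ t ∈ S, G.Adj w t → t = a ∨ t = u ∨ t = x := by
  obtain ⟨v, hv, hva, hvc, hv2⟩ := hIH (G.contractOnto a u) (S.erase u)
    (Finset.card_erase_lt_of_mem hu) (by simpa using hK.contractOnto (S := (S : Set V)) hu hau)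
    a (Finset.mem_erase.2 ⟨hau.ne, ha⟩) c (Finset.mem_erase.2 ⟨huc.symm, hc⟩)
    (le_contractOnto a u hac) (by rw [Finset.card_erase_of_mem hu]; omega)
  rw [Finset.mem_erase] at hv
  exact ⟨v, hv.2, hvc, exists_common_neighbor_of_contractOnto hu ha hau hv.1 hva
    (hdeg v hv.2 hva hvc) hv2⟩

theorem SmallerHaveDegreeLETwo.false_of_adj (hIH : SmallerHaveDegreeLETwo S)
    (hK : G.K4MinorFreeOn (S : Set V)) (ha : a ∈ S) (hc : c ∈ S) (hac : G.Adj a c)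
    (hdeg : ∀ v ∈ S, v ≠ a → v ≠ c → ¬ G.DegreeLETwoOn S v)
    {u : V} (hu : u ∈ S) (huc : u ≠ c) (hau : G.Adj a u) : False := by
  have hcard : 4 ≤ S.card := by
    obtain ⟨s, hs, hus, hsa, hsc⟩ :=
      exists_adj_of_not_degreeLETwoOn (hdeg u hu hau.ne' huc) a c
    have : ({a, c, u, s} : Finset V) ⊆ S := by
      intro t
      simp only [Finset.mem_insert, Finset.mem_singleton]
      grind
    refine le_trans (le_of_eq ?_) (Finset.card_le_card this)
    have h₁ := hac.ne
    have h₂ := hau.ne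
    have h₃ := hus.ne
    grind
  obtain ⟨w, hw, hwc, hwa, hwu, x, hNw⟩ :=
    hIH.exists_common_neighbor hK ha hc hac hcard hdeg hu huc hau
  obtain ⟨v, hv, hvc, hva, hvw, y, hNv⟩ :=
    hIH.exists_common_neighbor hK ha hc hac hcard hdeg hw hwc hwa.symm
  have hNw' : ∃ x, ∀ t ∈ S, G.Adj w t → t = a ∨ t = v ∨ t = x := by
    rcases hNw v hv hvw.symm with rfl | rfl | rfl
    · exact absurd rfl hva.ne
    · exact ⟨x, hNw⟩
    · exact ⟨u, fun t ht h => by have := hNw t ht h; tauto⟩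
  clear hNw
  obtain ⟨x, hNw⟩ := hNw'
  obtain ⟨x', hx, hwx, hxa, hxv⟩ := exists_adj_of_not_degreeLETwoOn (hdeg w hw hwa.ne hwc) a v
  obtain rfl : x' = x := by have := hNw x' hx hwx; tauto
  obtain ⟨y', hy, hvy, hya, hyw⟩ := exists_adj_of_not_degreeLETwoOn (hdeg v hv hva.ne hvc) a w
  obtain rfl : y' = y := by have := hNv y' hy hvy; tauto
  by_cases hxy : x' = y'
  · subst hxy
    by_cases hxc : x' = c
    · subst hxc
      exact hK.not_clique ha hc hv hw hac hva.symm hwa.symm hvy.symm hwx.symm hvw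
    · have haU : a ∈ S \ {v, w, x'} := by
        simp [ha, hva.ne', hwa.ne', hxa.symm]
      obtain ⟨A, hAU, haA, hconn, hcl⟩ := G.exists_connectedOn_closed haU
      have hA : ∀ t ∈ A, t ∈ S ∧ t ≠ v ∧ t ≠ w ∧ t ≠ x' := fun t ht => by
        simpa using hAU ht
      have hAx : ∀ t ∈ A, ¬ G.Adj x' t := fun t ht hxt =>
        hK.not_triangle_connectedOn hv hw hx (fun s hs => (hA s hs).1) hconn
          (fun h => (hA _ h).2.1 rfl) (fun h => (hA _ h).2.2.1 rfl) (fun h => (hA _ h).2.2.2 rfl)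
          hvw hvy hwx ⟨a, haA, hva⟩ ⟨a, haA, hwa⟩ ⟨t, ht, hxt⟩
      have hcA : c ∈ A := hcl a haA c (by simp [hc, hvc.symm, hwc.symm, Ne.symm hxc]) hac
      have hmem : ∀ t, t ∈ S \ (A ∪ {v, w}) ↔ t ∈ S ∧ t ∉ A ∧ t ≠ v ∧ t ≠ w := by
        intro t
        simp
        tauto
      obtain ⟨z, hz, hxz, hzv, hzw⟩ := exists_adj_of_not_degreeLETwoOn (hdeg x' hx hxa hxc) v w
      refine hIH.false_of_closed hK (T := S \ (A ∪ {v, w})) (x := x') (z := z)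
        Finset.sdiff_subset ⟨v, hv, by simp⟩
        ((hmem x').2 ⟨hx, fun h => (hA _ h).2.2.2 rfl, hxv, hyw⟩)
        ((hmem z).2 ⟨hz, fun h => hAx z h hxz, hzv, hzw⟩) hxz ?_ ?_
      · intro s hs hsx t ht hst
        rw [hmem] at hs ⊢
        have hsU : s ∈ S \ {v, w, x'} := by simp [hs.1, hs.2.2.1, hs.2.2.2, hsx]
        have hsa : s ≠ a := by rintro rfl; exact hs.2.1 haA
        refine ⟨ht, fun h => hs.2.1 (hcl t h s hsU hst.symm), ?_, ?_⟩
        · rintro rfl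
          have := hNv s hs.1 hst.symm
          tauto
        · rintro rfl
          have := hNw s hs.1 hst.symm
          tauto
      · intro s hs hsx
        rw [hmem] at hs
        exact hdeg s hs.1 (by rintro rfl; exact hs.2.1 haA) (by rintro rfl; exact hs.2.1 hcA)
  · obtain ⟨s, hs, hsa, hsc, hs2⟩ := hIH (G.contractOnto w v) (S.erase v)
      (Finset.card_erase_lt_of_mem hv)
      (by simpa using hK.contractOnto (S := (S : Set V)) hv hvw.symm)
      a (Finset.mem_erase.2 ⟨hva.ne', ha⟩) c (Finset.mem_erase.2 ⟨hvc.symm, hc⟩)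
      (le_contractOnto w v hac) (by rw [Finset.card_erase_of_mem hv]; omega)
    rw [Finset.mem_erase] at hs
    exact not_degreeLETwoOn_contractOnto hv hw hvw ha hx hy hva hwa hwx hvy hxa hya hxv hyw hxy
      hNw hNv hs.2 hs.1 hsa (hdeg s hs.2 hsa hsc) hs2

end MinimalCounterexample

/-- A `K₄`-minor-free graph with at least three vertices has, outside any given edge, a vertex of
degree at most two. -/
theorem K4MinorFreeOn.exists_degreeLETwoOn [DecidableEq V] {S : Finset V}
    (hK : G.K4MinorFreeOn (S : Set V)) {a c : V} (ha : a ∈ S) (hc : c ∈ S) (hac : G.Adj a c)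
    (hcard : 3 ≤ S.card) : ∃ v ∈ S, v ≠ a ∧ v ≠ c ∧ G.DegreeLETwoOn S v := by
  induction hn : S.card using Nat.strong_induction_on generalizing G S a c with
  | _ n ih =>
    have hIH : SmallerHaveDegreeLETwo S := fun H T hT hHT a ha c hc hac h3 =>
      ih _ (hn ▸ hT) hHT ha hc hac h3 rfl
    by_contra! hdeg
    by_cases hau : ∃ u ∈ S, u ≠ c ∧ G.Adj a u
    · obtain ⟨u, hu, huc, hau⟩ := hau
      exact hIH.false_of_adj hK ha hc hac hdeg hu huc hau
    by_cases hcu : ∃ u ∈ S, u ≠ a ∧ G.Adj c u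
    · obtain ⟨u, hu, hua, hcu⟩ := hcu
      exact hIH.false_of_adj hK hc ha hac.symm (fun v hv h₁ h₂ => hdeg v hv h₂ h₁) hu hua hcu
    push Not at hau hcu
    obtain ⟨v, hv, hvac⟩ : ∃ v ∈ S, v ∉ ({a, c} : Finset V) := by
      apply Finset.exists_mem_notMem_of_card_lt_card
      have := Finset.card_le_two (a := a) (b := c)
      omega
    simp only [Finset.mem_insert, Finset.mem_singleton, not_or] at hvac
    obtain ⟨z, hz, hvz, hza, hzc⟩ :=
      exists_adj_of_not_degreeLETwoOn (hdeg v hv hvac.1 hvac.2) a c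
    have hmem : ∀ t, t ∈ S \ {a, c} ↔ t ∈ S ∧ t ≠ a ∧ t ≠ c := by simp
    refine hIH.false_of_closed hK (T := S \ {a, c}) (x := v) (z := z) Finset.sdiff_subset
      ⟨a, ha, by simp⟩ ((hmem v).2 ⟨hv, hvac⟩) ((hmem z).2 ⟨hz, hza, hzc⟩) hvz ?_ ?_
    · intro s hs _ t ht hst
      rw [hmem] at hs ⊢
      refine ⟨ht, ?_, ?_⟩
      · rintro rfl
        exact hau s hs.1 hs.2.2 hst.symm
      · rintro rfl
        exact hcu s hs.1 hs.2.1 hst.symm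
    · intro s hs _
      rw [hmem] at hs
      exact hdeg s hs.1 hs.2.1 hs.2.2

/-- `TwoTreeOn G x y D`: the graph `G` restricted to `{x, y} ∪ D` is a subgraph of a 2-tree grown
from the edge `xy`. In `node`, the vertex `z` is stacked onto `xy`, the sets `A`, `B` are grown
from the new edges `xz`, `zy`, and `C` is the rest of what is grown from `xy`. -/
inductive TwoTreeOn [DecidableEq V] (G : SimpleGraph V) : V → V → Finset V → Prop
  | empty (x y : V) : TwoTreeOn G x y ∅
  | node {x y z : V} {A B C : Finset V} (hA : TwoTreeOn G x z A) (hB : TwoTreeOn G z y B)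
      (hC : TwoTreeOn G x y C) (hzx : z ≠ x) (hzy : z ≠ y) (hzC : z ∉ C) (hyA : y ∉ A)
      (hxB : x ∉ B) (hAB : Disjoint A B) (hAC : Disjoint A C) (hBC : Disjoint B C)
      (nzC : ∀ c ∈ C, ¬ G.Adj z c) (nyA : ∀ a ∈ A, ¬ G.Adj y a) (nxB : ∀ b ∈ B, ¬ G.Adj x b)
      (nAB : ∀ a ∈ A, ∀ b ∈ B, ¬ G.Adj a b) (nAC : ∀ a ∈ A, ∀ c ∈ C, ¬ G.Adj a c)
      (nBC : ∀ b ∈ B, ∀ c ∈ C, ¬ G.Adj b c) : TwoTreeOn G x y (insert z (A ∪ B ∪ C))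

section TwoTree

variable [DecidableEq V]

theorem TwoTreeOn.notMem {x y : V} {D : Finset V} (h : G.TwoTreeOn x y D) : x ∉ D ∧ y ∉ D := by
  induction h with
  | empty x y => simp
  | node => grind

theorem TwoTreeOn.anti {x y v : V} {D : Finset V} (h : G'.TwoTreeOn x y D)
    (hle : ∀ s t, s ≠ v → t ≠ v → G.Adj s t → G'.Adj s t)
    (hv : v ∉ insert x (insert y D)) : G.TwoTreeOn x y D := by
  induction h with
  | empty x y => exact .empty x y
  | node hA hB hC hzx hzy hzC hyA hxB hAB hAC hBC nzC nyA nxB nAB nAC nBC ihA ihB ihC =>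
    simp only [Finset.mem_insert, Finset.mem_union, not_or] at hv ihA ihB ihC
    have ne : ∀ {s : V} {T : Finset V}, s ∈ T → v ∉ T → s ≠ v := fun hs hT =>
      ne_of_mem_of_not_mem hs hT
    obtain ⟨hvx, hvy, hvz, ⟨hvA, hvB⟩, hvC⟩ := hv
    exact .node (ihA ⟨hvx, hvz, hvA⟩) (ihB ⟨hvz, hvy, hvB⟩) (ihC ⟨hvx, hvy, hvC⟩)
      hzx hzy hzC hyA hxB hAB hAC hBC
      (fun c hc h => nzC c hc (hle _ _ (Ne.symm hvz) (ne hc hvC) h))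
      (fun a ha h => nyA a ha (hle _ _ (Ne.symm hvy) (ne ha hvA) h))
      (fun b hb h => nxB b hb (hle _ _ (Ne.symm hvx) (ne hb hvB) h))
      (fun a ha b hb h => nAB a ha b hb (hle _ _ (ne ha hvA) (ne hb hvB) h))
      (fun a ha c hc h => nAC a ha c hc (hle _ _ (ne ha hvA) (ne hc hvC) h))
      (fun b hb c hc h => nBC b hb c hc (hle _ _ (ne hb hvB) (ne hc hvC) h))

theorem TwoTreeOn.stack_root {x y v : V} {D : Finset V} (h : G.TwoTreeOn x y D)
    (hvx : v ≠ x) (hvy : v ≠ y) (hvD : v ∉ D) (hN : ∀ d ∈ D, ¬ G.Adj v d) :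
    G.TwoTreeOn x y (insert v D) := by
  simpa using TwoTreeOn.node (.empty x v) (.empty v y) h hvx hvy hvD (by simp) (by simp) (by simp)
    (by simp) (by simp) hN (by simp) (by simp) (by simp) (by simp) (by simp)

/-- Adjacent or equal vertices of a stacked graph, not both roots, lie in a common part. -/
theorem mem_part_of_adj {x y z p q : V} {A B C : Finset V}
    (hp : p ∈ insert x (insert y (insert z (A ∪ B ∪ C))))
    (hq : q ∈ insert x (insert y (insert z (A ∪ B ∪ C)))) (hpq : p = q ∨ G.Adj p q)
    (hroot : ¬ (p ∈ ({x, y} : Finset V) ∧ q ∈ ({x, y} : Finset V)))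
    (nzC : ∀ c ∈ C, ¬ G.Adj z c) (nyA : ∀ a ∈ A, ¬ G.Adj y a) (nxB : ∀ b ∈ B, ¬ G.Adj x b)
    (nAB : ∀ a ∈ A, ∀ b ∈ B, ¬ G.Adj a b) (nAC : ∀ a ∈ A, ∀ c ∈ C, ¬ G.Adj a c)
    (nBC : ∀ b ∈ B, ∀ c ∈ C, ¬ G.Adj b c) :
    (p ∈ insert x (insert z A) ∧ q ∈ insert x (insert z A)) ∨
      (p ∈ insert z (insert y B) ∧ q ∈ insert z (insert y B)) ∨
      (p ∈ insert x (insert y C) ∧ q ∈ insert x (insert y C)) := by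
  simp only [Finset.mem_insert, Finset.mem_union, Finset.mem_singleton] at hp hq hroot ⊢
  rcases hpq with rfl | hpq
  · tauto
  have hqp := hpq.symm
  rcases hp with rfl | rfl | rfl | (hp | hp) | hp <;>
    rcases hq with rfl | rfl | rfl | (hq | hq) | hq
  all_goals first
    | simp; done
    | simp [hp]; done
    | simp [hq]; done
    | simp [hp, hq]; done
    | simp at hroot; done
    | exact (nxB _ hq hpq).elim
    | exact (nxB _ hp hqp).elim
    | exact (nyA _ hq hpq).elim
    | exact (nyA _ hp hqp).elim
    | exact (nzC _ hq hpq).elim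
    | exact (nzC _ hp hqp).elim
    | exact (nAB _ hp _ hq hpq).elim
    | exact (nAB _ hq _ hp hqp).elim
    | exact (nAC _ hp _ hq hpq).elim
    | exact (nAC _ hq _ hp hqp).elim
    | exact (nBC _ hp _ hq hpq).elim
    | exact (nBC _ hq _ hp hqp).elim

/-- A vertex `v` whose neighbours lie in a clique `{p, q}` can be stacked onto a 2-tree. -/
theorem TwoTreeOn.stack {x y v p q : V} {D : Finset V} (h : G'.TwoTreeOn x y D) (hxy : x ≠ y)
    (hle : ∀ s t, s ≠ v → t ≠ v → G.Adj s t → G'.Adj s t)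
    (hvx : v ≠ x) (hvy : v ≠ y) (hvD : v ∉ D) (hp : p ∈ insert x (insert y D))
    (hq : q ∈ insert x (insert y D)) (hpq : p = q ∨ G'.Adj p q)
    (hN : ∀ w ∈ insert x (insert y D), G.Adj v w → w = p ∨ w = q) :
    G.TwoTreeOn x y (insert v D) := by
  induction h with
  | empty x y => exact (TwoTreeOn.empty x y).stack_root hvx hvy hvD (by simp)
  | @node x y z A B C hA hB hC hzx hzy hzC hyA hxB hAB hAC hBC nzC nyA nxB nAB nAC nBC
      ihA ihB ihC =>
    have hA' := hA.notMem
    have hB' := hB.notMem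
    have hC' := hC.notMem
    have hDG := (TwoTreeOn.node hA hB hC hzx hzy hzC hyA hxB hAB hAC hBC nzC nyA nxB nAB nAC
      nBC).anti hle (by simp only [Finset.mem_insert, hvx, hvy, false_or] at hvD ⊢; exact hvD)
    have hnot := hDG.notMem
    by_cases hroot : p ∈ ({x, y} : Finset V) ∧ q ∈ ({x, y} : Finset V)
    · refine hDG.stack_root hvx hvy hvD fun d hd hvd => ?_
      have hdxy : d ∈ ({x, y} : Finset V) := by
        rcases hN d (Finset.mem_insert_of_mem (Finset.mem_insert_of_mem hd)) hvd with rfl | rfl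
        exacts [hroot.1, hroot.2]
      rcases Finset.mem_insert.1 hdxy with rfl | hdy
      · exact hnot.1 hd
      · exact hnot.2 (Finset.mem_singleton.1 hdy ▸ hd)
    have ne : ∀ {s : V} {T : Finset V}, s ∈ T → v ∉ T → s ≠ v := fun hs hT =>
      ne_of_mem_of_not_mem hs hT
    simp only [Finset.mem_insert, Finset.mem_union, not_or] at hvD
    obtain ⟨hvz, ⟨hvA, hvB⟩, hvC⟩ := hvD
    have hGA : G.TwoTreeOn x z A := hA.anti hle (by simp [hvx, hvz, hvA])
    have hGB : G.TwoTreeOn z y B := hB.anti hle (by simp [hvz, hvy, hvB])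
    have hGC : G.TwoTreeOn x y C := hC.anti hle (by simp [hvx, hvy, hvC])
    have mzC := fun c hc h => nzC c hc (hle _ _ (Ne.symm hvz) (ne hc hvC) h)
    have myA := fun a ha h => nyA a ha (hle _ _ (Ne.symm hvy) (ne ha hvA) h)
    have mxB := fun b hb h => nxB b hb (hle _ _ (Ne.symm hvx) (ne hb hvB) h)
    have mAB := fun a ha b hb h => nAB a ha b hb (hle _ _ (ne ha hvA) (ne hb hvB) h)
    have mAC := fun a ha c hc h => nAC a ha c hc (hle _ _ (ne ha hvA) (ne hc hvC) h)
    have mBC := fun b hb c hc h => nBC b hb c hc (hle _ _ (ne hb hvB) (ne hc hvC) h)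
    have far : ∀ {T : Finset V}, p ∈ T → q ∈ T → ∀ w ∈ insert x (insert y (insert z (A ∪ B ∪ C))),
        w ∉ T → ¬ G.Adj v w := by
      intro T hp hq w hw hwT h
      rcases hN w hw h with rfl | rfl
      exacts [hwT hp, hwT hq]
    have hcases : (p ∈ insert x (insert z A) ∧ q ∈ insert x (insert z A)) ∨
        (p ∈ insert z (insert y B) ∧ q ∈ insert z (insert y B)) ∨
        (p ∈ insert x (insert y C) ∧ q ∈ insert x (insert y C)) := by
      exact mem_part_of_adj hp hq hpq hroot nzC nyA nxB nAB nAC nBC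
    rcases hcases with ⟨hp', hq'⟩ | ⟨hp', hq'⟩ | ⟨hp', hq'⟩
    · have hfar := far hp' hq'
      rw [show insert v (insert z (A ∪ B ∪ C)) = insert z (insert v A ∪ B ∪ C) by
        rw [Finset.insert_comm]; simp only [Finset.insert_union]]
      refine .node (ihA hzx.symm hvx hvz hvA hp' hq' fun w hw => hN w (by
        simp only [Finset.mem_insert, Finset.mem_union] at hw ⊢; clear * - hw; tauto)) hGB hGC hzx
        hzy hzC (by simp [hyA, hvy.symm]) hxB (Finset.disjoint_insert_left.2 ⟨hvB, hAB⟩)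
        (Finset.disjoint_insert_left.2 ⟨hvC, hAC⟩) hBC mzC
        (Finset.forall_mem_insert _ _ _ |>.2 ⟨fun h => hfar y (by simp) ?_ h.symm, myA⟩) mxB
        (Finset.forall_mem_insert _ _ _ |>.2 ⟨fun b hb => hfar b (by simp [hb]) ?_, mAB⟩)
        (Finset.forall_mem_insert _ _ _ |>.2 ⟨fun c hc => hfar c (by simp [hc]) ?_, mAC⟩) mBC
      · simp [hxy.symm, hzy.symm, hyA]
      · simp [ne_of_mem_of_not_mem hb hxB, ne_of_mem_of_not_mem hb hB'.1,
          Finset.disjoint_right.1 hAB hb]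
      · simp [ne_of_mem_of_not_mem hc hC'.1, ne_of_mem_of_not_mem hc hzC,
          Finset.disjoint_right.1 hAC hc]
    · have hfar := far hp' hq'
      rw [show insert v (insert z (A ∪ B ∪ C)) = insert z (A ∪ insert v B ∪ C) by
        rw [Finset.insert_comm]; simp only [Finset.insert_union, Finset.union_insert]]
      refine .node hGA (ihB hzy hvz hvy hvB hp' hq' fun w hw => hN w (by
        simp only [Finset.mem_insert, Finset.mem_union] at hw ⊢; clear * - hw; tauto)) hGC hzx hzy
        hzC hyA (by simp [hxB, hvx.symm]) (Finset.disjoint_insert_right.2 ⟨hvA, hAB⟩)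
        hAC (Finset.disjoint_insert_left.2 ⟨hvC, hBC⟩) mzC myA
        (Finset.forall_mem_insert _ _ _ |>.2 ⟨fun h => hfar x (by simp) ?_ h.symm, mxB⟩)
        (fun a ha => Finset.forall_mem_insert _ _ _ |>.2
          ⟨fun h => hfar a (by simp [ha]) ?_ h.symm, mAB a ha⟩) mAC
        (Finset.forall_mem_insert _ _ _ |>.2 ⟨fun c hc => hfar c (by simp [hc]) ?_, mBC⟩)
      · simp [hxy, hzx.symm, hxB]
      · simp [ne_of_mem_of_not_mem ha hA'.2, ne_of_mem_of_not_mem ha hyA,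
          Finset.disjoint_left.1 hAB ha]
      · simp [ne_of_mem_of_not_mem hc hC'.2, ne_of_mem_of_not_mem hc hzC,
          Finset.disjoint_right.1 hBC hc]
    · have hfar := far hp' hq'
      rw [show insert v (insert z (A ∪ B ∪ C)) = insert z (A ∪ B ∪ insert v C) by
        rw [Finset.insert_comm]; simp only [Finset.union_insert]]
      refine .node hGA hGB (ihC hxy hvx hvy hvC hp' hq' fun w hw => hN w (by
        simp only [Finset.mem_insert, Finset.mem_union] at hw ⊢; clear * - hw; tauto)) hzx hzy
        (by simp [hzC, Ne.symm hvz]) hyA hxB hAB (Finset.disjoint_insert_right.2 ⟨hvA, hAC⟩)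
        (Finset.disjoint_insert_right.2 ⟨hvB, hBC⟩)
        (Finset.forall_mem_insert _ _ _ |>.2 ⟨fun h => hfar z (by simp) ?_ h.symm, mzC⟩) myA mxB
        mAB
        (fun a ha => Finset.forall_mem_insert _ _ _ |>.2
          ⟨fun h => hfar a (by simp [ha]) ?_ h.symm, mAC a ha⟩)
        (fun b hb => Finset.forall_mem_insert _ _ _ |>.2
          ⟨fun h => hfar b (by simp [hb]) ?_ h.symm, mBC b hb⟩)
      · simp [hzx, hzy, hzC]
      · simp [ne_of_mem_of_not_mem ha hA'.1, ne_of_mem_of_not_mem ha hyA,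
          Finset.disjoint_left.1 hAC ha]
      · simp [ne_of_mem_of_not_mem hb hB'.2, ne_of_mem_of_not_mem hb hxB,
          Finset.disjoint_left.1 hBC hb]

/-- Every `K₄`-minor-free graph is a subgraph of a 2-tree. -/
theorem K4MinorFreeOn.exists_twoTreeOn {S : Finset V} (hK : G.K4MinorFreeOn (S : Set V))
    (hcard : 2 ≤ S.card) :
    ∃ x y D, x ≠ y ∧ S = insert x (insert y D) ∧ G.TwoTreeOn x y D := by
  induction hn : S.card using Nat.strong_induction_on generalizing G S with
  | _ n ih =>
    rcases hcard.eq_or_lt with h2 | h3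
    · obtain ⟨x, y, hxy, rfl⟩ := Finset.card_eq_two.1 h2.symm
      exact ⟨x, y, ∅, hxy, rfl, .empty x y⟩
    obtain ⟨v, hv, p, q, hpq⟩ : ∃ v ∈ S, G.DegreeLETwoOn S v := by
      by_cases hedge : ∃ a ∈ S, ∃ c ∈ S, G.Adj a c
      · obtain ⟨a, ha, c, hc, hac⟩ := hedge
        obtain ⟨v, hv, -, -, h⟩ := hK.exists_degreeLETwoOn ha hc hac h3
        exact ⟨v, hv, h⟩
      · push Not at hedge
        obtain ⟨v, hv⟩ := Finset.card_pos.1 (by omega : 0 < S.card)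
        exact ⟨v, hv, v, v, fun w hw h => absurd h (hedge v hv w hw)⟩
    obtain ⟨H, p, q, hle, hH, hp, hq, hpq, hN⟩ : ∃ (H : SimpleGraph V) (p q : V), G ≤ H ∧
        H.K4MinorFreeOn (S.erase v : Set V) ∧ p ∈ S.erase v ∧ q ∈ S.erase v ∧
        (p = q ∨ H.Adj p q) ∧ ∀ w ∈ S.erase v, G.Adj v w → w = p ∨ w = q := by
      have hfree : G.K4MinorFreeOn (S.erase v : Set V) :=
        hK.mono (by exact_mod_cast Finset.erase_subset v S)
      by_cases hp : p ∈ S ∧ G.Adj v p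
      · have hp' : p ∈ S.erase v := Finset.mem_erase.2 ⟨hp.2.ne', hp.1⟩
        by_cases hq : q ∈ S ∧ G.Adj v q
        · have hq' : q ∈ S.erase v := Finset.mem_erase.2 ⟨hq.2.ne', hq.1⟩
          refine ⟨G.contractOnto p v, p, q, le_contractOnto p v,
            by simpa using hK.contractOnto (S := (S : Set V)) hv hp.2.symm, hp', hq', ?_,
            fun w hw => hpq w (Finset.mem_of_mem_erase hw)⟩
          by_cases h : p = q
          · exact Or.inl h
          · exact Or.inr ⟨h, Or.inr (Or.inl ⟨rfl, hq.2⟩)⟩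
        · exact ⟨G, p, p, le_rfl, hfree, hp', hp', Or.inl rfl, by grind⟩
      · by_cases hq : q ∈ S ∧ G.Adj v q
        · have hq' : q ∈ S.erase v := Finset.mem_erase.2 ⟨hq.2.ne', hq.1⟩
          exact ⟨G, q, q, le_rfl, hfree, hq', hq', Or.inl rfl, by grind⟩
        · obtain ⟨r, hr⟩ := Finset.card_pos.1 (by
            rw [Finset.card_erase_of_mem hv]; omega : 0 < (S.erase v).card)
          exact ⟨G, r, r, le_rfl, hfree, hr, hr, Or.inl rfl, by grind⟩
    have hcardv := Finset.card_erase_of_mem hv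
    obtain ⟨x, y, D, hxy, hS, hD⟩ := ih _ (by omega) hH (by omega) rfl
    have hvS : v ∉ S.erase v := Finset.notMem_erase v S
    rw [hS] at hp hq hN hvS
    refine ⟨x, y, insert v D, hxy, ?_, hD.stack hxy (fun s t _ _ h => hle h) (by grind) (by grind)
      (by grind) hp hq hpq hN⟩
    rw [← Finset.insert_erase hv, hS]
    grind

end TwoTree

/-- `f` lists the vertices of `F` in an order in which no two edges of `G` cross when the vertices
are placed on a convex curve. -/
def IsNoncrossing (G : SimpleGraph V) (F : Finset V) (f : V → ℕ) : Prop :=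
  Set.InjOn f F ∧ ∀ p ∈ F, ∀ q ∈ F, ∀ r ∈ F, ∀ s ∈ F, f p < f r → f r < f q → f q < f s →
    G.Adj p q → ¬ G.Adj r s

/-- The graph `G` restricted to `F` has a noncrossing convex vertex order. -/
def NoncrossingOn (G : SimpleGraph V) (F : Finset V) : Prop := ∃ f, G.IsNoncrossing F f

theorem NoncrossingOn.mono {F F' : Finset V} (h : G.NoncrossingOn F) (hF : F' ⊆ F) :
    G.NoncrossingOn F' :=
  h.imp fun _ hf => ⟨hf.1.mono (by exact_mod_cast hF), fun p hp q hq r hr s hs =>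
    hf.2 p (hF hp) q (hF hq) r (hF hr) s (hF hs)⟩

section Noncrossing

variable [DecidableEq V]

/-- A noncrossing order can be rotated so that any given vertex comes first. -/
theorem NoncrossingOn.exists_first {F : Finset V} (h : G.NoncrossingOn F) (v : V) :
    ∃ f, G.IsNoncrossing F f ∧ f v = 0 ∧ ∀ x ∈ F, x ≠ v → 0 < f x := by
  obtain ⟨f, hinj, hf⟩ := h
  by_cases hv : v ∈ F
  · obtain ⟨N, hN⟩ : ∃ N, ∀ x ∈ F, f x < N :=
      ⟨F.sup f + 1, fun x hx => Nat.lt_succ_of_le (Finset.le_sup hx)⟩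
    have hvN := hN v hv
    refine ⟨fun x => if f x < f v then f x + N - f v else f x - f v, ⟨?_, ?_⟩, by simp, ?_⟩
    · intro x hx y hy hxy
      have hxN := hN x hx
      have hyN := hN y hy
      refine hinj hx hy ?_
      dsimp only at hxy
      split_ifs at hxy <;> omega
    · intro p hp q hq r hr s hs hpr hrq hqs hpq hrs
      have hpN := hN p hp
      have hqN := hN q hq
      have hrN := hN r hr
      have hsN := hN s hs
      have rot : (f p < f r ∧ f r < f q ∧ f q < f s) ∨ (f s < f p ∧ f p < f r ∧ f r < f q) ∨
          (f q < f s ∧ f s < f p ∧ f p < f r) ∨ (f r < f q ∧ f q < f s ∧ f s < f p) := by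
        dsimp only at hpr hrq hqs
        split_ifs at hpr hrq hqs <;> omega
      rcases rot with ⟨h₁, h₂, h₃⟩ | ⟨h₁, h₂, h₃⟩ | ⟨h₁, h₂, h₃⟩ | ⟨h₁, h₂, h₃⟩
      · exact hf p hp q hq r hr s hs h₁ h₂ h₃ hpq hrs
      · exact hf s hs r hr p hp q hq h₁ h₂ h₃ hrs.symm hpq
      · exact hf q hq p hp s hs r hr h₁ h₂ h₃ hpq.symm hrs.symm
      · exact hf r hr s hs q hq p hp h₁ h₂ h₃ hrs hpq.symm
    · intro x hx hxv
      have hne : f x ≠ f v := fun h => hxv (hinj hx hv h)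
      dsimp only
      split_ifs <;> omega
  · have hne : ∀ x ∈ F, x ≠ v := fun x hx => ne_of_mem_of_not_mem hx hv
    refine ⟨fun x => if x = v then 0 else f x + 1, ⟨?_, ?_⟩, by simp, fun x hx hxv => by simp [hxv]⟩
    · intro x hx y hy hxy
      exact hinj hx hy (by simpa [hne x hx, hne y hy] using hxy)
    · intro p hp q hq r hr s hs hpr hrq hqs
      simp only [hne p hp, hne q hq, hne r hr, hne s hs, if_false, Nat.add_lt_add_iff_right]
        at hpr hrq hqs
      exact hf p hp q hq r hr s hs hpr hrq hqs

/-- Noncrossing orders can be glued along a cut vertex. -/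
theorem NoncrossingOn.union {F₁ F₂ : Finset V} (h₁ : G.NoncrossingOn F₁) (h₂ : G.NoncrossingOn F₂)
    (v : V) (hinter : ∀ x ∈ F₁, x ∈ F₂ → x = v)
    (hadj : ∀ x ∈ F₁, ∀ y ∈ F₂, G.Adj x y → x ∈ F₂ ∨ y ∈ F₁) : G.NoncrossingOn (F₁ ∪ F₂) := by
  obtain ⟨f₂, ⟨inj₂, nc₂⟩, zero₂, pos₂⟩ := h₂.exists_first v
  obtain ⟨f₁, ⟨inj₁, nc₁⟩, zero₁, -⟩ := h₁.exists_first v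
  obtain ⟨N, hN⟩ : ∃ N, ∀ x ∈ F₁, f₁ x < N :=
    ⟨F₁.sup f₁ + 1, fun x hx => Nat.lt_succ_of_le (Finset.le_sup hx)⟩
  obtain ⟨f, hf⟩ : ∃ f : V → ℕ, ∀ x, f x = if x ∈ F₁ then f₁ x else N + f₂ x := ⟨_, fun _ => rfl⟩
  have in₁ : ∀ x ∈ F₁, f x = f₁ x := fun x hx => by simp [hf, hx]
  have out₁ : ∀ x, x ∉ F₁ → f x = N + f₂ x := fun x hx => by simp [hf, hx]
  have mem₁ : ∀ x, f x < N → x ∈ F₁ := fun x hx => by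
    by_contra hx'
    rw [out₁ x hx'] at hx
    omega
  have lt₂ : ∀ x ∈ F₂, ∀ y ∈ F₂, f x < f y → f₂ x < f₂ y := by
    intro x hx y hy hxy
    by_cases hx₁ : x ∈ F₁
    · obtain rfl := hinter x hx₁ hx
      rw [zero₂]
      exact pos₂ y hy (by rintro rfl; exact hxy.false)
    · rw [out₁ x hx₁] at hxy
      by_cases hy₁ : y ∈ F₁
      · rw [in₁ y hy₁] at hxy
        have := hN y hy₁
        omega
      · rw [out₁ y hy₁] at hxy
        omega
  have edge : ∀ x ∈ F₁ ∪ F₂, ∀ y ∈ F₁ ∪ F₂, G.Adj x y →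
      (x ∈ F₁ ∧ y ∈ F₁) ∨ (x ∈ F₂ ∧ y ∈ F₂) := by
    intro x hx y hy hxy
    have h₁ := hadj x
    have h₂ := hadj y
    rw [Finset.mem_union] at hx hy
    have := hxy.symm
    grind
  refine ⟨f, ?_, ?_⟩
  · intro x hx y hy hxy
    by_cases hx₁ : x ∈ F₁ <;> by_cases hy₁ : y ∈ F₁
    · exact inj₁ hx₁ hy₁ (by rwa [in₁ x hx₁, in₁ y hy₁] at hxy)
    · rw [in₁ x hx₁, out₁ y hy₁] at hxy
      have := hN x hx₁
      omega
    · rw [out₁ x hx₁, in₁ y hy₁] at hxy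
      have := hN y hy₁
      omega
    · rw [out₁ x hx₁, out₁ y hy₁] at hxy
      exact inj₂ ((Finset.mem_union.1 hx).resolve_left hx₁)
        ((Finset.mem_union.1 hy).resolve_left hy₁) (by omega)
  · intro p hp q hq r hr s hs hpr hrq hqs hpq hrs
    rcases edge p hp q hq hpq with ⟨hp', hq'⟩ | ⟨hp', hq'⟩ <;>
      rcases edge r hr s hs hrs with ⟨hr', hs'⟩ | ⟨hr', hs'⟩
    · rw [in₁ p hp', in₁ r hr'] at hpr
      rw [in₁ r hr', in₁ q hq'] at hrq
      rw [in₁ q hq', in₁ s hs'] at hqs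
      exact nc₁ p hp' q hq' r hr' s hs' hpr hrq hqs hpq hrs
    · have hqN := hN q hq'
      rw [in₁ q hq'] at hrq
      have hr₁ := mem₁ r (by omega)
      obtain rfl := hinter r hr₁ hr'
      rw [in₁ r hr₁, zero₁] at hpr
      omega
    · have hsN := hN s hs'
      rw [in₁ s hs'] at hqs
      obtain rfl := hinter p (mem₁ p (by omega)) hp'
      obtain rfl := hinter q (mem₁ q (by omega)) hq'
      omega
    · exact nc₂ p hp' q hq' r hr' s hs' (lt₂ p hp' r hr' hpr) (lt₂ r hr' q hq' hrq)
        (lt₂ q hq' s hs' hqs) hpq hrs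

theorem NoncrossingOn.union_of_insert {Y P : Finset V} {u : V} (hY : G.NoncrossingOn Y)
    (hP : G.NoncrossingOn (insert u P)) (hdisj : Disjoint Y P)
    (hadj : ∀ w ∈ Y, ∀ p ∈ P, G.Adj w p → w = u) : G.NoncrossingOn (Y ∪ P) := by
  have hdisj := Finset.disjoint_left.1 hdisj
  by_cases hu : u ∈ Y
  · refine (hY.union hP u ?_ ?_).mono (Finset.union_subset_union_right (Finset.subset_insert u P))
    · intro x hx hx'
      exact (Finset.mem_insert.1 hx').resolve_right (hdisj hx)
    · intro x hx y hy hxy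
      rcases Finset.mem_insert.1 hy with rfl | hy
      · exact Or.inr hu
      · exact Or.inl (Finset.mem_insert.2 (Or.inl (hadj x hx y hy hxy)))
  · refine hY.union (hP.mono (Finset.subset_insert u P)) u
      (fun x hx hx' => absurd hx' (hdisj hx)) fun x hx y hy hxy => ?_
    exact absurd (hadj x hx y hy hxy ▸ hx) hu

theorem K4MinorFreeOn.noncrossingOn_of_card_le {S : Set V} (hK : G.K4MinorFreeOn S) {F : Finset V}
    (hF : (F : Set V) ⊆ S) (hcard : F.card ≤ 4) : G.NoncrossingOn F := by
  by_cases h4 : F.card = 4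
  · obtain ⟨p, hp, q, hq, hpq, hnadj⟩ : ∃ p ∈ F, ∃ q ∈ F, p ≠ q ∧ ¬ G.Adj p q := by
      by_contra! hall
      obtain ⟨a, T, haT, rfl, hT⟩ := Finset.card_eq_succ.1 h4
      obtain ⟨b, c, d, hbc, hbd, hcd, rfl⟩ := Finset.card_eq_three.1 hT
      simp only [Finset.mem_insert, Finset.mem_singleton, not_or] at haT
      obtain ⟨hab, hac, had⟩ := haT
      exact hK.not_clique (p := a) (q := b) (r := c) (s := d) (hF (by simp)) (hF (by simp))
        (hF (by simp)) (hF (by simp)) (hall a (by simp) b (by simp) hab)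
        (hall a (by simp) c (by simp) hac) (hall a (by simp) d (by simp) had)
        (hall b (by simp) c (by simp) hbc) (hall b (by simp) d (by simp) hbd)
        (hall c (by simp) d (by simp) hcd)
    have hcard2 : ((F.erase p).erase q).card = 2 := by
      rw [Finset.card_erase_of_mem (Finset.mem_erase.2 ⟨hpq.symm, hq⟩),
        Finset.card_erase_of_mem hp, h4]
    obtain ⟨r, s, hrs, hRS⟩ := Finset.card_eq_two.1 hcard2
    have hmem : ∀ x ∈ F, x = p ∨ x = q ∨ x = r ∨ x = s := by
      intro x hx
      have := Finset.ext_iff.1 hRS x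
      simp only [Finset.mem_erase, Finset.mem_insert, Finset.mem_singleton] at this
      tauto
    have hr := Finset.ext_iff.1 hRS r
    have hs := Finset.ext_iff.1 hRS s
    simp only [Finset.mem_erase, Finset.mem_insert, Finset.mem_singleton, true_or, or_true,
      iff_true] at hr hs
    obtain ⟨f, hf⟩ : ∃ f : V → ℕ, ∀ x,
        f x = if x = p then 0 else if x = r then 1 else if x = q then 2 else 3 := ⟨_, fun _ => rfl⟩
    have h0 : ∀ x, f x = 0 → x = p := by grind
    have h2 : ∀ x, f x = 2 → x = q := by grind
    have h3 : ∀ x, f x ≤ 3 := by grind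
    refine ⟨f, ?_, ?_⟩
    · intro x hx y hy hxy
      have := hmem x hx
      have := hmem y hy
      grind
    · intro a ha b hb c hc d hd hac hcb hbd hab
      have := h3 d
      rw [h0 a (by omega), h2 b (by omega)] at hab
      exact absurd hab hnadj
  · obtain ⟨f, hf⟩ := Set.countable_iff_exists_injOn.1 F.countable_toSet
    refine ⟨f, hf, fun p hp q hq r hr s hs hpr hrq hqs => ?_⟩
    have : ({p, r, q, s} : Finset V).card ≤ F.card := Finset.card_le_card (by
      simp only [Finset.insert_subset_iff, Finset.singleton_subset_iff]
      exact ⟨hp, hr, hq, hs⟩)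
    have hne : ∀ {a b : V}, f a < f b → a ≠ b := fun h h' => h.ne (congrArg f h')
    rw [Finset.card_insert_of_notMem (by
        simp [hne hpr, hne (hpr.trans hrq), hne (hpr.trans (hrq.trans hqs))]),
      Finset.card_insert_of_notMem (by simp [hne hrq, hne (hrq.trans hqs)]),
      Finset.card_insert_of_notMem (by simp [hne hqs]), Finset.card_singleton] at this
    omega

/-- `S` contains a nonempty part `W` such that deleting at most a fifth of `W` makes the rest of
`W` extend every noncrossing part of `S \ W`. -/
def Reducible (G : SimpleGraph V) (S : Finset V) : Prop :=
  ∃ W ⊆ S, ∃ X ⊆ W, W.Nonempty ∧ 5 * X.card ≤ W.card ∧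
    ∀ Y ⊆ S \ W, G.NoncrossingOn Y → G.NoncrossingOn (Y ∪ (W \ X))

theorem NoncrossingOn.insert_insert_union {y z : V} {A B C : Finset V}
    (hyC : G.NoncrossingOn (insert y C)) (hyzB : G.NoncrossingOn (insert y (insert z B)))
    (hzA : G.NoncrossingOn (insert z A)) (hzy : z ≠ y) (hzA' : z ∉ A) (hzC : z ∉ C) (hyA : y ∉ A)
    (hyB : y ∉ B) (hAB : Disjoint A B) (hAC : Disjoint A C) (hBC : Disjoint B C)
    (nzC : ∀ c ∈ C, ¬ G.Adj z c) (nyA : ∀ a ∈ A, ¬ G.Adj y a)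
    (nAB : ∀ a ∈ A, ∀ b ∈ B, ¬ G.Adj a b) (nAC : ∀ a ∈ A, ∀ c ∈ C, ¬ G.Adj a c)
    (nBC : ∀ b ∈ B, ∀ c ∈ C, ¬ G.Adj b c) :
    G.NoncrossingOn (insert y (insert z (A ∪ B ∪ C))) := by
  have hAB := Finset.disjoint_left.1 hAB
  have hAC := Finset.disjoint_left.1 hAC
  have hBC := Finset.disjoint_left.1 hBC
  have hP : G.NoncrossingOn (insert y (insert z (A ∪ B))) := by
    have := hyzB.union_of_insert hzA
      (Finset.disjoint_right.2 fun a ha => by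
        simp [ne_of_mem_of_not_mem ha hyA, ne_of_mem_of_not_mem ha hzA', hAB ha])
      (fun w hw a ha hwa => by
        simp only [Finset.mem_insert] at hw
        rcases hw with rfl | rfl | hw
        · exact absurd hwa (nyA a ha)
        · rfl
        · exact absurd hwa.symm (nAB a ha w hw))
    exact this.mono fun w hw => by
      simp only [Finset.mem_insert, Finset.mem_union] at hw ⊢
      clear * - hw
      tauto
  have := hyC.union_of_insert hP
    (Finset.disjoint_right.2 fun w hw => by
      simp only [Finset.mem_insert, Finset.mem_union, not_or] at hw ⊢
      rcases hw with rfl | hw | hw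
      · exact ⟨hzy, hzC⟩
      · exact ⟨ne_of_mem_of_not_mem hw hyA, hAC hw⟩
      · exact ⟨ne_of_mem_of_not_mem hw hyB, hBC hw⟩)
    (fun w hw p hp hwp => by
      simp only [Finset.mem_insert, Finset.mem_union] at hw hp
      refine hw.resolve_right fun hwC => ?_
      rcases hp with rfl | hp | hp
      · exact nzC w hwC hwp.symm
      · exact nAC p hp w hwC hwp.symm
      · exact nBC p hp w hwC hwp.symm)
  exact this.mono fun w hw => by
    simp only [Finset.mem_insert, Finset.mem_union] at hw ⊢
    clear * - hw
    tauto

/-- Deleting `x` leaves `D` attached at `y` only. -/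
theorem reducible_of_noncrossingOn_insert {S D : Finset V} {x y : V}
    (hx : x ∈ S) (hD : D ⊆ S) (hxD : x ∉ D) (hcard : 4 ≤ D.card)
    (hyD : G.NoncrossingOn (insert y D))
    (hatt : ∀ d ∈ D, ∀ w ∈ S, w ∉ D → w ≠ x → w ≠ y → ¬ G.Adj d w) : G.Reducible S := by
  refine ⟨insert x D, Finset.insert_subset hx hD, {x}, by simp, by simp, ?_, fun Y hY hYnc => ?_⟩
  · rw [Finset.card_insert_of_notMem hxD, Finset.card_singleton]
    omega
  have hY : ∀ w ∈ Y, w ∈ S ∧ w ≠ x ∧ w ∉ D := fun w hw => by simpa using hY hw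
  rw [show insert x D \ {x} = D by
    rw [← Finset.erase_eq, Finset.erase_insert hxD]]
  refine hYnc.union_of_insert hyD (Finset.disjoint_left.2 fun w hw => (hY w hw).2.2) ?_
  intro w hw d hd hwd
  obtain ⟨hwS, hwx, hwD⟩ := hY w hw
  by_contra hwy
  exact hatt d hd w hwS hwD hwx hwy hwd.symm

theorem TwoTreeOn.reducible_or_card_le {x y : V} {D S : Finset V} (h : G.TwoTreeOn x y D)
    (hK : G.K4MinorFreeOn (S : Set V)) (hxy : x ≠ y) (hx : x ∈ S) (hy : y ∈ S) (hD : D ⊆ S)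
    (hatt : ∀ d ∈ D, ∀ w ∈ S, w ∉ D → w ≠ x → w ≠ y → ¬ G.Adj d w) :
    G.Reducible S ∨ D.card ≤ 3 := by
  induction h with
  | empty x y => simp
  | @node x y z A B C hA hB hC hzx hzy hzC hyA hxB hAB hAC hBC nzC nyA nxB nAB nAC nBC
      ihA ihB ihC =>
    by_cases hred : G.Reducible S
    · exact Or.inl hred
    have hz : z ∈ S := hD (by simp)
    have hAS : A ⊆ S := fun a ha => hD (by simp [ha])
    have hBS : B ⊆ S := fun b hb => hD (by simp [hb])
    have hCS : C ⊆ S := fun c hc => hD (by simp [hc])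
    have hA' := hA.notMem
    have hB' := hB.notMem
    have hC' := hC.notMem
    have attA : ∀ a ∈ A, ∀ w ∈ S, w ∉ A → w ≠ x → w ≠ z → ¬ G.Adj a w := by
      intro a ha w hw hwA hwx hwz haw
      by_cases hwy : w = y
      · exact nyA a ha (hwy ▸ haw.symm)
      by_cases hwB : w ∈ B
      · exact nAB a ha w hwB haw
      by_cases hwC : w ∈ C
      · exact nAC a ha w hwC haw
      exact hatt a (by simp [ha]) w hw (by simp [hwz, hwA, hwB, hwC]) hwx hwy haw
    have attB : ∀ b ∈ B, ∀ w ∈ S, w ∉ B → w ≠ z → w ≠ y → ¬ G.Adj b w := by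
      intro b hb w hw hwB hwz hwy hbw
      by_cases hwx : w = x
      · exact nxB b hb (hwx ▸ hbw.symm)
      by_cases hwA : w ∈ A
      · exact nAB w hwA b hb hbw.symm
      by_cases hwC : w ∈ C
      · exact nBC b hb w hwC hbw
      exact hatt b (by simp [hb]) w hw (by simp [hwz, hwA, hwB, hwC]) hwx hwy hbw
    have attC : ∀ c ∈ C, ∀ w ∈ S, w ∉ C → w ≠ x → w ≠ y → ¬ G.Adj c w := by
      intro c hc w hw hwC hwx hwy hcw
      by_cases hwz : w = z
      · exact nzC c hc (hwz ▸ hcw.symm)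
      by_cases hwA : w ∈ A
      · exact nAC w hwA c hc hcw.symm
      by_cases hwB : w ∈ B
      · exact nBC w hwB c hc hcw.symm
      exact hatt c (by simp [hc]) w hw (by simp [hwz, hwA, hwB, hwC]) hwx hwy hcw
    have cardA := (ihA hzx.symm hx hz hAS attA).resolve_left hred
    have cardB := (ihB hzy hz hy hBS attB).resolve_left hred
    have cardC := (ihC hxy hx hy hCS attC).resolve_left hred
    have small : ∀ {T : Finset V} {u : V}, u ∈ S → T ⊆ S → T.card ≤ 3 →
        G.NoncrossingOn (insert u T) := fun hu hT hc =>
      hK.noncrossingOn_of_card_le (by exact_mod_cast Finset.insert_subset hu hT)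
        ((Finset.card_insert_le _ _).trans (by omega))
    have hzAB : z ∉ A ∪ B := by simp [hA'.2, hB'.1]
    have hcardAB : (A ∪ B).card = A.card + B.card := Finset.card_union_of_disjoint hAB
    by_cases hbig : 4 ≤ A.card + B.card
    · refine Or.inl ⟨insert z (A ∪ B), Finset.insert_subset hz (Finset.union_subset hAS hBS), {z},
        by simp, by simp, ?_, fun Y hY hYnc => ?_⟩
      · rw [Finset.card_insert_of_notMem hzAB, Finset.card_singleton]
        omega
      have hY : ∀ w ∈ Y, w ∈ S ∧ w ≠ z ∧ w ∉ A ∧ w ∉ B := fun w hw => by simpa using hY hw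
      rw [show insert z (A ∪ B) \ {z} = A ∪ B by
        rw [← Finset.erase_eq, Finset.erase_insert hzAB], ← Finset.union_assoc]
      refine (hYnc.union_of_insert (small hx hAS cardA)
        (Finset.disjoint_left.2 fun w hw => (hY w hw).2.2.1)
        fun w hw a ha hwa => ?_).union_of_insert (small hy hBS cardB) (Finset.disjoint_union_left.2
          ⟨Finset.disjoint_left.2 fun w hw => (hY w hw).2.2.2, hAB⟩) fun w hw b hb hwb => ?_
      · obtain ⟨hwS, hwz, hwA, hwB⟩ := hY w hw
        by_contra hwx
        exact attA a ha w hwS hwA hwx hwz hwa.symm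
      · rcases Finset.mem_union.1 hw with hw | hw
        · obtain ⟨hwS, hwz, hwA, hwB⟩ := hY w hw
          by_contra hwy
          exact attB b hb w hwS hwB hwz hwy hwb.symm
        · exact absurd hwb (nAB w hw b hb)
    by_cases hDcard : (insert z (A ∪ B ∪ C)).card ≤ 3
    · exact Or.inr hDcard
    have hxD : x ∉ insert z (A ∪ B ∪ C) := by simp [hzx.symm, hA'.1, hxB, hC'.1]
    have hyD : y ∉ insert z (A ∪ B ∪ C) := by simp [hzy.symm, hyA, hB'.2, hC'.2]
    refine Or.inl ?_
    by_cases hB2 : B.card ≤ 2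
    · exact reducible_of_noncrossingOn_insert hx hD hxD (by omega)
        ((small hy hCS cardC).insert_insert_union (small hy (Finset.insert_subset hz hBS)
          ((Finset.card_insert_le _ _).trans (by omega))) (small hz hAS cardA) hzy hA'.2 hzC hyA
          hB'.2 hAB hAC hBC nzC nyA nAB nAC nBC) hatt
    · have hxD' := (small hx hCS cardC).insert_insert_union (small hx (Finset.insert_subset hz hAS)
          ((Finset.card_insert_le _ _).trans (by omega))) (small hz hBS cardB) hzx hB'.1 hzC hxB
          hA'.1 hAB.symm hBC hAC nzC nxB (fun b hb a ha h => nAB a ha b hb h.symm) nBC nAC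
      rw [Finset.union_comm B A] at hxD'
      exact reducible_of_noncrossingOn_insert hy hD hyD (by omega) hxD'
        fun d hd w hw hwD hwy hwx => hatt d hd w hw hwD hwx hwy

/-- In a `K₄`-minor-free graph, deleting at most a fifth of the vertices leaves a graph with a
noncrossing convex vertex order. -/
theorem K4MinorFreeOn.exists_noncrossingOn_sdiff {S : Finset V}
    (hK : G.K4MinorFreeOn (S : Set V)) :
    ∃ X ⊆ S, 5 * X.card ≤ S.card ∧ G.NoncrossingOn (S \ X) := by
  induction hn : S.card using Nat.strong_induction_on generalizing S with
  | _ n ih =>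
    subst hn
    by_cases h4 : S.card ≤ 4
    · exact ⟨∅, by simp, by simp, hK.noncrossingOn_of_card_le (by simp) (by simpa using h4)⟩
    obtain ⟨x, y, D, hxy, hS, hD⟩ := hK.exists_twoTreeOn (by omega)
    have hxyD := hD.notMem
    have hcard : S.card = D.card + 2 := by
      rw [hS, Finset.card_insert_of_notMem (by simp [hxy, hxyD.1]),
        Finset.card_insert_of_notMem hxyD.2]
    rcases hD.reducible_or_card_le hK hxy (by simp [hS]) (by simp [hS])
      (fun d hd => by simp [hS, hd]) (fun d hd w hw hwD hwx hwy => by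
        simp [hS, hwx, hwy, hwD] at hw) with ⟨W, hWS, X, hXW, hW, hXcard, hred⟩ | hD3
    · have hlt := Finset.card_sdiff_of_subset hWS
      have hWle := Finset.card_le_card hWS
      have hWpos := hW.card_pos
      obtain ⟨X', hX'S, hX'card, hX'⟩ := ih (S \ W).card (by omega)
        (hK.mono (by exact_mod_cast Finset.sdiff_subset)) rfl
      refine ⟨X' ∪ X, Finset.union_subset (hX'S.trans Finset.sdiff_subset) (hXW.trans hWS), ?_, ?_⟩
      · have := Finset.card_union_le X' X
        omega
      · refine (hred _ Finset.sdiff_subset hX').mono fun w hw => ?_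
        simp only [Finset.mem_sdiff, Finset.mem_union, not_or] at hw ⊢
        tauto
    · have hxS : x ∈ S := by simp [hS]
      refine ⟨{x}, by simpa using hxS, by simp; omega, hK.noncrossingOn_of_card_le
        (by exact_mod_cast Finset.sdiff_subset) ?_⟩
      rw [← Finset.erase_eq, Finset.card_erase_of_mem hxS]
      omega

end Noncrossing

section Parabola

/-- The point of the parabola `y = x ^ 2` with abscissa `t`. -/
def parabola (t : ℝ) : ℝ × ℝ := (t, t ^ 2)

theorem parabola_injective : Function.Injective parabola := fun _ _ h => congrArg Prod.fst h

theorem chord_eq {a b : ℝ} {p : ℝ × ℝ} (h : p ∈ segment ℝ (parabola a) (parabola b)) :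
    p.2 - p.1 ^ 2 = (p.1 - a) * (b - p.1) ∧ 0 ≤ (p.1 - a) * (b - p.1) := by
  obtain ⟨s, t, hs, ht, hst, rfl⟩ := h
  obtain rfl : s = 1 - t := by linarith
  simp only [parabola, Prod.smul_mk, smul_eq_mul, Prod.mk_add_mk]
  refine ⟨by ring, ?_⟩
  have : 0 ≤ (1 - t) * t * (b - a) ^ 2 := by positivity
  linarith

theorem eq_parabola_of_mul_eq_zero {a b : ℝ} {p : ℝ × ℝ}
    (h : p.2 - p.1 ^ 2 = (p.1 - a) * (b - p.1)) (h0 : (p.1 - a) * (b - p.1) = 0) :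
    p = parabola a ∨ p = parabola b := by
  have hp : p.2 = p.1 ^ 2 := by linarith
  rcases mul_eq_zero.1 h0 with h | h
  · exact Or.inl (Prod.ext (by simp only [parabola]; linarith)
      (by rw [hp, sub_eq_zero.1 h]; rfl))
  · exact Or.inr (Prod.ext (by simp only [parabola]; linarith)
      (by rw [hp, ← sub_eq_zero.1 h]; rfl))

/-- Two distinct chords of the parabola that do not cross meet only in common endpoints. -/
theorem chord_inter {a b c d : ℝ} (hab : a < b) (hcd : c < d) (hne : ¬ (a = c ∧ b = d))
    (h₁ : ¬ (a < c ∧ c < b ∧ b < d)) (h₂ : ¬ (c < a ∧ a < d ∧ d < b)) {p : ℝ × ℝ}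
    (hp₁ : p ∈ segment ℝ (parabola a) (parabola b))
    (hp₂ : p ∈ segment ℝ (parabola c) (parabola d)) :
    (p = parabola a ∨ p = parabola b) ∧ (p = parabola c ∨ p = parabola d) := by
  obtain ⟨e₁, n₁⟩ := chord_eq hp₁
  obtain ⟨e₂, n₂⟩ := chord_eq hp₂
  rcases n₁.eq_or_lt with h0 | hpos
  · exact ⟨eq_parabola_of_mul_eq_zero e₁ h0.symm, eq_parabola_of_mul_eq_zero e₂ (by linarith)⟩
  exfalso
  have inside : ∀ {r s x : ℝ}, r < s → 0 < (x - r) * (s - x) → 0 < x - r ∧ 0 < s - x := by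
    intro r s x hrs hx
    rcases mul_pos_iff.1 hx with h | h
    · exact h
    · linarith [h.1, h.2]
  obtain ⟨ha, hb⟩ := inside hab hpos
  obtain ⟨hc, hd⟩ := inside hcd (by linarith : 0 < (p.1 - c) * (d - p.1))
  rcases lt_trichotomy a c with hac | hac | hac <;> rcases lt_trichotomy b d with hbd | hbd | hbd
  · exact h₁ ⟨hac, by linarith, hbd⟩
  · nlinarith
  · nlinarith
  · nlinarith
  · exact hne ⟨hac, hbd⟩
  · nlinarith
  · nlinarith
  · nlinarith
  · exact h₂ ⟨hac, by linarith, hbd⟩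

theorem not_isBounded_connectedComponentIn_compl {T : Set (ℝ × ℝ)}
    (hT : T ⊆ {p | p.1 ^ 2 ≤ p.2}) {p : ℝ × ℝ} (hp : p.2 < p.1 ^ 2) :
    ¬ Bornology.IsBounded (connectedComponentIn Tᶜ p) := by
  have hray : ({p.1} ×ˢ Set.Iic p.2 : Set (ℝ × ℝ)) ⊆ connectedComponentIn Tᶜ p := by
    refine (isPreconnected_singleton.prod isPreconnected_Iic).subset_connectedComponentIn
      ⟨rfl, Set.mem_Iic.2 le_rfl⟩ ?_
    rintro ⟨s, t⟩ ⟨rfl, ht⟩ hq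
    have : p.1 ^ 2 ≤ t := hT hq
    have : t ≤ p.2 := ht
    linarith
  intro hbdd
  have hprod := (Bornology.isBounded_prod_of_nonempty
    (Set.singleton_nonempty p.1 |>.prod Set.nonempty_Iic)).1 (hbdd.subset hray)
  exact not_bddBelow_Iic _ hprod.2.bddBelow

theorem parabola_mem_closure (t : ℝ) : parabola t ∈ closure {p : ℝ × ℝ | p.2 < p.1 ^ 2} := by
  have hcont : Continuous fun e : ℝ => ((t, t ^ 2 - e) : ℝ × ℝ) := by fun_prop
  refine mem_closure_of_tendsto (b := nhdsWithin (0 : ℝ) (Set.Ioi 0))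
    ((hcont.tendsto' 0 _ (by simp [parabola])).mono_left nhdsWithin_le_nhds) ?_
  filter_upwards [self_mem_nhdsWithin] with e he
  have : (0 : ℝ) < e := he
  simpa using this

end Parabola

/-- A noncrossing vertex order yields an outerplanar straight-line drawing on a parabola. -/
theorem NoncrossingOn.isOuterplanar {F : Finset V} (h : G.NoncrossingOn F) :
    IsOuterplanar (G.induce (F : Set V)) := by
  obtain ⟨f, hinj, hf⟩ := h
  have hne : ∀ {u v : (F : Set V)}, (G.induce (F : Set V)).Adj u v → f u ≠ f v := fun {u v} huv h =>
    huv.ne (Subtype.ext (hinj u.2 v.2 h))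
  have hvtx : Function.Injective fun v : (F : Set V) => parabola (f v) := fun u v huv =>
    Subtype.ext (hinj u.2 v.2 (by exact_mod_cast parabola_injective huv))
  have inter : ∀ {u v a b : (F : Set V)}, (G.induce (F : Set V)).Adj u v →
      (G.induce (F : Set V)).Adj a b → s(u, v) ≠ s(a, b) → f u < f v → f a < f b →
      ∀ {p : ℝ × ℝ}, p ∈ segment ℝ (parabola (f u)) (parabola (f v)) →
      p ∈ segment ℝ (parabola (f a)) (parabola (f b)) →
      (p = parabola (f u) ∨ p = parabola (f v)) ∧ (p = parabola (f a) ∨ p = parabola (f b)) := by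
    intro u v a b huv hab hne' hlt₁ hlt₂ p hp₁ hp₂
    refine chord_inter (by exact_mod_cast hlt₁) (by exact_mod_cast hlt₂) ?_ ?_ ?_ hp₁ hp₂
    · rintro ⟨h₁, h₂⟩
      refine hne' ?_
      rw [Subtype.ext (hinj u.2 a.2 (by exact_mod_cast h₁)),
        Subtype.ext (hinj v.2 b.2 (by exact_mod_cast h₂))]
    · rintro ⟨h₁, h₂, h₃⟩
      exact hf u u.2 v v.2 a a.2 b b.2 (by exact_mod_cast h₁) (by exact_mod_cast h₂)
        (by exact_mod_cast h₃) huv hab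
    · rintro ⟨h₁, h₂, h₃⟩
      exact hf a a.2 b b.2 u u.2 v v.2 (by exact_mod_cast h₁) (by exact_mod_cast h₂)
        (by exact_mod_cast h₃) hab huv
  let E : PlaneEmbedding (G.induce (F : Set V)) :=
    { vtx := fun v => parabola (f v)
      vtx_inj := hvtx
      arc := fun u v _ => segment ℝ (parabola (f u)) (parabola (f v))
      arc_symm := fun u v _ => segment_symm ℝ _ _
      arc_path := fun u v huv => ⟨Path.segment _ _,
        Path.segment_injective_of_ne (hvtx.ne huv.ne), Path.range_segment _ _⟩
      arc_vtx := fun u v huv w hw => by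
        obtain ⟨h, -⟩ := chord_eq hw
        refine (eq_parabola_of_mul_eq_zero h ?_).imp (fun h => hvtx h) (fun h => hvtx h)
        rw [← h]
        simp [parabola]
      arc_inter := by
        rintro u v a b huv hab hne' p ⟨hp₁, hp₂⟩
        rcases (hne huv).lt_or_gt with h₁ | h₁ <;> rcases (hne hab).lt_or_gt with h₂ | h₂
        · exact inter huv hab hne' h₁ h₂ hp₁ hp₂
        · rw [segment_symm] at hp₂
          exact (inter huv hab.symm (by rwa [Sym2.eq_swap (a := b)]) h₁ h₂ hp₁ hp₂).imp_right
            Or.symm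
        · rw [segment_symm] at hp₁
          exact (inter huv.symm hab (by rwa [Sym2.eq_swap (a := v)]) h₁ h₂ hp₁ hp₂).imp_left
            Or.symm
        · rw [segment_symm] at hp₁ hp₂
          exact (inter huv.symm hab.symm
            (by rwa [Sym2.eq_swap (a := v), Sym2.eq_swap (a := b)]) h₁ h₂ hp₁ hp₂).imp
            Or.symm Or.symm }
  have hsupp : E.subSupport Set.univ ⊆ {p | p.1 ^ 2 ≤ p.2} := by
    rintro p (⟨v, -, rfl⟩ | hp)
    · exact le_refl ((f v : ℝ) ^ 2)
    · simp only [Set.mem_iUnion] at hp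
      obtain ⟨u, -, v, -, huv, hp⟩ := hp
      obtain ⟨h₁, h₂⟩ := chord_eq hp
      exact sub_nonneg.1 (h₁ ▸ h₂)
  refine ⟨E, fun v _ => closure_mono ?_ (parabola_mem_closure (f v))⟩
  intro p hp
  exact ⟨fun h => not_lt_of_ge (show p.1 ^ 2 ≤ p.2 from hsupp h) hp,
    not_isBounded_connectedComponentIn_compl hsupp hp⟩

end SimpleGraph

/-- For every planar graph `G`, `(4/5)·s_{K₄}(G) ≤ s_o(G)`. -/
theorem stmt10 (V : Type) [Fintype V] (G : SimpleGraph V) (hG : IsPlanar G) :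
    (4 / 5 : ℚ) * (sK4 G : ℚ) ≤ (sO G : ℚ) := by
  classical
  obtain ⟨S, hS, hcard⟩ : sK4 G ∈
      {n | ∃ S : Finset V, K4MinorFree (G.induce (↑S : Set V)) ∧ S.card = n} := by
    refine Nat.sSup_mem ⟨0, ∅, ?_, rfl⟩ ⟨Fintype.card V, ?_⟩
    · rintro ⟨B, hB, -⟩
      obtain ⟨v, -⟩ := hB 0
      exact absurd v.2 (by simp)
    · rintro n ⟨S, -, rfl⟩
      exact Finset.card_le_univ S
  obtain ⟨X, hXS, hX, hout⟩ :=
    (SimpleGraph.K4MinorFreeOn.of_induce hS).exists_noncrossingOn_sdiff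
  have hle : (S \ X).card ≤ sO G := by
    refine le_csSup ⟨Fintype.card V, ?_⟩ ⟨S \ X, hout.isOuterplanar, rfl⟩
    rintro n ⟨T, -, rfl⟩
    exact Finset.card_le_univ T
  have hsdiff := Finset.card_sdiff_add_card_eq_card hXS
  have : 4 * sK4 G ≤ 5 * sO G := by omega
  have : (4 : ℚ) * sK4 G ≤ 5 * sO G := by exact_mod_cast this
  linarith
end
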